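/- arXiv:math/0401248 — 2 statements merged into one kernel-verified Lean document; each statement's English description precedes it below -/
import Mathlib

section
/- For every block size l there is a constant C (possibly depending on l) such that, for every δ ∈ ℝ with c̃(n) := c(n) − δn, every L that is a multiple m·l, every N ≥ 1 and every f ≥ 0: ( ν_Λ^N[ ν_Λ^N[ f , Σ_{x∈Λ} c̃(η_x) | G ] ] )² ≤ C N ν_Λ^N[f] ν_Λ^N[ Ent_{ν_Λ^N[·|G]}(f) ]. -/
open scoped BigOperators

noncomputable section

/-- `cfact c k = c(k)! = c(1)⋯c(k)`, with `cfact c 0 = 1`. -/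
def cfact (c : ℕ → ℝ) : ℕ → ℝ
  | 0 => 1
  | k + 1 => cfact c k * c (k + 1)

/-- The configuration obtained from `η` by moving one particle from `x` to `y` (`x ≠ y`),
i.e. `η - δ^x + δ^y`. -/
def move (η : ℤ → ℕ) (x y : ℤ) : ℤ → ℕ :=
  fun z => if z = x then η x - 1 else if z = y then η y + 1 else η z

/-- Unnormalized weight of the canonical measure `ν_Λ^N` on configurations supported in `Λ`
with `N` particles: `∏_{x∈Λ} 1/c(η_x)!`. -/
def nuW (c : ℕ → ℝ) (Λ : Finset ℤ) (N : ℕ) : (ℤ → ℕ) → ℝ :=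
  Set.indicator {η : ℤ → ℕ | (∀ x, x ∉ Λ → η x = 0) ∧ (∑ x ∈ Λ, η x) = N}
    (fun η => ∏ x ∈ Λ, (cfact c (η x))⁻¹)

/-- Expectation with respect to the probability measure obtained by normalizing the
nonnegative weight `w`. -/
def wE (w f : (ℤ → ℕ) → ℝ) : ℝ :=
  (∑' η : ℤ → ℕ, w η * f η) / (∑' η : ℤ → ℕ, w η)

/-- Covariance `μ[f,g] = μ[f g] - μ[f] μ[g]`. -/
def wCov (w f g : (ℤ → ℕ) → ℝ) : ℝ :=
  wE w (fun η => f η * g η) - wE w f * wE w g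

/-- Entropy `Ent_μ(f) = μ[f log f] - μ[f] log μ[f]` (note `Real.log 0 = 0`, giving the
convention `0 log 0 = 0`). -/
def wEnt (w f : (ℤ → ℕ) → ℝ) : ℝ :=
  wE w (fun η => f η * Real.log (f η)) - wE w f * Real.log (wE w f)

/-- Dirichlet form of the zero-range process on `Λ`:
`E(f,g) = (1/2) Σ_{x∈Λ} Σ_{y∈Λ, |x-y|=1} μ[c(η_x) ∂_{xy}f ∂_{xy}g]`. -/
def wDir (c : ℕ → ℝ) (Λ : Finset ℤ) (w f g : (ℤ → ℕ) → ℝ) : ℝ :=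
  wE w (fun η => (1 / 2) * ∑ x ∈ Λ, ∑ y ∈ Λ,
    if |x - y| = 1 then c (η x) * ((f (move η x y) - f η) * (g (move η x y) - g η)) else 0)

/-- Weight conditioned on the event `∑_{x ∈ Λ₁} η x = n`. -/
def condW (w : (ℤ → ℕ) → ℝ) (Λ₁ : Finset ℤ) (n : ℕ) : (ℤ → ℕ) → ℝ :=
  Set.indicator {η : ℤ → ℕ | (∑ x ∈ Λ₁, η x) = n} w

/-- `h(n) = (n+1)/c(n+1)`. -/
def hfun (c : ℕ → ℝ) (n : ℕ) : ℝ := (n + 1) / c (n + 1)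

/-- The block `C_{k+1} = [a + k l, a + (k+1) l) ∩ ℤ`. -/
def blockC (a : ℤ) (l k : ℕ) : Finset ℤ :=
  Finset.Ico (a + (k : ℤ) * (l : ℤ)) (a + ((k : ℤ) + 1) * (l : ℤ))

/-- Weight of the canonical measure conditioned on the σ-field `G` generated by the block
totals `η̄_{C₁}, …, η̄_{C_m}`: evaluated at the block profile of `η₀`. -/
def blockW (w : (ℤ → ℕ) → ℝ) (a : ℤ) (l m : ℕ) (η₀ : ℤ → ℕ) : (ℤ → ℕ) → ℝ :=
  Set.indicator {η : ℤ → ℕ | ∀ k ∈ Finset.range m,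
    (∑ x ∈ blockC a l k, η x) = ∑ x ∈ blockC a l k, η₀ x} w

/-- Elementary inequality behind the sub-Gaussian estimate. -/
lemma exp_le_add_exp_sq (x : ℝ) : Real.exp x ≤ x + Real.exp (x ^ 2) := by
  have h1 := Real.add_one_le_exp (x ^ 2)
  by_cases hx : |x| ≤ 1
  · have := Real.abs_exp_sub_one_sub_id_le hx
    have := (abs_le.mp this).2
    linarith
  · push Not at hx
    rcases lt_abs.mp hx with h | h
    · have : Real.exp x ≤ Real.exp (x ^ 2) := Real.exp_le_exp.mpr (by nlinarith)
      linarith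
    · have : Real.exp x ≤ 1 := Real.exp_le_one_iff.mpr (by linarith)
      nlinarith

/-- From a Gaussian-square moment to a centred sub-Gaussian bound. -/
lemma subgauss_of_sq {α : Type*} (S : Finset α) (p X : α → ℝ) (μ D : ℝ) (hμ : 0 < μ)
    (hp : ∀ i ∈ S, 0 ≤ p i) (hsum : ∑ i ∈ S, p i = 1)
    (hD : ∑ i ∈ S, p i * Real.exp (μ * X i ^ 2) ≤ D) (t : ℝ) :
    ∑ i ∈ S, p i * Real.exp (t * (X i - ∑ j ∈ S, p j * X j))
      ≤ Real.exp (2 * Real.exp (2 * D) / μ * t ^ 2) := by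
  set m := ∑ j ∈ S, p j * X j with hm
  have hm2 : μ * m ^ 2 ≤ D := by
    have h0 : 0 ≤ ∑ i ∈ S, p i * (X i - m) ^ 2 :=
      Finset.sum_nonneg fun i hi => mul_nonneg (hp i hi) (sq_nonneg _)
    have h1 : ∑ i ∈ S, p i * (X i - m) ^ 2 = ∑ i ∈ S, p i * X i ^ 2 - m ^ 2 := by
      have : ∀ i, p i * (X i - m) ^ 2 = p i * X i ^ 2 - 2 * m * (p i * X i) + m ^ 2 * p i := by
        intro i; ring
      simp only [this, Finset.sum_add_distrib, Finset.sum_sub_distrib, ← Finset.mul_sum, hsum, ← hm]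
      ring
    have h2 : ∑ i ∈ S, p i * (μ * X i ^ 2) ≤ ∑ i ∈ S, p i * Real.exp (μ * X i ^ 2) :=
      Finset.sum_le_sum fun i hi => mul_le_mul_of_nonneg_left
        (by linarith [Real.add_one_le_exp (μ * X i ^ 2)]) (hp i hi)
    have h3 : ∑ i ∈ S, p i * (μ * X i ^ 2) = μ * ∑ i ∈ S, p i * X i ^ 2 := by
      rw [Finset.mul_sum]; exact Finset.sum_congr rfl fun i _ => by ring
    nlinarith
  have hD0 : 0 ≤ D := le_trans (by positivity) hm2
  have hDe : D ≤ Real.exp D := by linarith [Real.add_one_le_exp D]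
  have hκ : ∑ i ∈ S, p i * Real.exp (μ / 2 * (X i - m) ^ 2) ≤ Real.exp (2 * D) := by
    calc _ ≤ ∑ i ∈ S, p i * Real.exp (μ * X i ^ 2) * Real.exp D := by
          refine Finset.sum_le_sum fun i hi => ?_
          rw [mul_assoc, ← Real.exp_add]
          refine mul_le_mul_of_nonneg_left (Real.exp_le_exp.mpr ?_) (hp i hi)
          nlinarith [sq_nonneg (X i + m)]
      _ ≤ Real.exp D * Real.exp D := by
          rw [← Finset.sum_mul]
          exact mul_le_mul_of_nonneg_right (hD.trans hDe) (Real.exp_pos _).le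
      _ = _ := by rw [← Real.exp_add]; ring_nf
  set B := 2 * D with hB
  have hBe := Real.add_one_le_exp B
  by_cases ht : t ^ 2 ≤ μ / 2
  · set r := t ^ 2 / (μ / 2) with hr
    have hr0 : 0 ≤ r := by positivity
    have hr1 : r ≤ 1 := by rw [hr, div_le_one (by positivity)]; exact ht
    have htr : t ^ 2 = r * (μ / 2) := by rw [hr]; field_simp
    have hc : ∀ z : ℝ, Real.exp (r * z) ≤ 1 - r + r * Real.exp z := by
      intro z
      have := convexOn_exp.2 (Set.mem_univ (0:ℝ)) (Set.mem_univ z)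
        (show (0:ℝ) ≤ 1 - r by linarith) hr0 (by ring)
      simpa using this
    calc _ ≤ ∑ i ∈ S, (t * (p i * X i) - t * m * p i + ((1 - r) * p i
            + r * (p i * Real.exp (μ / 2 * (X i - m) ^ 2)))) := by
          refine Finset.sum_le_sum fun i hi => ?_
          have h1 := exp_le_add_exp_sq (t * (X i - m))
          have h2 := hc (μ / 2 * (X i - m) ^ 2)
          have h3 : (t * (X i - m)) ^ 2 = r * (μ / 2 * (X i - m) ^ 2) := by
            rw [mul_pow, htr]; ring
          rw [h3] at h1
          have := mul_le_mul_of_nonneg_left (h1.trans (add_le_add_right h2 _)) (hp i hi)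
          refine this.trans (le_of_eq ?_)
          ring
      _ = 1 - r + r * ∑ i ∈ S, p i * Real.exp (μ / 2 * (X i - m) ^ 2) := by
          simp only [Finset.sum_add_distrib, Finset.sum_sub_distrib, ← Finset.mul_sum, hsum, ← hm]
          ring
      _ ≤ 1 + r * Real.exp B := by nlinarith
      _ ≤ Real.exp (r * Real.exp B) := by linarith [Real.add_one_le_exp (r * Real.exp B)]
      _ = _ := by congr 1; rw [hr]; field_simp
  · push Not at ht
    calc _ ≤ ∑ i ∈ S, Real.exp (t ^ 2 / (4 * (μ / 2))) * (p i * Real.exp (μ / 2 * (X i - m) ^ 2)) := by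
          refine Finset.sum_le_sum fun i hi => ?_
          rw [mul_left_comm, ← Real.exp_add]
          refine mul_le_mul_of_nonneg_left (Real.exp_le_exp.mpr ?_) (hp i hi)
          have : t ^ 2 / (4 * (μ / 2)) + μ / 2 * (X i - m) ^ 2 - t * (X i - m)
            = (t - μ * (X i - m)) ^ 2 / (4 * (μ / 2)) := by field_simp; ring
          have h2 : 0 ≤ (t - μ * (X i - m)) ^ 2 / (4 * (μ / 2)) := by positivity
          linarith
      _ ≤ Real.exp (t ^ 2 / (4 * (μ / 2))) * Real.exp B := by
          rw [← Finset.mul_sum]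
          exact mul_le_mul_of_nonneg_left hκ (Real.exp_pos _).le
      _ ≤ _ := by
          rw [← Real.exp_add]
          refine Real.exp_le_exp.mpr ?_
          have h1 : 1 ≤ t ^ 2 / (μ / 2) := by rw [one_le_div (by positivity)]; exact ht.le
          have e1 : t ^ 2 / (4 * (μ / 2)) = (t ^ 2 / (μ / 2)) / 4 := by field_simp
          have e2 : 2 * Real.exp B / μ * t ^ 2 = Real.exp B * (t ^ 2 / (μ / 2)) := by field_simp
          rw [e1, e2]
          have hB0 : 0 ≤ B := by positivity
          nlinarith

/-- Entropy (Donsker–Varadhan) inequality for a finite weight. -/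
lemma entropy_ineq {α : Type*} (S : Finset α) (p f h : α → ℝ) (K : ℝ)
    (hp : ∀ i ∈ S, 0 ≤ p i) (hsum : ∑ i ∈ S, p i = 1) (hf : ∀ i, 0 ≤ f i)
    (hK : ∑ i ∈ S, p i * Real.exp (h i) ≤ Real.exp K) :
    ∑ i ∈ S, p i * (f i * h i) - K * ∑ i ∈ S, p i * f i ≤
      ∑ i ∈ S, p i * (f i * Real.log (f i))
        - (∑ i ∈ S, p i * f i) * Real.log (∑ i ∈ S, p i * f i) := by
  set F := ∑ i ∈ S, p i * f i with hF
  have hF0 : 0 ≤ F := Finset.sum_nonneg fun i hi => mul_nonneg (hp i hi) (hf i)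
  rcases hF0.eq_or_lt with h0 | hpos
  · have hz := (Finset.sum_eq_zero_iff_of_nonneg
      (fun i hi => mul_nonneg (hp i hi) (hf i))).mp h0.symm
    have z1 : ∀ g : α → ℝ, ∑ i ∈ S, p i * (f i * g i) = 0 := fun g =>
      Finset.sum_eq_zero fun i hi => by rw [← mul_assoc, hz i hi, zero_mul]
    rw [z1, z1 fun i => Real.log (f i), ← h0]; simp
  · have key : ∀ i, f i * h i - K * f i ≤ f i * Real.log (f i) - f i * Real.log F - f i
        + F * Real.exp (-K) * Real.exp (h i) := by
      intro i
      rcases (hf i).eq_or_lt with h1 | h1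
      · rw [← h1]; simp; positivity
      · have := Real.add_one_le_exp (h i - K - Real.log (f i) + Real.log F)
        have e : Real.exp (h i - K - Real.log (f i) + Real.log F)
            = F * Real.exp (-K) * Real.exp (h i) / f i := by
          rw [Real.exp_add, Real.exp_sub, Real.exp_sub, Real.exp_log hpos, Real.exp_log h1,
            Real.exp_neg]; field_simp
        rw [e, le_div_iff₀ h1] at this
        nlinarith
    have s := Finset.sum_le_sum fun i hi => mul_le_mul_of_nonneg_left (key i) (hp i hi)
    have e1 : ∑ i ∈ S, p i * (f i * h i - K * f i) = ∑ i ∈ S, p i * (f i * h i) - K * F := by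
      rw [hF, Finset.mul_sum, ← Finset.sum_sub_distrib]
      exact Finset.sum_congr rfl fun i _ => by ring
    have e2 : ∑ i ∈ S, p i * (f i * Real.log (f i) - f i * Real.log F - f i
        + F * Real.exp (-K) * Real.exp (h i)) = ∑ i ∈ S, p i * (f i * Real.log (f i))
        - F * Real.log F - F + F * Real.exp (-K) * ∑ i ∈ S, p i * Real.exp (h i) := by
      have : ∀ i, p i * (f i * Real.log (f i) - f i * Real.log F - f i
        + F * Real.exp (-K) * Real.exp (h i)) = p i * (f i * Real.log (f i))
        - Real.log F * (p i * f i) - p i * f i + F * Real.exp (-K) * (p i * Real.exp (h i)) := by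
        intro i; ring
      simp only [this, Finset.sum_add_distrib, Finset.sum_sub_distrib, ← Finset.mul_sum, ← hF]
      ring
    rw [e1, e2] at s
    have : F * Real.exp (-K) * ∑ i ∈ S, p i * Real.exp (h i) ≤ F * Real.exp (-K) * Real.exp K :=
      mul_le_mul_of_nonneg_left hK (by positivity)
    have e3 : F * Real.exp (-K) * Real.exp K = F := by rw [mul_assoc, ← Real.exp_add]; simp
    rw [e3] at this
    linarith

/-- Centred form of the entropy inequality: a covariance bound. -/
lemma cov_entropy {α : Type*} (S : Finset α) (p f g : α → ℝ) (M Q : ℝ) (hQ : 0 ≤ Q)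
    (hp : ∀ i ∈ S, 0 ≤ p i) (hsum : ∑ i ∈ S, p i = 1) (hf : ∀ i, 0 ≤ f i)
    (hK : ∀ t : ℝ, ∑ i ∈ S, p i * Real.exp (t * g i) ≤ Real.exp (t * M + Q * t ^ 2)) (t : ℝ) :
    t * (∑ i ∈ S, p i * (f i * g i) - (∑ i ∈ S, p i * f i) * ∑ i ∈ S, p i * g i) ≤
      (∑ i ∈ S, p i * (f i * Real.log (f i))
        - (∑ i ∈ S, p i * f i) * Real.log (∑ i ∈ S, p i * f i))
      + Q * t ^ 2 * ∑ i ∈ S, p i * f i := by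
  have hM : ∑ i ∈ S, p i * g i = M := by
    have h : ∀ t : ℝ, t * (∑ i ∈ S, p i * g i - M) ≤ Q * t ^ 2 := by
      intro t
      have := entropy_ineq S p (fun _ => 1) (fun i => t * g i) _ hp hsum (by simp) (hK t)
      simp only [one_mul, mul_one, hsum, Real.log_one, mul_zero, Finset.sum_const_zero,
        sub_zero] at this
      have e : ∑ i ∈ S, p i * (t * g i) = t * ∑ i ∈ S, p i * g i := by
        rw [Finset.mul_sum]; exact Finset.sum_congr rfl fun i _ => by ring
      rw [e] at this; linarith
    set Δ := ∑ i ∈ S, p i * g i - M with hΔ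
    have h1 := h (Δ / (Q + 1))
    have : Δ ^ 2 / (Q + 1) ≤ Q / (Q + 1) * (Δ ^ 2 / (Q + 1)) := by
      calc _ = Δ / (Q + 1) * Δ := by ring
        _ ≤ _ := h1
        _ = _ := by field_simp
    have hq : Q / (Q + 1) < 1 := by rw [div_lt_one (by positivity)]; linarith
    have h0 : 0 ≤ Δ ^ 2 / (Q + 1) := by positivity
    have h2 : Δ ^ 2 / (Q + 1) = 0 := by nlinarith
    have h3 : Δ ^ 2 = 0 := by
      rcases div_eq_zero_iff.mp h2 with h | h
      · exact h
      · linarith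
    have := pow_eq_zero_iff (two_ne_zero) |>.mp h3
    linarith
  have := entropy_ineq S p f (fun i => t * g i) _ hp hsum hf (hK t)
  have e : ∑ i ∈ S, p i * (f i * (t * g i)) = t * ∑ i ∈ S, p i * (f i * g i) := by
    rw [Finset.mul_sum]; exact Finset.sum_congr rfl fun i _ => by ring
  rw [e] at this
  rw [hM]
  linarith

lemma cfact_pos (c : ℕ → ℝ) (hcpos : ∀ n : ℕ, 0 < n → 0 < c n) (k : ℕ) : 0 < cfact c k := by
  induction k with
  | zero => simp [cfact]
  | succ k ih => exact mul_pos ih (hcpos _ (Nat.succ_pos _))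

/-- The unnormalized product weight. -/
def pw (c : ℕ → ℝ) (C : Finset ℤ) (η : ℤ → ℕ) : ℝ := ∏ x ∈ C, (cfact c (η x))⁻¹

lemma pw_pos (c : ℕ → ℝ) (hcpos : ∀ n : ℕ, 0 < n → 0 < c n) (C : Finset ℤ) (η : ℤ → ℕ) :
    0 < pw c C η := Finset.prod_pos fun _ _ => inv_pos.mpr (cfact_pos c hcpos _)

lemma move_same (η : ℤ → ℕ) (x y : ℤ) : move η x y x = η x - 1 := by simp [move]

lemma move_tgt (η : ℤ → ℕ) {x y : ℤ} (h : x ≠ y) : move η x y y = η y + 1 := by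
  simp [move, h.symm]

lemma move_other (η : ℤ → ℕ) {x y z : ℤ} (h : z ≠ x) (h' : z ≠ y) : move η x y z = η z := by
  simp [move, h, h']

lemma move_move (η : ℤ → ℕ) {x y : ℤ} (h : x ≠ y) (hx : η x ≠ 0) :
    move (move η x y) y x = η := by
  funext z
  by_cases hz : z = x
  · subst hz; rw [move_tgt _ h.symm, move_same]; omega
  · by_cases hz' : z = y
    · subst hz'; rw [move_same, move_tgt _ h]; omega
    · rw [move_other _ hz' hz, move_other _ hz hz']

lemma split_pair {M : Type*} [CommMonoid M] (C : Finset ℤ) {x y : ℤ} (hx : x ∈ C) (hy : y ∈ C)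
    (h : x ≠ y) (F : ℤ → M) :
    ∏ z ∈ C, F z = F x * (F y * ∏ z ∈ (C.erase x).erase y, F z) := by
  rw [← Finset.mul_prod_erase C F hx,
    ← Finset.mul_prod_erase (C.erase x) F (Finset.mem_erase.mpr ⟨h.symm, hy⟩)]

lemma split_pair_sum (C : Finset ℤ) {x y : ℤ} (hx : x ∈ C) (hy : y ∈ C)
    (h : x ≠ y) (F : ℤ → ℕ) :
    ∑ z ∈ C, F z = F x + (F y + ∑ z ∈ (C.erase x).erase y, F z) := by
  rw [← Finset.add_sum_erase C F hx,
    ← Finset.add_sum_erase (C.erase x) F (Finset.mem_erase.mpr ⟨h.symm, hy⟩)]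

lemma move_mem (C : Finset ℤ) (n : ℕ) {x y : ℤ} (hx : x ∈ C) (hy : y ∈ C)
    (h : x ≠ y) (η : ℤ → ℕ) (hη : η ∈ Finset.piAntidiag C n) (h0 : η x ≠ 0) :
    move η x y ∈ Finset.piAntidiag C n := by
  rw [Finset.mem_piAntidiag] at hη ⊢
  obtain ⟨h1, h2⟩ := hη
  constructor
  · rw [split_pair_sum C hx hy h] at h1 ⊢
    rw [move_same, move_tgt _ h]
    have : ∑ z ∈ (C.erase x).erase y, move η x y z = ∑ z ∈ (C.erase x).erase y, η z := by
      refine Finset.sum_congr rfl fun z hz => ?_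
      simp only [Finset.mem_erase] at hz
      exact move_other _ hz.2.1 hz.1
    rw [this]; omega
  · intro z hz
    by_cases hzx : z = x
    · rw [hzx]; exact hx
    · by_cases hzy : z = y
      · rw [hzy]; exact hy
      · rw [move_other _ hzx hzy] at hz; exact h2 z hz

lemma pw_move (c : ℕ → ℝ) (hcpos : ∀ n : ℕ, 0 < n → 0 < c n) (C : Finset ℤ) {x y : ℤ}
    (hx : x ∈ C) (hy : y ∈ C) (h : x ≠ y) (η : ℤ → ℕ) (h0 : η x ≠ 0) :
    pw c C (move η x y) * c (move η x y y) = pw c C η * c (η x) := by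
  unfold pw
  rw [split_pair C hx hy h, split_pair C hx hy h (fun z => (cfact c (η z))⁻¹)]
  have : ∏ z ∈ (C.erase x).erase y, (cfact c (move η x y z))⁻¹
      = ∏ z ∈ (C.erase x).erase y, (cfact c (η z))⁻¹ := by
    refine Finset.prod_congr rfl fun z hz => ?_
    simp only [Finset.mem_erase] at hz
    rw [move_other _ hz.2.1 hz.1]
  rw [this, move_same, move_tgt _ h]
  obtain ⟨k, hk⟩ := Nat.exists_eq_succ_of_ne_zero h0
  rw [hk]
  simp only [Nat.succ_eq_add_one, Nat.add_sub_cancel, cfact]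
  have a1 := (cfact_pos c hcpos k).ne'
  have a2 := (hcpos (k+1) (by omega)).ne'
  have a3 := (cfact_pos c hcpos (η y)).ne'
  have a4 := (hcpos (η y+1) (by omega)).ne'
  field_simp

/-- Detailed balance / integration by parts for the canonical measure. -/
lemma ibp (c : ℕ → ℝ) (hc0 : c 0 = 0) (hcpos : ∀ n : ℕ, 0 < n → 0 < c n)
    (C : Finset ℤ) (n : ℕ) {x y : ℤ}
    (hx : x ∈ C) (hy : y ∈ C) (h : x ≠ y) (F : (ℤ → ℕ) → ℝ) :
    ∑ η ∈ Finset.piAntidiag C n, pw c C η * (c (η x) * F (move η x y))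
      = ∑ η ∈ Finset.piAntidiag C n, pw c C η * (c (η y) * F η) := by
  rw [← Finset.sum_filter_of_ne (p := fun η => η x ≠ 0),
    ← Finset.sum_filter_of_ne (s := Finset.piAntidiag C n) (p := fun η => η y ≠ 0)]
  · refine Finset.sum_nbij' (fun η => move η x y) (fun η => move η y x) ?_ ?_ ?_ ?_ ?_
    · intro η hη
      rw [Finset.mem_filter] at hη ⊢
      exact ⟨move_mem C n hx hy h η hη.1 hη.2, by rw [move_tgt _ h]; omega⟩
    · intro η hη
      rw [Finset.mem_filter] at hη ⊢
      exact ⟨move_mem C n hy hx h.symm η hη.1 hη.2, by rw [move_tgt _ h.symm]; omega⟩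
    · intro η hη
      rw [Finset.mem_filter] at hη
      exact move_move η h hη.2
    · intro η hη
      rw [Finset.mem_filter] at hη
      exact move_move η h.symm hη.2
    · intro η hη
      rw [Finset.mem_filter] at hη
      rw [← mul_assoc, ← mul_assoc, pw_move c hcpos C hx hy h η hη.2]
  · intro η _ hne h0; apply hne; rw [h0, hc0]; ring
  · intro η _ hne h0; apply hne; rw [h0, hc0]; ring

lemma c_lip (c : ℕ → ℝ) (a₁ : ℝ) (hLG : ∀ k : ℕ, |c (k + 1) - c k| ≤ a₁) (j r : ℕ) :
    |c (j + r) - c j| ≤ a₁ * r := by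
  induction r with
  | zero => simp
  | succ r ih =>
    have h1 := abs_add_le (c (j + r + 1) - c (j + r)) (c (j + r) - c j)
    have h2 := hLG (j + r)
    rw [show c (j + r + 1) - c (j + r) + (c (j + r) - c j) = c (j + (r+1)) - c j by
      rw [← add_assoc]; ring] at h1
    push_cast
    linarith

lemma c_lip' (c : ℕ → ℝ) (a₁ : ℝ) (hLG : ∀ k : ℕ, |c (k + 1) - c k| ≤ a₁) (j k : ℕ) :
    |c k - c j| ≤ a₁ * |(k : ℝ) - j| := by
  rcases le_total j k with h | h
  · obtain ⟨r, rfl⟩ := Nat.exists_eq_add_of_le h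
    have := c_lip c a₁ hLG j r
    push_cast
    rwa [add_sub_cancel_left, Nat.abs_cast]
  · obtain ⟨r, rfl⟩ := Nat.exists_eq_add_of_le h
    have := c_lip c a₁ hLG k r
    push_cast
    rw [abs_sub_comm (c k), abs_sub_comm (k : ℝ)]
    rwa [add_sub_cancel_left, Nat.abs_cast]

lemma c_grow (c : ℕ → ℝ) (a₁ a₂ : ℝ) (k₀ : ℕ) (hLG : ∀ k : ℕ, |c (k + 1) - c k| ≤ a₁)
    (hk₀ : 0 < k₀) (ha₂ : 0 < a₂) (hM : ∀ j k : ℕ, j + k₀ ≤ k → a₂ ≤ c k - c j)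
    (j k : ℕ) (hjk : j ≤ k) :
    a₂ / k₀ * ((k : ℝ) - j) - (a₂ + a₁ * k₀) ≤ c k - c j := by
  have ha₁ : 0 ≤ a₁ := (abs_nonneg _).trans (hLG 0)
  obtain ⟨d, rfl⟩ := Nat.exists_eq_add_of_le hjk
  have hk : (0:ℝ) < k₀ := by exact_mod_cast hk₀
  have step : ∀ q j : ℕ, a₂ * q ≤ c (j + k₀ * q) - c j := by
    intro q
    induction q with
    | zero => intro j; simp
    | succ q ih =>
      intro j
      have h1 := ih j
      have h2 := hM (j + k₀ * q) (j + k₀ * (q+1)) (by rw [mul_add]; omega)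
      push_cast
      linarith
  have h1 := step (d / k₀) (j + d % k₀)
  have h2 := (abs_le.mp (c_lip c a₁ hLG j (d % k₀))).1
  have hd : d % k₀ + k₀ * (d / k₀) = d := Nat.mod_add_div d k₀
  rw [add_assoc, hd] at h1
  have hlt : ((d % k₀ : ℕ) : ℝ) ≤ k₀ := by exact_mod_cast (Nat.mod_lt d hk₀).le
  have hdr : ((d % k₀ : ℕ) : ℝ) + k₀ * ((d / k₀ : ℕ) : ℝ) = d := by exact_mod_cast hd
  have h3 : a₂ / k₀ * (d : ℝ) ≤ a₂ * ((d / k₀ : ℕ) : ℝ) + a₂ := by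
    rw [← hdr]
    have : a₂ / k₀ * (((d % k₀ : ℕ) : ℝ) + k₀ * ((d / k₀ : ℕ) : ℝ)) =
      a₂ / k₀ * ((d % k₀ : ℕ) : ℝ) + a₂ * ((d / k₀ : ℕ) : ℝ) := by field_simp
    rw [this]
    have : a₂ / k₀ * ((d % k₀ : ℕ) : ℝ) ≤ a₂ / k₀ * k₀ :=
      mul_le_mul_of_nonneg_left hlt (by positivity)
    rw [div_mul_cancel₀ _ hk.ne'] at this
    linarith
  have h4 : a₁ * ((d % k₀ : ℕ) : ℝ) ≤ a₁ * k₀ := mul_le_mul_of_nonneg_left hlt ha₁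
  push_cast
  rw [add_sub_cancel_left]
  linarith

/-- The drift inequality, in purely real terms. -/
lemma drift_real (a₁ b e θ n : ℝ) (ha₁ : 0 ≤ a₁) (he : 0 ≤ e) (hθ : 0 < θ) (hθ8 : θ ≤ 1 / 8)
    (hθb : 16 * θ * a₁ ≤ b) (hn : 1 ≤ n) (d cu cv : ℝ) (hd : |d| ≤ n)
    (hcu : 0 ≤ cu) (hcv : 0 ≤ cv) (hcs : cu + cv ≤ a₁ * n)
    (hdc : b * d ^ 2 - e * |d| ≤ d * (cu - cv)) :
    cu * (Real.exp (θ / n * (d - 2) ^ 2) - Real.exp (θ / n * d ^ 2))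
      + cv * (Real.exp (θ / n * (d + 2) ^ 2) - Real.exp (θ / n * d ^ 2))
    ≤ Real.exp (θ / n * d ^ 2) * ((4 * e + 36 * a₁) * θ - 2 * b * (θ / n * d ^ 2)) := by
  set lam := θ / n with hlam
  have hn0 : 0 < n := by linarith
  have hl0 : 0 < lam := by positivity
  have hln : lam * n = θ := by rw [hlam]; field_simp
  have hlθ : lam ≤ θ := by nlinarith
  have hld : lam * |d| ≤ θ := by nlinarith
  have e1 : Real.exp (lam * (d - 2) ^ 2) = Real.exp (lam * d ^ 2) * Real.exp (-4 * lam * (d - 1)) := by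
    rw [← Real.exp_add]; ring_nf
  have e2 : Real.exp (lam * (d + 2) ^ 2) = Real.exp (lam * d ^ 2) * Real.exp (4 * lam * (d + 1)) := by
    rw [← Real.exp_add]; ring_nf
  have hd1 : lam * d ≤ θ := le_trans (mul_le_mul_of_nonneg_left (le_abs_self d) hl0.le) hld
  have hd2 : -θ ≤ lam * d := by
    have := mul_le_mul_of_nonneg_left (neg_abs_le d) hl0.le
    linarith
  have q1 := (abs_le.mp (Real.abs_exp_sub_one_sub_id_le (x := -4 * lam * (d - 1))
    (abs_le.mpr ⟨by linarith, by linarith⟩))).2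
  have q2 := (abs_le.mp (Real.abs_exp_sub_one_sub_id_le (x := 4 * lam * (d + 1))
    (abs_le.mpr ⟨by linarith, by linarith⟩))).2
  rw [e1, e2]
  have hE := Real.exp_pos (lam * d ^ 2)
  set E := Real.exp (lam * d ^ 2)
  set A := Real.exp (-4 * lam * (d - 1))
  set B := Real.exp (4 * lam * (d + 1))
  rw [show cu * (E * A - E) + cv * (E * B - E) = E * (cu * (A - 1) + cv * (B - 1)) by ring]
  refine mul_le_mul_of_nonneg_left ?_ hE.le
  have r1 : cu * (A - 1) ≤ cu * (-4 * lam * (d - 1) + 32 * lam ^ 2 * (d ^ 2 + 1)) := by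
    refine mul_le_mul_of_nonneg_left ?_ hcu
    have : 0 ≤ lam ^ 2 * (d + 1) ^ 2 := by positivity
    nlinarith
  have r2 : cv * (B - 1) ≤ cv * (4 * lam * (d + 1) + 32 * lam ^ 2 * (d ^ 2 + 1)) := by
    refine mul_le_mul_of_nonneg_left ?_ hcv
    have : 0 ≤ lam ^ 2 * (d - 1) ^ 2 := by positivity
    nlinarith
  have r3 : (cu + cv) * (4 * lam + 32 * lam ^ 2 * (d ^ 2 + 1))
      ≤ a₁ * n * (4 * lam + 32 * lam ^ 2 * (d ^ 2 + 1)) :=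
    mul_le_mul_of_nonneg_right hcs (by positivity)
  have r4 : a₁ * n * (4 * lam + 32 * lam ^ 2 * (d ^ 2 + 1))
      = 4 * a₁ * θ + 2 * (16 * θ * a₁) * (lam * d ^ 2) + 32 * a₁ * θ * lam := by
    rw [← hln]; ring
  have r5 : (16 * θ * a₁) * (lam * d ^ 2) ≤ b * (lam * d ^ 2) :=
    mul_le_mul_of_nonneg_right hθb (by positivity)
  have r6 : 32 * a₁ * θ * lam ≤ 32 * a₁ * θ * 1 :=
    mul_le_mul_of_nonneg_left (by linarith) (by positivity)
  have r7 : 4 * lam * (b * d ^ 2 - e * |d|) ≤ 4 * lam * (d * (cu - cv)) :=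
    mul_le_mul_of_nonneg_left hdc (by positivity)
  have r8 : 4 * e * (lam * |d|) ≤ 4 * e * θ := mul_le_mul_of_nonneg_left hld (by positivity)
  nlinarith

set_option maxHeartbeats 1000000 in
/-- Gaussian-square moment of the difference of two occupation numbers. -/
lemma pair_bound (c : ℕ → ℝ) (a₁ a₂ : ℝ) (k₀ : ℕ)
    (hc0 : c 0 = 0) (hcpos : ∀ n : ℕ, 0 < n → 0 < c n)
    (hLG : ∀ k : ℕ, |c (k + 1) - c k| ≤ a₁)
    (hk₀ : 0 < k₀) (ha₂ : 0 < a₂)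
    (hM : ∀ j k : ℕ, j + k₀ ≤ k → a₂ ≤ c k - c j) :
    ∃ θ D : ℝ, 0 < θ ∧ 1 ≤ D ∧ ∀ (C : Finset ℤ) (n : ℕ), 1 ≤ n → ∀ x ∈ C, ∀ y ∈ C,
      ∑ η ∈ Finset.piAntidiag C n, pw c C η * Real.exp (θ / n * ((η x : ℝ) - η y) ^ 2)
        ≤ D * ∑ η ∈ Finset.piAntidiag C n, pw c C η := by
  have ha₁ : 0 ≤ a₁ := (abs_nonneg _).trans (hLG 0)
  have hk : (0:ℝ) < k₀ := by exact_mod_cast hk₀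
  set b := a₂ / k₀ with hb
  have hb0 : 0 < b := by positivity
  set e := a₂ + a₁ * k₀ with he
  have he0 : 0 < e := by positivity
  set θ := min (1 / 8) (b / (16 * (a₁ + 1))) with hθ
  have hθ0 : 0 < θ := by positivity
  have hθ8 : θ ≤ 1 / 8 := min_le_left _ _
  have hθb : 16 * θ * a₁ ≤ b := by
    have h1 : θ ≤ b / (16 * (a₁ + 1)) := min_le_right _ _
    rw [le_div_iff₀ (by positivity)] at h1
    nlinarith
  set G := (4 * e + 36 * a₁) * θ with hG
  have hG0 : 0 < G := by positivity
  refine ⟨θ, 2 * Real.exp (G / b), hθ0, ?_, ?_⟩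
  · have : 1 ≤ Real.exp (G / b) := Real.one_le_exp (by positivity)
    linarith
  intro C n hn x hx y hy
  have hn1 : (1:ℝ) ≤ n := by exact_mod_cast hn
  have hD1 : 1 ≤ Real.exp (G / b) := Real.one_le_exp (by positivity)
  by_cases hxy : x = y
  · subst hxy
    simp only [sub_self, ne_eq, OfNat.ofNat_ne_zero, not_false_eq_true, zero_pow, mul_zero,
      Real.exp_zero, mul_one]
    have : 0 ≤ ∑ η ∈ Finset.piAntidiag C n, pw c C η :=
      Finset.sum_nonneg fun η _ => (pw_pos c hcpos C η).le
    nlinarith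
  set V : (ℤ → ℕ) → ℝ := fun η => Real.exp (θ / n * ((η x : ℝ) - η y) ^ 2) with hV
  have i1 := ibp c hc0 hcpos C n hx hy hxy V
  have i2 := ibp c hc0 hcpos C n hy hx (Ne.symm hxy) V
  have hzero : ∑ η ∈ Finset.piAntidiag C n, pw c C η *
      (c (η x) * (V (move η x y) - V η) + c (η y) * (V (move η y x) - V η)) = 0 := by
    have : ∀ η, pw c C η *
      (c (η x) * (V (move η x y) - V η) + c (η y) * (V (move η y x) - V η))
      = pw c C η * (c (η x) * V (move η x y)) - pw c C η * (c (η y) * V η)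
        + (pw c C η * (c (η y) * V (move η y x)) - pw c C η * (c (η x) * V η)) := by
      intro η; ring
    simp only [this, Finset.sum_add_distrib, Finset.sum_sub_distrib]
    rw [i1, i2]; ring
  have hc_nonneg : ∀ k, 0 ≤ c k := by
    intro k
    rcases Nat.eq_zero_or_pos k with h | h
    · rw [h, hc0]
    · exact (hcpos k h).le
  have hc_le : ∀ k : ℕ, c k ≤ a₁ * k := by
    intro k
    have := (abs_le.mp (c_lip c a₁ hLG 0 k)).2
    rw [hc0, zero_add, sub_zero] at this
    exact this
  have hpt : ∀ η ∈ Finset.piAntidiag C n,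
      c (η x) * (V (move η x y) - V η) + c (η y) * (V (move η y x) - V η)
        ≤ - G * V η + 2 * G * Real.exp (G / b) := by
    intro η hη
    set u := η x with hu
    set v := η y with hv
    have hle : u + v ≤ n := by
      rw [Finset.mem_piAntidiag, split_pair_sum C hx hy hxy] at hη
      omega
    have hler : (u : ℝ) + v ≤ n := by exact_mod_cast hle
    have hu0 : (0:ℝ) ≤ u := Nat.cast_nonneg _
    have hv0 : (0:ℝ) ≤ v := Nat.cast_nonneg _
    have m1 : c u * V (move η x y) = c u * Real.exp (θ / n * (((u : ℝ) - v) - 2) ^ 2) := by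
      by_cases h0 : u = 0
      · rw [h0, hc0]; ring
      · simp only [hV, move_same, move_tgt _ hxy, ← hu, ← hv]
        rw [Nat.cast_sub (by omega)]
        push_cast
        ring_nf
    have m2 : c v * V (move η y x) = c v * Real.exp (θ / n * (((u : ℝ) - v) + 2) ^ 2) := by
      by_cases h0 : v = 0
      · rw [h0, hc0]; ring
      · simp only [hV, move_same, move_tgt _ (Ne.symm hxy), ← hu, ← hv]
        rw [Nat.cast_sub (by omega)]
        push_cast
        ring_nf
    have hVη : V η = Real.exp (θ / n * ((u : ℝ) - v) ^ 2) := rfl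
    have hdr := drift_real a₁ b e θ n ha₁ he0.le hθ0 hθ8 hθb hn1 ((u : ℝ) - v) (c u) (c v)
      (abs_le.mpr ⟨by linarith, by linarith⟩) (hc_nonneg u) (hc_nonneg v)
      (by have := hc_le u; have := hc_le v; nlinarith)
      (by
        rcases le_total v u with h | h
        · have h1 := c_grow c a₁ a₂ k₀ hLG hk₀ ha₂ hM v u h
          have h2 : (0:ℝ) ≤ (u:ℝ) - v := by
            have : (v:ℝ) ≤ u := by exact_mod_cast h
            linarith
          rw [abs_of_nonneg h2]
          nlinarith [mul_le_mul_of_nonneg_left h1 h2]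
        · have h1 := c_grow c a₁ a₂ k₀ hLG hk₀ ha₂ hM u v h
          have h2 : (0:ℝ) ≤ (v:ℝ) - u := by
            have : (u:ℝ) ≤ v := by exact_mod_cast h
            linarith
          rw [abs_of_nonpos (by linarith)]
          nlinarith [mul_le_mul_of_nonneg_left h1 h2])
    rw [mul_sub, mul_sub, m1, m2, hVη, ← mul_sub, ← mul_sub]
    refine hdr.trans ?_
    rw [← hG]
    set z := θ / n * ((u : ℝ) - v) ^ 2 with hz
    have hz0 : 0 ≤ z := by positivity
    have hez := Real.exp_pos z
    by_cases hzb : z ≤ G / b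
    · have h1 : Real.exp z ≤ Real.exp (G / b) := Real.exp_le_exp.mpr hzb
      have h2 : 0 ≤ Real.exp z * (b * z) := by positivity
      nlinarith
    · push Not at hzb
      rw [div_lt_iff₀ hb0] at hzb
      have h2 : Real.exp z * G ≤ Real.exp z * (z * b) := mul_le_mul_of_nonneg_left hzb.le hez.le
      have h3 : 0 ≤ G * Real.exp (G / b) := by positivity
      nlinarith
  have hs := Finset.sum_le_sum fun η hη =>
    mul_le_mul_of_nonneg_left (hpt η hη) (pw_pos c hcpos C η).le
  rw [hzero] at hs
  have e3 : ∑ η ∈ Finset.piAntidiag C n, pw c C η * (- G * V η + 2 * G * Real.exp (G / b))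
      = G * (2 * Real.exp (G / b) * ∑ η ∈ Finset.piAntidiag C n, pw c C η
        - ∑ η ∈ Finset.piAntidiag C n, pw c C η * V η) := by
    rw [Finset.mul_sum, ← Finset.sum_sub_distrib, Finset.mul_sum]
    exact Finset.sum_congr rfl fun η _ => by ring
  rw [e3] at hs
  have := nonneg_of_mul_nonneg_right hs hG0
  linarith

lemma Zpos (c : ℕ → ℝ) (hcpos : ∀ n : ℕ, 0 < n → 0 < c n) (C : Finset ℤ) (n : ℕ)
    (hne : (Finset.piAntidiag C n).Nonempty) :
    0 < ∑ η ∈ Finset.piAntidiag C n, pw c C η :=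
  Finset.sum_pos (fun η _ => pw_pos c hcpos C η) hne

/-- Sub-Gaussian bound on a single block. -/
lemma block_bound (c : ℕ → ℝ) (a₁ a₂ : ℝ) (k₀ : ℕ)
    (hc0 : c 0 = 0) (hcpos : ∀ n : ℕ, 0 < n → 0 < c n)
    (hLG : ∀ k : ℕ, |c (k + 1) - c k| ≤ a₁)
    (hk₀ : 0 < k₀) (ha₂ : 0 < a₂)
    (hM : ∀ j k : ℕ, j + k₀ ≤ k → a₂ ≤ c k - c j) (l : ℕ) (hl : 1 ≤ l) :
    ∃ A : ℝ, 0 < A ∧ ∀ (C : Finset ℤ) (n : ℕ), C.card = l → ∃ M : ℝ, ∀ t : ℝ,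
      ∑ η ∈ Finset.piAntidiag C n, pw c C η * Real.exp (t * ∑ x ∈ C, c (η x))
        ≤ Real.exp (t * M + A * n * t ^ 2) * ∑ η ∈ Finset.piAntidiag C n, pw c C η := by
  obtain ⟨θ, D, hθ, hD, hpair⟩ := pair_bound c a₁ a₂ k₀ hc0 hcpos hLG hk₀ ha₂ hM
  have ha₁ : 0 < a₁ := by
    have h1 := hLG 0
    have h2 := hcpos 1 one_pos
    rw [zero_add, hc0, sub_zero] at h1
    exact lt_of_lt_of_le h2 ((le_abs_self _).trans h1)
  have hl0 : (0:ℝ) < l := by exact_mod_cast hl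
  set D' := (l:ℝ) ^ 2 * D with hD'
  refine ⟨2 * Real.exp (2 * D') * (a₁ * l) ^ 2 / θ, by positivity, ?_⟩
  intro C n hC
  rcases Nat.eq_zero_or_pos n with hn | hn
  · subst hn
    refine ⟨0, fun t => ?_⟩
    simp [hc0]
  have hn0 : (0:ℝ) < n := by exact_mod_cast hn
  by_cases hne : (Finset.piAntidiag C n).Nonempty
  swap
  · rw [Finset.not_nonempty_iff_eq_empty] at hne
    rw [hne]; exact ⟨0, fun t => by simp⟩
  have hZ := Zpos c hcpos C n hne
  set Z := ∑ η ∈ Finset.piAntidiag C n, pw c C η with hZdef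
  set g : (ℤ → ℕ) → ℝ := fun η => ∑ x ∈ C, c (η x) with hg
  set g0 : ℝ := ∑ x ∈ C, c (n / l) with hg0
  set X : (ℤ → ℕ) → ℝ := fun η => g η - g0 with hX
  set p : (ℤ → ℕ) → ℝ := fun η => pw c C η / Z with hp
  have hCne : C.Nonempty := by rw [← Finset.card_pos]; omega
  have hXb : ∀ η ∈ Finset.piAntidiag C n, Real.exp (θ / n / (a₁ * l) ^ 2 * X η ^ 2)
      ≤ ∑ x ∈ C, ∑ y ∈ C, Real.exp (θ / n * ((η x : ℝ) - η y) ^ 2) := by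
    intro η hη
    have hs : ∑ x ∈ C, η x = n := (Finset.mem_piAntidiag.mp hη).1
    obtain ⟨x, hx, hxmax⟩ := C.exists_max_image η hCne
    obtain ⟨y, hy, hymin⟩ := C.exists_min_image η hCne
    have hq1 : n / l ≤ η x := by
      have : n ≤ l * η x := by
        rw [← hs, ← hC, ← smul_eq_mul]
        exact Finset.sum_le_card_nsmul _ _ _ hxmax
      exact Nat.div_le_of_le_mul this
    have hq2 : η y ≤ n / l := by
      have : l * η y ≤ n := by
        rw [← hs, ← hC, ← smul_eq_mul]
        exact Finset.card_nsmul_le_sum _ _ _ hymin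
      rw [Nat.le_div_iff_mul_le (by omega)]
      linarith
    have hq1r : ((n / l : ℕ) : ℝ) ≤ η x := by exact_mod_cast hq1
    have hq2r : (η y : ℝ) ≤ ((n / l : ℕ) : ℝ) := by exact_mod_cast hq2
    have habs : |X η| ≤ a₁ * l * ((η x : ℝ) - η y) := by
      simp only [hX, hg, hg0]
      rw [← Finset.sum_sub_distrib]
      refine (Finset.abs_sum_le_sum_abs _ _).trans ?_
      have : ∀ z ∈ C, |c (η z) - c (n / l)| ≤ a₁ * ((η x : ℝ) - η y) := by
        intro z hz
        refine (c_lip' c a₁ hLG _ _).trans (mul_le_mul_of_nonneg_left ?_ ha₁.le)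
        have h1 : (η z : ℝ) ≤ η x := by exact_mod_cast hxmax z hz
        have h2 : (η y : ℝ) ≤ η z := by exact_mod_cast hymin z hz
        rw [abs_le]; constructor <;> linarith
      refine (Finset.sum_le_card_nsmul _ _ _ this).trans (le_of_eq ?_)
      rw [hC, nsmul_eq_mul]; ring
    have hsq : X η ^ 2 ≤ (a₁ * l * ((η x : ℝ) - η y)) ^ 2 := by
      rw [← sq_abs (X η)]
      exact pow_le_pow_left₀ (abs_nonneg _) habs 2
    calc _ ≤ Real.exp (θ / n * ((η x : ℝ) - η y) ^ 2) := by
          refine Real.exp_le_exp.mpr ?_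
          calc _ ≤ θ / n / (a₁ * l) ^ 2 * (a₁ * l * ((η x : ℝ) - η y)) ^ 2 :=
                mul_le_mul_of_nonneg_left hsq (by positivity)
            _ = _ := by field_simp
      _ ≤ ∑ y ∈ C, Real.exp (θ / n * ((η x : ℝ) - η y) ^ 2) :=
          Finset.single_le_sum (f := fun y => Real.exp (θ / n * ((η x : ℝ) - η y) ^ 2))
            (fun _ _ => (Real.exp_pos _).le) hy
      _ ≤ _ := Finset.single_le_sum
            (f := fun x => ∑ y ∈ C, Real.exp (θ / n * ((η x : ℝ) - η y) ^ 2))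
            (fun _ _ => Finset.sum_nonneg fun _ _ => (Real.exp_pos _).le) hx
  have hmom : ∑ η ∈ Finset.piAntidiag C n, p η * Real.exp (θ / n / (a₁ * l) ^ 2 * X η ^ 2)
      ≤ D' := by
    have h1 : ∑ η ∈ Finset.piAntidiag C n, pw c C η *
        Real.exp (θ / n / (a₁ * l) ^ 2 * X η ^ 2) ≤ D' * Z := by
      calc _ ≤ ∑ η ∈ Finset.piAntidiag C n, ∑ x ∈ C, ∑ y ∈ C, pw c C η *
            Real.exp (θ / n * ((η x : ℝ) - η y) ^ 2) := by
            refine Finset.sum_le_sum fun η hη => ?_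
            refine (mul_le_mul_of_nonneg_left (hXb η hη) (pw_pos c hcpos C η).le).trans ?_
            simp only [Finset.mul_sum]; exact le_rfl
        _ = ∑ x ∈ C, ∑ y ∈ C, ∑ η ∈ Finset.piAntidiag C n, pw c C η *
            Real.exp (θ / n * ((η x : ℝ) - η y) ^ 2) := by
            rw [Finset.sum_comm]
            exact Finset.sum_congr rfl fun x _ => Finset.sum_comm
        _ ≤ ∑ x ∈ C, ∑ y ∈ C, D * Z :=
            Finset.sum_le_sum fun x hx => Finset.sum_le_sum fun y hy => hpair C n hn x hx y hy
        _ = D' * Z := by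
            simp only [Finset.sum_const, hC, nsmul_eq_mul]; rw [hD']; ring
    have h2 : ∑ η ∈ Finset.piAntidiag C n, p η * Real.exp (θ / n / (a₁ * l) ^ 2 * X η ^ 2)
      = (∑ η ∈ Finset.piAntidiag C n, pw c C η *
        Real.exp (θ / n / (a₁ * l) ^ 2 * X η ^ 2)) / Z := by
      rw [Finset.sum_div]
      exact Finset.sum_congr rfl fun η _ => by simp only [hp]; ring
    rw [h2, div_le_iff₀ hZ]
    exact h1
  have hp1 : ∑ η ∈ Finset.piAntidiag C n, p η = 1 := by
    simp only [hp]; rw [← Finset.sum_div]; exact div_self hZ.ne'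
  set m := ∑ η ∈ Finset.piAntidiag C n, p η * X η with hm
  refine ⟨g0 + m, fun t => ?_⟩
  have hsg := subgauss_of_sq (Finset.piAntidiag C n) p X (θ / n / (a₁ * l) ^ 2) D'
    (by positivity) (fun η _ => div_nonneg (pw_pos c hcpos C η).le hZ.le) hp1 hmom t
  rw [← hm] at hsg
  have e1 : ∑ η ∈ Finset.piAntidiag C n, pw c C η * Real.exp (t * ∑ x ∈ C, c (η x))
      = Real.exp (t * (g0 + m)) * Z *
        ∑ η ∈ Finset.piAntidiag C n, p η * Real.exp (t * (X η - m)) := by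
    rw [Finset.mul_sum]
    refine Finset.sum_congr rfl fun η _ => ?_
    have : Real.exp (t * ∑ x ∈ C, c (η x))
        = Real.exp (t * (g0 + m)) * Real.exp (t * (X η - m)) := by
      rw [← Real.exp_add]; congr 1; simp only [hX, hg]; ring
    rw [this]; simp only [hp]; field_simp
  rw [e1, Real.exp_add]
  have e2 : 2 * Real.exp (2 * D') / (θ / n / (a₁ * l) ^ 2) * t ^ 2
      = 2 * Real.exp (2 * D') * (a₁ * l) ^ 2 / θ * n * t ^ 2 := by field_simp
  rw [e2] at hsg
  calc _ ≤ Real.exp (t * (g0 + m)) * Z * _ :=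
        mul_le_mul_of_nonneg_left hsg (by positivity)
    _ = _ := by ring

/-- The segment made of the first `m` blocks. -/
def seg (a : ℤ) (l m : ℕ) : Finset ℤ := Finset.Ico a (a + ((m * l : ℕ) : ℤ))

lemma seg_zero (a : ℤ) (l : ℕ) : seg a l 0 = ∅ := by simp [seg]

lemma seg_disj (a : ℤ) (l m : ℕ) : Disjoint (seg a l m) (blockC a l m) := by
  rw [Finset.disjoint_left]
  intro x hx hx'
  simp only [seg, blockC, Finset.mem_Ico] at hx hx'
  push_cast at hx
  omega

lemma seg_succ (a : ℤ) (l m : ℕ) : seg a l (m + 1) = seg a l m ∪ blockC a l m := by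
  ext x
  simp only [seg, blockC, Finset.mem_Ico, Finset.mem_union]
  push_cast
  have h1 : (0:ℤ) ≤ (m:ℤ) * l := by positivity
  have h2 : (0:ℤ) ≤ (l:ℤ) := by positivity
  rw [add_mul, one_mul]
  omega

lemma block_sub_seg (a : ℤ) (l m k : ℕ) (hk : k < m) : blockC a l k ⊆ seg a l m := by
  induction m with
  | zero => omega
  | succ m ih =>
    rw [seg_succ]
    rcases Nat.lt_succ_iff_lt_or_eq.mp hk with h | h
    · exact (ih h).trans Finset.subset_union_left
    · rw [h]; exact Finset.subset_union_right

lemma sum_seg (a : ℤ) (l m : ℕ) (η : ℤ → ℕ) :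
    ∑ x ∈ seg a l m, η x = ∑ k ∈ Finset.range m, ∑ x ∈ blockC a l k, η x := by
  induction m with
  | zero => simp [seg_zero]
  | succ m ih => rw [seg_succ, Finset.sum_union (seg_disj a l m), ih, Finset.sum_range_succ]

lemma card_blockC (a : ℤ) (l k : ℕ) : (blockC a l k).card = l := by
  simp only [blockC, Int.card_Ico]
  rw [show a + ((k:ℤ) + 1) * l - (a + k * l) = l by ring]
  simp

/-- Configurations with prescribed block totals. -/
def prof (a : ℤ) (l m : ℕ) (n : ℕ → ℕ) : Finset (ℤ → ℕ) :=
  (Finset.piAntidiag (seg a l m) (∑ k ∈ Finset.range m, n k)).filter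
    (fun η => ∀ k ∈ Finset.range m, ∑ x ∈ blockC a l k, η x = n k)

/-- Restriction of a configuration. -/
def restr (s : Finset ℤ) (η : ℤ → ℕ) : ℤ → ℕ := fun x => if x ∈ s then η x else 0

lemma mem_prof (a : ℤ) (l m : ℕ) (n : ℕ → ℕ) (η : ℤ → ℕ) : η ∈ prof a l m n ↔
    (∀ x, η x ≠ 0 → x ∈ seg a l m) ∧ ∀ k < m, ∑ x ∈ blockC a l k, η x = n k := by
  simp only [prof, Finset.mem_filter, Finset.mem_piAntidiag, Finset.mem_range]
  constructor
  · rintro ⟨⟨_, h⟩, h'⟩; exact ⟨h, h'⟩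
  · rintro ⟨h, h'⟩
    refine ⟨⟨?_, h⟩, h'⟩
    have := sum_seg a l m η
    rw [this]
    exact Finset.sum_congr rfl fun k hk => h' k (Finset.mem_range.mp hk)

lemma prof_prod (a : ℤ) (l : ℕ) (n : ℕ → ℕ) (p : ℕ → ℝ) (m : ℕ) :
    ∑ η ∈ prof a l m n, ∏ x ∈ seg a l m, p (η x)
      = ∏ k ∈ Finset.range m, ∑ η ∈ Finset.piAntidiag (blockC a l k) (n k),
          ∏ x ∈ blockC a l k, p (η x) := by
  induction m with
  | zero =>
    have : prof a l 0 n = {0} := by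
      ext η
      rw [mem_prof]
      simp only [seg_zero, Finset.notMem_empty, Finset.mem_singleton]
      constructor
      · rintro ⟨h, _⟩; funext x; by_contra hx; exact h x hx
      · rintro rfl; simp
    rw [this]; simp [seg_zero]
  | succ m ih =>
    rw [Finset.prod_range_succ, ← ih, Finset.sum_mul_sum, ← Finset.sum_product']
    have hd := seg_disj a l m
    symm
    refine Finset.sum_nbij' (fun q => q.1 + q.2)
      (fun η => (restr (seg a l m) η, restr (blockC a l m) η)) ?_ ?_ ?_ ?_ ?_
    · rintro ⟨η, ζ⟩ hq
      simp only [Finset.mem_product, mem_prof, Finset.mem_piAntidiag] at hq ⊢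
      obtain ⟨⟨h1, h2⟩, h3, h4⟩ := hq
      have hη : ∀ x ∈ blockC a l m, η x = 0 := by
        intro x hx; by_contra h
        exact (Finset.disjoint_left.mp hd) (h1 x h) hx
      have hζ : ∀ x ∈ seg a l m, ζ x = 0 := by
        intro x hx; by_contra h
        exact (Finset.disjoint_left.mp hd) hx (h4 x h)
      refine ⟨?_, ?_⟩
      · intro x hx
        rw [seg_succ, Finset.mem_union]
        by_cases h : η x = 0
        · right; apply h4; intro h0; apply hx; simp [h, h0]
        · left; exact h1 x h
      · intro k hk
        simp only [Pi.add_apply, Finset.sum_add_distrib]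
        rcases Nat.lt_succ_iff_lt_or_eq.mp hk with h | h
        · rw [h2 k h, Finset.sum_eq_zero (fun x hx => hζ x (block_sub_seg a l m k h hx))]; rfl
        · subst h
          rw [Finset.sum_eq_zero hη, zero_add]; exact h3
    · intro η hη
      simp only [Finset.mem_product, mem_prof, Finset.mem_piAntidiag] at hη ⊢
      obtain ⟨h1, h2⟩ := hη
      refine ⟨⟨?_, ?_⟩, ?_, ?_⟩
      · intro x hx; by_contra h; exact hx (by simp [restr, h])
      · intro k hk
        rw [← h2 k (by omega)]
        refine Finset.sum_congr rfl fun x hx => ?_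
        simp [restr, block_sub_seg a l m k hk hx]
      · rw [← h2 m (by omega)]
        refine Finset.sum_congr rfl fun x hx => ?_
        simp [restr, hx]
      · intro x hx; by_contra h; exact hx (by simp [restr, h])
    · rintro ⟨η, ζ⟩ hq
      simp only [Finset.mem_product, mem_prof, Finset.mem_piAntidiag] at hq
      obtain ⟨⟨h1, h2⟩, h3, h4⟩ := hq
      refine Prod.ext ?_ ?_
      · funext x
        simp only [restr, Pi.add_apply]
        split_ifs with hx
        · have : ζ x = 0 := by
            by_contra h
            exact (Finset.disjoint_left.mp hd) hx (h4 x h)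
          omega
        · by_contra h; exact hx (h1 x (Ne.symm h))
      · funext x
        simp only [restr, Pi.add_apply]
        split_ifs with hx
        · have : η x = 0 := by
            by_contra h
            exact (Finset.disjoint_left.mp hd) (h1 x h) hx
          omega
        · by_contra h; exact hx (h4 x (Ne.symm h))
    · intro η hη
      rw [mem_prof] at hη
      funext x
      simp only [restr, Pi.add_apply]
      by_cases h : x ∈ seg a l m
      · simp [h, Finset.disjoint_left.mp hd h]
      · by_cases h' : x ∈ blockC a l m
        · simp [h, h']
        · simp only [h, h', if_false]
          by_contra h0
          have := hη.1 x (by omega)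
          rw [seg_succ, Finset.mem_union] at this
          tauto
    · rintro ⟨η, ζ⟩ hq
      simp only [Finset.mem_product, mem_prof, Finset.mem_piAntidiag] at hq
      obtain ⟨⟨h1, h2⟩, h3, h4⟩ := hq
      rw [seg_succ, Finset.prod_union hd]
      congr 1
      · refine Finset.prod_congr rfl fun x hx => ?_
        have : ζ x = 0 := by
          by_contra h
          exact (Finset.disjoint_left.mp hd) hx (h4 x h)
        simp [this]
      · refine Finset.prod_congr rfl fun x hx => ?_
        have : η x = 0 := by
          by_contra h
          exact (Finset.disjoint_left.mp hd) (h1 x h) hx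
        simp [this]

/-- Sub-Gaussian bound on the whole segment, conditionally on the block totals. -/
lemma prof_bound (c : ℕ → ℝ) (a₁ a₂ : ℝ) (k₀ : ℕ)
    (hc0 : c 0 = 0) (hcpos : ∀ n : ℕ, 0 < n → 0 < c n)
    (hLG : ∀ k : ℕ, |c (k + 1) - c k| ≤ a₁)
    (hk₀ : 0 < k₀) (ha₂ : 0 < a₂)
    (hM : ∀ j k : ℕ, j + k₀ ≤ k → a₂ ≤ c k - c j) (l : ℕ) (hl : 1 ≤ l) :
    ∃ A : ℝ, 0 < A ∧ ∀ (a : ℤ) (m : ℕ) (n : ℕ → ℕ), ∃ M : ℝ, ∀ t : ℝ,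
      ∑ η ∈ prof a l m n, pw c (seg a l m) η * Real.exp (t * ∑ x ∈ seg a l m, c (η x))
        ≤ Real.exp (t * M + A * ((∑ k ∈ Finset.range m, n k : ℕ) : ℝ) * t ^ 2)
          * ∑ η ∈ prof a l m n, pw c (seg a l m) η := by
  obtain ⟨A, hA, h⟩ := block_bound c a₁ a₂ k₀ hc0 hcpos hLG hk₀ ha₂ hM l hl
  refine ⟨A, hA, fun a m n => ?_⟩
  choose M hMt using fun k => h (blockC a l k) (n k) (card_blockC a l k)
  refine ⟨∑ k ∈ Finset.range m, M k, fun t => ?_⟩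
  have e : ∀ (s : Finset ℤ) (η : ℤ → ℕ), pw c s η * Real.exp (t * ∑ x ∈ s, c (η x))
      = ∏ x ∈ s, ((fun k => (cfact c k)⁻¹ * Real.exp (t * c k)) (η x)) := by
    intro s η
    rw [Finset.prod_mul_distrib, Finset.mul_sum, Real.exp_sum, pw]
  have e' : ∑ η ∈ prof a l m n, pw c (seg a l m) η
      = ∏ k ∈ Finset.range m, ∑ η ∈ Finset.piAntidiag (blockC a l k) (n k),
          pw c (blockC a l k) η := prof_prod a l n (fun k => (cfact c k)⁻¹) m
  rw [e', Finset.sum_congr rfl fun η _ => e (seg a l m) η, prof_prod a l n (fun k => (cfact c k)⁻¹ * Real.exp (t * c k)) m]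
  have e2 : Real.exp (t * ∑ k ∈ Finset.range m, M k
      + A * ((∑ k ∈ Finset.range m, n k : ℕ) : ℝ) * t ^ 2)
      = ∏ k ∈ Finset.range m, Real.exp (t * M k + A * n k * t ^ 2) := by
    rw [← Real.exp_sum]
    congr 1
    push_cast
    rw [Finset.sum_add_distrib, Finset.mul_sum, Finset.mul_sum, Finset.sum_mul]
  rw [e2, ← Finset.prod_mul_distrib]
  refine Finset.prod_le_prod ?_ ?_
  · intro k _
    refine Finset.sum_nonneg fun η _ => ?_
    rw [← e]
    exact mul_nonneg (pw_pos c hcpos _ _).le (Real.exp_pos _).le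
  · intro k _
    rw [← Finset.sum_congr rfl fun η _ => e (blockC a l k) η]
    exact hMt k t

/-- Expectation for a weight supported on a finset. -/
lemma wE_finset (w f : (ℤ → ℕ) → ℝ) (S : Finset (ℤ → ℕ)) (hS : ∀ η, η ∉ S → w η = 0) :
    wE w f = (∑ η ∈ S, w η * f η) / ∑ η ∈ S, w η := by
  unfold wE
  rw [tsum_eq_sum (s := S) (fun η hη => by rw [hS η hη, zero_mul]),
    tsum_eq_sum (s := S) (fun η hη => hS η hη)]

open scoped Classical in
lemma nuW_eq (c : ℕ → ℝ) (Λ : Finset ℤ) (N : ℕ) (η : ℤ → ℕ) :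
    nuW c Λ N η = if η ∈ Finset.piAntidiag Λ N then pw c Λ η else 0 := by
  unfold nuW
  rw [Set.indicator_apply]
  refine if_congr ?_ rfl rfl
  rw [Finset.mem_piAntidiag]
  simp only [Set.mem_ofPred_eq]
  constructor
  · rintro ⟨h1, h2⟩; exact ⟨h2, fun x hx => by by_contra h; exact hx (h1 x h)⟩
  · rintro ⟨h1, h2⟩; exact ⟨fun x hx => by by_contra h; exact hx (h2 x h), h1⟩

lemma mem_prof_iff (a : ℤ) (l m N : ℕ) (η₀ η : ℤ → ℕ)
    (h₀ : η₀ ∈ Finset.piAntidiag (seg a l m) N) :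
    η ∈ prof a l m (fun k => ∑ x ∈ blockC a l k, η₀ x) ↔
    η ∈ Finset.piAntidiag (seg a l m) N ∧
      ∀ k ∈ Finset.range m, ∑ x ∈ blockC a l k, η x = ∑ x ∈ blockC a l k, η₀ x := by
  have : ∑ k ∈ Finset.range m, ∑ x ∈ blockC a l k, η₀ x = N := by
    have := sum_seg a l m η₀
    rw [← this]; exact (Finset.mem_piAntidiag.mp h₀).1
  unfold prof
  rw [this, Finset.mem_filter]

open scoped Classical in
lemma blockW_eq (c : ℕ → ℝ) (a : ℤ) (l m N : ℕ) (η₀ η : ℤ → ℕ)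
    (h₀ : η₀ ∈ Finset.piAntidiag (seg a l m) N) :
    blockW (nuW c (seg a l m) N) a l m η₀ η =
      if η ∈ prof a l m (fun k => ∑ x ∈ blockC a l k, η₀ x) then pw c (seg a l m) η else 0 := by
  unfold blockW
  rw [Set.indicator_apply, nuW_eq]
  simp only [Set.mem_ofPred_eq, mem_prof_iff a l m N η₀ η h₀]
  by_cases h1 : η ∈ Finset.piAntidiag (seg a l m) N <;> simp only [h1, true_and, false_and, if_true, if_false, ite_self]

lemma wE_block (c : ℕ → ℝ) (a : ℤ) (l m N : ℕ) (η₀ : ℤ → ℕ)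
    (h₀ : η₀ ∈ Finset.piAntidiag (seg a l m) N) (f : (ℤ → ℕ) → ℝ) :
    wE (blockW (nuW c (seg a l m) N) a l m η₀) f =
      (∑ η ∈ prof a l m (fun k => ∑ x ∈ blockC a l k, η₀ x), pw c (seg a l m) η * f η)
        / ∑ η ∈ prof a l m (fun k => ∑ x ∈ blockC a l k, η₀ x), pw c (seg a l m) η := by
  rw [wE_finset _ _ (prof a l m (fun k => ∑ x ∈ blockC a l k, η₀ x))
    (fun η hη => by rw [blockW_eq c a l m N η₀ η h₀, if_neg hη])]
  congr 1
  · exact Finset.sum_congr rfl fun η hη => by rw [blockW_eq c a l m N η₀ η h₀, if_pos hη]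
  · exact Finset.sum_congr rfl fun η hη => by rw [blockW_eq c a l m N η₀ η h₀, if_pos hη]

lemma wE_nu (c : ℕ → ℝ) (Λ : Finset ℤ) (N : ℕ) (f : (ℤ → ℕ) → ℝ) :
    wE (nuW c Λ N) f = (∑ η ∈ Finset.piAntidiag Λ N, pw c Λ η * f η)
      / ∑ η ∈ Finset.piAntidiag Λ N, pw c Λ η := by
  rw [wE_finset _ _ (Finset.piAntidiag Λ N) (fun η hη => by rw [nuW_eq, if_neg hη])]
  congr 1
  · exact Finset.sum_congr rfl fun η hη => by rw [nuW_eq, if_pos hη]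
  · exact Finset.sum_congr rfl fun η hη => by rw [nuW_eq, if_pos hη]

/-- Tower property. -/
lemma tower (c : ℕ → ℝ) (hcpos : ∀ n : ℕ, 0 < n → 0 < c n) (a : ℤ) (l m N : ℕ)
    (f : (ℤ → ℕ) → ℝ) :
    wE (nuW c (seg a l m) N) (fun η₀ => wE (blockW (nuW c (seg a l m) N) a l m η₀) f)
      = wE (nuW c (seg a l m) N) f := by
  rw [wE_nu, wE_nu]
  congr 1
  set S := Finset.piAntidiag (seg a l m) N with hS
  set P : (ℤ → ℕ) → Finset (ℤ → ℕ) :=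
    fun η₀ => prof a l m (fun k => ∑ x ∈ blockC a l k, η₀ x) with hP
  set w := pw c (seg a l m) with hw
  set Z : (ℤ → ℕ) → ℝ := fun η₀ => ∑ η ∈ P η₀, w η with hZ
  have hPS : ∀ η₀ ∈ S, ∀ η, η ∈ P η₀ ↔ η ∈ S ∧
      ∀ k ∈ Finset.range m, ∑ x ∈ blockC a l k, η x = ∑ x ∈ blockC a l k, η₀ x :=
    fun η₀ h₀ η => mem_prof_iff a l m N η₀ η h₀
  have hself : ∀ η ∈ S, η ∈ P η := fun η h => (hPS η h η).mpr ⟨h, fun _ _ => rfl⟩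
  have hZpos : ∀ η ∈ S, 0 < Z η := fun η h =>
    Finset.sum_pos (fun ζ _ => pw_pos c hcpos _ ζ) ⟨η, hself η h⟩
  have hPeq : ∀ η₀ ∈ S, ∀ η ∈ P η₀, P η = P η₀ := by
    intro η₀ h₀ η hη
    have h1 := (hPS η₀ h₀ η).mp hη
    ext ζ
    rw [hPS η h1.1, hPS η₀ h₀]
    constructor
    · rintro ⟨h, h'⟩; exact ⟨h, fun k hk => (h' k hk).trans (h1.2 k hk)⟩
    · rintro ⟨h, h'⟩; exact ⟨h, fun k hk => (h' k hk).trans (h1.2 k hk).symm⟩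
  calc ∑ η₀ ∈ S, w η₀ * wE (blockW (nuW c (seg a l m) N) a l m η₀) f
      = ∑ η₀ ∈ S, ∑ η ∈ P η₀, w η₀ * (w η * f η) / Z η := by
        refine Finset.sum_congr rfl fun η₀ h₀ => ?_
        rw [wE_block c a l m N η₀ h₀, mul_div_assoc', Finset.mul_sum, Finset.sum_div]
        refine Finset.sum_congr rfl fun η hη => ?_
        have : Z η = Z η₀ := by simp only [hZ]; rw [hPeq η₀ h₀ η hη]
        rw [this]
    _ = ∑ η ∈ S, ∑ η₀ ∈ P η, w η₀ * (w η * f η) / Z η := by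
        refine Finset.sum_comm' fun η₀ η => ?_
        constructor
        · rintro ⟨h₀, hη⟩
          refine ⟨?_, ((hPS η₀ h₀ η).mp hη).1⟩
          rw [hPeq η₀ h₀ η hη]; exact hself η₀ h₀
        · rintro ⟨h₀, hη⟩
          refine ⟨((hPS η hη η₀).mp h₀).1, ?_⟩
          rw [hPeq η hη η₀ h₀]; exact hself η hη
    _ = ∑ η ∈ S, w η * f η := by
        refine Finset.sum_congr rfl fun η hη => ?_
        rw [← Finset.sum_div, ← Finset.sum_mul]
        have := (hZpos η hη).ne'
        change Z η * (w η * f η) / Z η = w η * f η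
        field_simp

/-- Pointwise (in the block profile) covariance bound. -/
lemma cov_block (c : ℕ → ℝ) (hcpos : ∀ n : ℕ, 0 < n → 0 < c n) (a : ℤ) (l m N : ℕ) (A : ℝ)
    (hA : 0 < A)
    (h : ∀ n : ℕ → ℕ, ∃ M : ℝ, ∀ t : ℝ,
      ∑ η ∈ prof a l m n, pw c (seg a l m) η * Real.exp (t * ∑ x ∈ seg a l m, c (η x))
        ≤ Real.exp (t * M + A * ((∑ k ∈ Finset.range m, n k : ℕ) : ℝ) * t ^ 2)
          * ∑ η ∈ prof a l m n, pw c (seg a l m) η)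
    (δ : ℝ) (f : (ℤ → ℕ) → ℝ) (hf : ∀ η, 0 ≤ f η) (η₀ : ℤ → ℕ)
    (h₀ : η₀ ∈ Finset.piAntidiag (seg a l m) N) (t : ℝ) :
    t * wCov (blockW (nuW c (seg a l m) N) a l m η₀) f
        (fun η => ∑ x ∈ seg a l m, (c (η x) - δ * (η x : ℝ)))
      ≤ wEnt (blockW (nuW c (seg a l m) N) a l m η₀) f
        + A * N * t ^ 2 * wE (blockW (nuW c (seg a l m) N) a l m η₀) f := by
  unfold wCov wEnt
  simp only [wE_block c a l m N η₀ h₀]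
  set n : ℕ → ℕ := fun k => ∑ x ∈ blockC a l k, η₀ x with hn
  obtain ⟨M, hM⟩ := h n
  have hN : ∑ k ∈ Finset.range m, n k = N := by
    have := sum_seg a l m η₀
    simp only [hn]
    rw [← this]; exact (Finset.mem_piAntidiag.mp h₀).1
  rw [hN] at hM
  set P := prof a l m n with hP
  have hPm : ∀ η ∈ P, η ∈ Finset.piAntidiag (seg a l m) N := fun η hη =>
    ((mem_prof_iff a l m N η₀ η h₀).mp hη).1
  have hne : P.Nonempty := ⟨η₀, (mem_prof_iff a l m N η₀ η₀ h₀).mpr ⟨h₀, fun _ _ => rfl⟩⟩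
  set w := pw c (seg a l m) with hw
  have hZ : 0 < ∑ η ∈ P, w η := Finset.sum_pos (fun η _ => pw_pos c hcpos _ η) hne
  set Z := ∑ η ∈ P, w η with hZd
  have ediv : ∀ g : (ℤ → ℕ) → ℝ, (∑ η ∈ P, w η * g η) / Z = ∑ η ∈ P, w η / Z * g η := by
    intro g; rw [Finset.sum_div]; exact Finset.sum_congr rfl fun η _ => by ring
  simp only [ediv]
  have hg : ∀ η ∈ P, ∑ x ∈ seg a l m, (c (η x) - δ * (η x : ℝ))
      = ∑ x ∈ seg a l m, c (η x) - δ * N := by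
    intro η hη
    rw [Finset.sum_sub_distrib, ← Finset.mul_sum, ← Nat.cast_sum]
    have := (Finset.mem_piAntidiag.mp (hPm η hη)).1
    rw [this]
  refine cov_entropy P (fun η => w η / Z) f _ (M - δ * N) (A * N) (by positivity)
    (fun η _ => div_nonneg (pw_pos c hcpos _ η).le hZ.le) ?_ hf ?_ t
  · rw [← Finset.sum_div]; exact div_self hZ.ne'
  · intro t
    rw [← ediv, div_le_iff₀ hZ]
    have e1 : ∑ η ∈ P, w η * Real.exp (t * ∑ x ∈ seg a l m, (c (η x) - δ * (η x : ℝ)))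
        = Real.exp (-(t * (δ * N))) *
          ∑ η ∈ P, w η * Real.exp (t * ∑ x ∈ seg a l m, c (η x)) := by
      rw [Finset.mul_sum]
      refine Finset.sum_congr rfl fun η hη => ?_
      rw [hg η hη, mul_left_comm, ← Real.exp_add]
      congr 2; ring
    rw [e1]
    calc _ ≤ Real.exp (-(t * (δ * N))) * (Real.exp (t * M + A * N * t ^ 2) * Z) :=
          mul_le_mul_of_nonneg_left (hM t) (Real.exp_pos _).le
      _ = _ := by
          rw [← mul_assoc, ← Real.exp_add]; congr 2; ring

/-- Proposition 3.8: one-block estimate for the conditional covariance. -/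
theorem statement11
    (c : ℕ → ℝ) (a₁ a₂ : ℝ) (k₀ : ℕ)
    (hc0 : c 0 = 0) (hcpos : ∀ n : ℕ, 0 < n → 0 < c n)
    (hLG : ∀ k : ℕ, |c (k + 1) - c k| ≤ a₁)
    (hk₀ : 0 < k₀) (ha₂ : 0 < a₂)
    (hM : ∀ j k : ℕ, j + k₀ ≤ k → a₂ ≤ c k - c j)
    (l : ℕ) (hl : 1 ≤ l) :
    ∃ C : ℝ, 0 < C ∧ ∀ (a : ℤ) (m N : ℕ) (δ : ℝ), 1 ≤ m → 1 ≤ N →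
      ∀ f : (ℤ → ℕ) → ℝ, (∀ η, 0 ≤ f η) →
        (wE (nuW c (Finset.Ico a (a + ((m * l : ℕ) : ℤ))) N)
            (fun η₀ => wCov (blockW (nuW c (Finset.Ico a (a + ((m * l : ℕ) : ℤ))) N) a l m η₀) f
              (fun η => ∑ x ∈ Finset.Ico a (a + ((m * l : ℕ) : ℤ)), (c (η x) - δ * (η x : ℝ))))) ^ 2
          ≤ C * (N : ℝ) * wE (nuW c (Finset.Ico a (a + ((m * l : ℕ) : ℤ))) N) f *
              wE (nuW c (Finset.Ico a (a + ((m * l : ℕ) : ℤ))) N)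
                (fun η₀ => wEnt (blockW (nuW c (Finset.Ico a (a + ((m * l : ℕ) : ℤ))) N) a l m η₀) f) := by
  obtain ⟨A, hA, h⟩ := prof_bound c a₁ a₂ k₀ hc0 hcpos hLG hk₀ ha₂ hM l hl
  refine ⟨4 * A, by positivity, ?_⟩
  intro a m N δ _ _ f hf
  change (wE (nuW c (seg a l m) N) (fun η₀ => wCov (blockW (nuW c (seg a l m) N) a l m η₀) f
      (fun η => ∑ x ∈ seg a l m, (c (η x) - δ * (η x : ℝ))))) ^ 2
    ≤ 4 * A * (N : ℝ) * wE (nuW c (seg a l m) N) f *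
      wE (nuW c (seg a l m) N) (fun η₀ => wEnt (blockW (nuW c (seg a l m) N) a l m η₀) f)
  set cv : (ℤ → ℕ) → ℝ := fun η₀ => wCov (blockW (nuW c (seg a l m) N) a l m η₀) f
      (fun η => ∑ x ∈ seg a l m, (c (η x) - δ * (η x : ℝ))) with hcv
  set en : (ℤ → ℕ) → ℝ := fun η₀ => wEnt (blockW (nuW c (seg a l m) N) a l m η₀) f with hen
  set ex : (ℤ → ℕ) → ℝ := fun η₀ => wE (blockW (nuW c (seg a l m) N) a l m η₀) f with hex
  have key : ∀ t : ℝ, 0 ≤ (A * N * wE (nuW c (seg a l m) N) f) * (t * t)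
      + (-wE (nuW c (seg a l m) N) cv) * t + wE (nuW c (seg a l m) N) en := by
    intro t
    rw [← tower c hcpos a l m N f, wE_nu, wE_nu, wE_nu]
    set Z := ∑ η ∈ Finset.piAntidiag (seg a l m) N, pw c (seg a l m) η
    have hZ : 0 ≤ Z := Finset.sum_nonneg fun η _ => (pw_pos c hcpos _ η).le
    have hnn : 0 ≤ (∑ η ∈ Finset.piAntidiag (seg a l m) N, pw c (seg a l m) η *
        (en η + A * N * t ^ 2 * ex η - t * cv η)) / Z := by
      refine div_nonneg (Finset.sum_nonneg fun η hη =>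
        mul_nonneg (pw_pos c hcpos _ η).le ?_) hZ
      have := cov_block c hcpos a l m N A hA (h a m) δ f hf η hη t
      simp only [hen, hex, hcv]
      linarith
    refine hnn.trans (le_of_eq ?_)
    have : ∀ η, pw c (seg a l m) η * (en η + A * N * t ^ 2 * ex η - t * cv η)
        = pw c (seg a l m) η * en η + A * N * t ^ 2 * (pw c (seg a l m) η * ex η)
          - t * (pw c (seg a l m) η * cv η) := by
      intro η; ring
    simp only [this, Finset.sum_add_distrib, Finset.sum_sub_distrib, ← Finset.mul_sum]
    ring
  have hd := discrim_le_zero key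
  unfold discrim at hd
  linarith
end
end

section
/- For every ε > 0 there exist a block size l = l_ε, a volume threshold L₀ = L₀(ε), a density threshold ρ₀ > 0 and a finite constant C_ε such that the following holds for every L ≥ L₀ that is a multiple m·l and every N ≥ 1: with ρ := N/L, δ := α'(ρ) if ρ ≥ ρ₀ and δ := α(ρ)/ρ if ρ < ρ₀, and c̃(n) := c(n) − δn, one has for all f ≥ 0: ν_Λ^N[ f , Σ_{k=1}^m ν_{C_k}^{η̄_{C_k}}[ Σ_{x∈C_k} c̃(η_x) ] ]² ≤ N ν_Λ^N[f] ( C_ε ν_Λ^N[f] + C_ε L² E_{ν_Λ^N}(√f,√f) + ε Ent_{ν_Λ^N}(f) ). -/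
open scoped BigOperators

noncomputable section

/-- Grand canonical partition function `Z(α) = Σ_k α^k / c(k)!`. -/
def Zfun (c : ℕ → ℝ) (α : ℝ) : ℝ := ∑' k : ℕ, α ^ k / cfact c k

/-- Mean particle number per site under the grand canonical measure with fugacity `α`. -/
def meanGC (c : ℕ → ℝ) (α : ℝ) : ℝ :=
  (∑' k : ℕ, (k : ℝ) * α ^ k / cfact c k) / Zfun c α

namespace ZR

lemma hs_cast {f g : ℕ → ℝ} {x y : ℝ} (h : HasSum f x) (hf : ∀ k, g k = f k) (hx : y = x) :
    HasSum g y := by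
  rw [hx, funext hf]
  exact h

lemma c_lip (c : ℕ → ℝ) (a₁ : ℝ) (hLG : ∀ k : ℕ, |c (k + 1) - c k| ≤ a₁) (j d : ℕ) :
    |c (j + d) - c j| ≤ a₁ * d := by
  induction d with
  | zero => simp
  | succ d ih =>
    have h := hLG (j + d)
    rw [abs_le] at *
    rw [← add_assoc]
    push_cast
    constructor <;> linarith [h.1, h.2, ih.1, ih.2]

lemma c_lip' (c : ℕ → ℝ) (a₁ : ℝ) (hLG : ∀ k : ℕ, |c (k + 1) - c k| ≤ a₁) (j k : ℕ) :
    |c k - c j| ≤ a₁ * |(k : ℝ) - j| := by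
  rcases le_total j k with h | h
  · obtain ⟨d, rfl⟩ := Nat.exists_eq_add_of_le h
    have := c_lip c a₁ hLG j d
    push_cast
    rwa [add_sub_cancel_left, abs_of_nonneg (Nat.cast_nonneg d : (0 : ℝ) ≤ d)]
  · obtain ⟨d, rfl⟩ := Nat.exists_eq_add_of_le h
    have := c_lip c a₁ hLG k d
    rw [abs_sub_comm, abs_sub_comm (k : ℝ)]
    push_cast
    rwa [add_sub_cancel_left, abs_of_nonneg (Nat.cast_nonneg d : (0 : ℝ) ≤ d)]

lemma c_upper (c : ℕ → ℝ) (a₁ : ℝ) (hc0 : c 0 = 0)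
    (hLG : ∀ k : ℕ, |c (k + 1) - c k| ≤ a₁) (n : ℕ) : c n ≤ a₁ * n := by
  have := c_lip c a₁ hLG 0 n
  rw [hc0, zero_add, sub_zero] at this
  exact (abs_le.1 this).2

lemma c_block (c : ℕ → ℝ) (a₂ : ℝ) (k₀ : ℕ)
    (hM : ∀ j k : ℕ, j + k₀ ≤ k → a₂ ≤ c k - c j) (j q : ℕ) :
    a₂ * q ≤ c (j + q * k₀) - c j := by
  induction q with
  | zero => simp
  | succ q ih =>
    have h := hM (j + q * k₀) (j + (q + 1) * k₀) (by ring_nf; omega)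
    push_cast
    linarith

lemma c_quasi (c : ℕ → ℝ) (a₁ a₂ : ℝ) (k₀ : ℕ)
    (hLG : ∀ k : ℕ, |c (k + 1) - c k| ≤ a₁)
    (hk₀ : 0 < k₀) (ha₂ : 0 < a₂)
    (hM : ∀ j k : ℕ, j + k₀ ≤ k → a₂ ≤ c k - c j) :
    ∃ a b : ℝ, 0 < a ∧ 0 < b ∧ ∀ j k : ℕ, j ≤ k → a * ((k : ℝ) - j) - b ≤ c k - c j := by
  have ha1 : 0 ≤ a₁ := (abs_nonneg _).trans (hLG 0)
  have hk : (0 : ℝ) < k₀ := by exact_mod_cast hk₀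
  refine ⟨a₂ / k₀, a₂ + a₁ * k₀, by positivity, by positivity, ?_⟩
  intro j k hjk
  obtain ⟨d, rfl⟩ := Nat.exists_eq_add_of_le hjk
  have h1 := c_block c a₂ k₀ hM j (d / k₀)
  have h2 := c_lip c a₁ hLG (j + d / k₀ * k₀) (d % k₀)
  have h3 : j + d / k₀ * k₀ + d % k₀ = j + d := by
    rw [add_assoc, Nat.div_add_mod' d k₀]
  rw [h3] at h2
  have h4 : ((d % k₀ : ℕ) : ℝ) ≤ k₀ := by exact_mod_cast (Nat.mod_lt d hk₀).le
  have h5 : (d : ℝ) = ((d / k₀ : ℕ) : ℝ) * k₀ + ((d % k₀ : ℕ) : ℝ) := by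
    exact_mod_cast (Nat.div_add_mod' d k₀).symm
  have h6 := (abs_le.1 h2).1
  have h7 : a₁ * ((d % k₀ : ℕ) : ℝ) ≤ a₁ * k₀ := mul_le_mul_of_nonneg_left h4 ha1
  have h8 : a₂ / k₀ * (d : ℝ) ≤ a₂ * ((d / k₀ : ℕ) : ℝ) + a₂ := by
    rw [div_mul_eq_mul_div, div_le_iff₀ hk, h5]
    nlinarith
  push_cast
  rw [add_sub_cancel_left]
  linarith

lemma c_lower (c : ℕ → ℝ) (a₂ : ℝ) (k₀ : ℕ)
    (hc0 : c 0 = 0) (hcpos : ∀ n : ℕ, 0 < n → 0 < c n)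
    (hk₀ : 0 < k₀) (ha₂ : 0 < a₂)
    (hM : ∀ j k : ℕ, j + k₀ ≤ k → a₂ ≤ c k - c j) :
    ∃ cm : ℝ, 0 < cm ∧ ∀ n : ℕ, cm * n ≤ c n := by
  have hk : (0 : ℝ) < k₀ := by exact_mod_cast hk₀
  have key : ∀ K : ℕ, ∃ cm : ℝ, 0 < cm ∧ ∀ n < K, cm * n ≤ c n := by
    intro K
    induction K with
    | zero => exact ⟨1, one_pos, by simp⟩
    | succ K ih =>
      obtain ⟨cm, h, h'⟩ := ih
      rcases Nat.eq_zero_or_pos K with rfl | hK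
      · refine ⟨1, one_pos, ?_⟩
        intro n hn
        have : n = 0 := by omega
        subst this
        simp [hc0]
      · have hK' : (0 : ℝ) < K := by exact_mod_cast hK
        refine ⟨min cm (c K / K), lt_min h (div_pos (hcpos K hK) hK'), ?_⟩
        intro n hn
        rcases Nat.lt_succ_iff_lt_or_eq.1 hn with h1 | h1
        · exact (mul_le_mul_of_nonneg_right (min_le_left _ _) (Nat.cast_nonneg n)).trans (h' n h1)
        · subst h1
          refine (mul_le_mul_of_nonneg_right (min_le_right _ _) (Nat.cast_nonneg n)).trans ?_
          rw [div_mul_cancel₀ _ hK'.ne']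
  obtain ⟨cm, h, h'⟩ := key k₀
  refine ⟨min cm (a₂ / (2 * k₀)), lt_min h (by positivity), ?_⟩
  intro n
  rcases lt_or_ge n k₀ with h1 | h1
  · exact (mul_le_mul_of_nonneg_right (min_le_left _ _) (Nat.cast_nonneg n)).trans (h' n h1)
  · refine (mul_le_mul_of_nonneg_right (min_le_right _ _) (Nat.cast_nonneg n)).trans ?_
    have h2 := c_block c a₂ k₀ hM (n % k₀) (n / k₀)
    have h3 : n % k₀ + n / k₀ * k₀ = n := by rw [add_comm, Nat.div_add_mod' n k₀]
    rw [h3] at h2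
    have h4 : 0 ≤ c (n % k₀) := by
      rcases Nat.eq_zero_or_pos (n % k₀) with h5 | h5
      · rw [h5, hc0]
      · exact (hcpos _ h5).le
    have h5 : (n : ℝ) = ((n / k₀ : ℕ) : ℝ) * k₀ + ((n % k₀ : ℕ) : ℝ) := by
      exact_mod_cast (Nat.div_add_mod' n k₀).symm
    have h6 : ((n % k₀ : ℕ) : ℝ) ≤ k₀ := by exact_mod_cast (Nat.mod_lt n hk₀).le
    have h7 : (1 : ℝ) ≤ ((n / k₀ : ℕ) : ℝ) := by
      exact_mod_cast (Nat.one_le_div_iff hk₀).2 h1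
    have h8 : a₂ / (2 * k₀) * (n : ℝ) ≤ a₂ * ((n / k₀ : ℕ) : ℝ) := by
      rw [div_mul_eq_mul_div, div_le_iff₀ (by positivity), h5]
      have : (k₀ : ℝ) ≤ ((n / k₀ : ℕ) : ℝ) * k₀ := by nlinarith
      nlinarith
    linarith

lemma cfact_lower (c : ℕ → ℝ) (cm : ℝ) (hcm : 0 < cm) (hl : ∀ n : ℕ, cm * n ≤ c n) (n : ℕ) :
    cm ^ n * (n.factorial : ℝ) ≤ cfact c n := by
  induction n with
  | zero => simp [cfact]
  | succ n ih =>
    rw [cfact, Nat.factorial_succ, pow_succ]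
    have h := hl (n + 1)
    have h0 : (0 : ℝ) ≤ cm ^ n * (n.factorial : ℝ) := by positivity
    have h1 : (0 : ℝ) ≤ cm * ((n + 1 : ℕ) : ℝ) := by positivity
    calc cm ^ n * cm * (((n + 1) * n.factorial : ℕ) : ℝ)
        = (cm ^ n * (n.factorial : ℝ)) * (cm * ((n + 1 : ℕ) : ℝ)) := by push_cast; ring
      _ ≤ _ := mul_le_mul ih h h1 (h0.trans ih)

/-- Normalised grand canonical weights. -/
lemma gc_exists (c : ℕ → ℝ) (cm : ℝ) (hcm : 0 < cm) (hl : ∀ n : ℕ, cm * n ≤ c n)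
    (α ρ : ℝ) (hα : 0 < α) (hm : meanGC c α = ρ) :
    ∃ μ : ℕ → ℝ, (∀ k, 0 < μ k) ∧ (∀ k, c (k + 1) * μ (k + 1) = α * μ k) ∧
      HasSum μ 1 ∧ HasSum (fun k : ℕ => (k : ℝ) * μ k) ρ := by
  have hcf : ∀ n, 0 < cfact c n := fun n =>
    lt_of_lt_of_le (by positivity) (cfact_lower c cm hcm hl n)
  have hb : ∀ n, α ^ n / cfact c n ≤ (α / cm) ^ n / (n.factorial : ℝ) := by
    intro n
    rw [div_pow, div_div]
    exact div_le_div_of_nonneg_left (by positivity) (by positivity) (cfact_lower c cm hcm hl n)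
  have hs0 : Summable (fun k : ℕ => α ^ k / cfact c k) :=
    Summable.of_nonneg_of_le (fun n => (div_pos (by positivity) (hcf n)).le) hb
      (Real.summable_pow_div_factorial _)
  have hs1 : Summable (fun k : ℕ => (k : ℝ) * α ^ k / cfact c k) := by
    refine Summable.of_nonneg_of_le
      (fun n => div_nonneg (by positivity) (hcf n).le) (fun n => ?_)
      (Real.summable_pow_div_factorial (2 * (α / cm)))
    have h2 : (n : ℝ) ≤ 2 ^ n := by exact_mod_cast Nat.lt_two_pow_self.le
    rw [mul_div_assoc, mul_pow, mul_div_assoc]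
    exact mul_le_mul h2 (hb n) (div_pos (by positivity) (hcf n)).le (by positivity)
  have hZ : 0 < Zfun c α := hs0.tsum_pos (fun n => (div_pos (by positivity) (hcf n)).le) 0
    (div_pos (by positivity) (hcf 0))
  refine ⟨fun k => α ^ k / cfact c k / Zfun c α,
    fun k => div_pos (div_pos (by positivity) (hcf k)) hZ, ?_, ?_, ?_⟩
  · intro k
    have h1 := (hcf k).ne'
    have h2 : c (k + 1) ≠ 0 := by
      have := hl (k + 1)
      have h3 : 0 < cm * ((k + 1 : ℕ) : ℝ) := by positivity
      exact (lt_of_lt_of_le h3 this).ne'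
    have := hZ.ne'
    simp only [cfact]
    rw [pow_succ]
    field_simp
  · have := hs0.hasSum.div_const (Zfun c α)
    have h : (∑' k : ℕ, α ^ k / cfact c k) / Zfun c α = 1 := div_self hZ.ne'
    rwa [h] at this
  · have := hs1.hasSum.div_const (Zfun c α)
    rw [← hm]
    exact hs_cast this (fun k => by ring) rfl

lemma gc_shift (c : ℕ → ℝ) (hc0 : c 0 = 0) (α ρ : ℝ) (μ : ℕ → ℝ)
    (hrec : ∀ k, c (k + 1) * μ (k + 1) = α * μ k)
    (h0 : HasSum μ 1) (h1 : HasSum (fun k : ℕ => (k : ℝ) * μ k) ρ) :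
    HasSum (fun k => c k * μ k) α ∧ HasSum (fun k : ℕ => (k : ℝ) * (c k * μ k)) (α * (ρ + 1)) := by
  constructor
  · have := (hasSum_nat_add_iff (f := fun k => c k * μ k) 1 (g := α)).1 (by
      have := h0.mul_left α
      exact hs_cast this (fun k => hrec k) (by ring))
    simpa [hc0] using this
  · have := (hasSum_nat_add_iff (f := fun k : ℕ => (k : ℝ) * (c k * μ k)) 1 (g := α * (ρ + 1))).1 (by
      have := (h1.add h0).mul_left α
      exact hs_cast this (fun k => by rw [hrec k]; push_cast; ring) rfl)
    simpa [hc0] using this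

lemma gc_ratio (c : ℕ → ℝ) (hc0 : c 0 = 0) (a₁ cm : ℝ) (hl : ∀ n : ℕ, cm * n ≤ c n)
    (hu : ∀ n : ℕ, c n ≤ a₁ * n) (α ρ : ℝ) (μ : ℕ → ℝ) (hμ : ∀ k, 0 < μ k)
    (hrec : ∀ k, c (k + 1) * μ (k + 1) = α * μ k)
    (h0 : HasSum μ 1) (h1 : HasSum (fun k : ℕ => (k : ℝ) * μ k) ρ) :
    cm * ρ ≤ α ∧ α ≤ a₁ * ρ := by
  have h2 := (gc_shift c hc0 α ρ μ hrec h0 h1).1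
  constructor
  · refine hasSum_le (fun k => ?_) (h1.mul_left cm) h2
    have := mul_le_mul_of_nonneg_right (hl k) (hμ k).le
    linarith
  · refine hasSum_le (fun k => ?_) h2 (h1.mul_left a₁)
    have := mul_le_mul_of_nonneg_right (hu k) (hμ k).le
    linarith

/-- First absolute centred moment. -/
lemma gc_moment (c : ℕ → ℝ) (hc0 : c 0 = 0) (a b : ℝ) (ha : 0 < a) (hb : 0 < b)
    (hq : ∀ j k : ℕ, j ≤ k → a * ((k : ℝ) - j) - b ≤ c k - c j) :
    ∃ b₀ : ℝ, 0 < b₀ ∧ ∀ (α ρ : ℝ) (μ : ℕ → ℝ), 0 < α → 0 < ρ → (∀ k, 0 < μ k) →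
      (∀ k, c (k + 1) * μ (k + 1) = α * μ k) → HasSum μ 1 →
      HasSum (fun k : ℕ => (k : ℝ) * μ k) ρ →
      ∃ s₁, HasSum (fun k : ℕ => |(k : ℝ) - ρ| * μ k) s₁ ∧ s₁ ≤ b₀ * √(α + 1) := by
  refine ⟨(1 + a * (1 + (a + b) / (2 * a)) ^ 2) / (2 * a), by positivity, ?_⟩
  intro α ρ μ hα hρ hμ hrec h0 h1
  have hsum : Summable (fun k : ℕ => |(k : ℝ) - ρ| * μ k) := by
    refine Summable.of_nonneg_of_le (fun k => mul_nonneg (abs_nonneg _) (hμ k).le) (fun k => ?_)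
      (h1.add (h0.mul_left ρ)).summable
    have : |(k : ℝ) - ρ| ≤ k + ρ := by
      rw [abs_le]; constructor <;> linarith [(Nat.cast_nonneg k : (0 : ℝ) ≤ k)]
    have := mul_le_mul_of_nonneg_right this (hμ k).le
    linarith
  obtain ⟨s₁, hs₁⟩ := hsum
  refine ⟨s₁, hs₁, ?_⟩
  obtain ⟨g1, g2⟩ := gc_shift c hc0 α ρ μ hrec h0 h1
  set s := √(α + 1) with hs
  have hs2 : s ^ 2 = α + 1 := Real.sq_sqrt (by linarith)
  have hs1 : 1 ≤ s := by rw [hs]; exact Real.one_le_sqrt.2 (by linarith)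
  set n₀ := ⌊ρ⌋₊ with hn0
  have hn1 : (n₀ : ℝ) ≤ ρ := Nat.floor_le hρ.le
  have hn2 : ρ < n₀ + 1 := Nat.lt_floor_add_one ρ
  set lam := s + (a + b) / (2 * a) with hlam
  have hA : HasSum (fun k : ℕ => ((k : ℝ) - ρ) * (c k - c n₀) * μ k) α := by
    have := (g2.sub (g1.mul_left ρ)).sub ((h1.sub (h0.mul_left ρ)).mul_left (c n₀))
    exact hs_cast this (fun k => by ring) (by ring)
  have hB := (hs₁.mul_left (2 * a * s)).sub (h0.mul_left (a * lam ^ 2))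
  have hle := hasSum_le (fun k => ?_) hB hA
  · have hl2 : lam ≤ (1 + (a + b) / (2 * a)) * s := by
      rw [hlam]
      have : 0 < (a + b) / (2 * a) := by positivity
      nlinarith
    have hl0 : 0 ≤ lam := by positivity
    have hl3 : lam ^ 2 ≤ ((1 + (a + b) / (2 * a)) * s) ^ 2 := pow_le_pow_left₀ hl0 hl2 2
    rw [div_mul_eq_mul_div, le_div_iff₀ (by positivity)]
    have h4 : s₁ * (2 * a) * s ≤ (1 + a * (1 + (a + b) / (2 * a)) ^ 2) * s * s := by
      have : a * lam ^ 2 ≤ a * ((1 + (a + b) / (2 * a)) * s) ^ 2 := by gcongr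
      nlinarith
    exact le_of_mul_le_mul_right h4 (by linarith)
  · have key : 2 * a * s * |(k : ℝ) - ρ| - a * lam ^ 2 ≤ ((k : ℝ) - ρ) * (c k - c n₀) := by
      have e1 : a * |(k : ℝ) - ρ| ^ 2 - (a + b) * |(k : ℝ) - ρ| ≤ ((k : ℝ) - ρ) * (c k - c n₀) := by
        rcases le_or_gt k n₀ with hk | hk
        · have h5 := hq k n₀ hk
          have h6 : (k : ℝ) ≤ n₀ := by exact_mod_cast hk
          rw [abs_of_nonpos (by linarith)]
          have h7 : a * (ρ - k) - (a + b) ≤ c n₀ - c k := by nlinarith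
          nlinarith [mul_le_mul_of_nonneg_left h7 (by linarith : 0 ≤ ρ - k)]
        · have h5 := hq n₀ k hk.le
          have h6 : (n₀ : ℝ) + 1 ≤ k := by exact_mod_cast hk
          rw [abs_of_nonneg (by linarith)]
          have h7 : a * (k - ρ) - (a + b) ≤ c k - c n₀ := by nlinarith
          nlinarith [mul_le_mul_of_nonneg_left h7 (by linarith : 0 ≤ k - ρ)]
      have e2 : 2 * a * s = 2 * a * lam - (a + b) := by
        rw [hlam]; field_simp; ring
      rw [e2]
      nlinarith [sq_nonneg (|(k : ℝ) - ρ| - lam), mul_nonneg ha.le (sq_nonneg (|(k : ℝ) - ρ| - lam))]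
    have := mul_le_mul_of_nonneg_right key (hμ k).le
    linarith

lemma gc_conc (c : ℕ → ℝ) (hc0 : c 0 = 0) (a₁ a b : ℝ) (ha₁ : 0 < a₁) (ha : 0 < a) (hb : 0 < b)
    (hlip : ∀ j k : ℕ, |c k - c j| ≤ a₁ * |(k : ℝ) - j|)
    (hq : ∀ j k : ℕ, j ≤ k → a * ((k : ℝ) - j) - b ≤ c k - c j) :
    ∃ b₁ : ℝ, 0 < b₁ ∧ ∀ (α ρ : ℝ) (μ : ℕ → ℝ), 0 < α → 0 < ρ → (∀ k, 0 < μ k) →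
      (∀ k, c (k + 1) * μ (k + 1) = α * μ k) → HasSum μ 1 →
      HasSum (fun k : ℕ => (k : ℝ) * μ k) ρ →
      ∀ n : ℕ, |c n - α| ≤ a₁ * |(n : ℝ) - ρ| + b₁ * √(α + 1) ∧
        (ρ ≤ n → a * ((n : ℝ) - ρ) - b₁ * √(α + 1) ≤ c n - α) ∧
        ((n : ℝ) ≤ ρ → a * (ρ - n) - b₁ * √(α + 1) ≤ α - c n) := by
  obtain ⟨b₀, hb₀, H⟩ := gc_moment c hc0 a b ha hb hq
  refine ⟨b + (a + a₁) * b₀, by positivity, ?_⟩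
  intro α ρ μ hα hρ hμ hrec h0 h1 n
  obtain ⟨s₁, hs₁, hle⟩ := H α ρ μ hα hρ hμ hrec h0 h1
  obtain ⟨g1, -⟩ := gc_shift c hc0 α ρ μ hrec h0 h1
  have hs1 : 1 ≤ √(α + 1) := Real.one_le_sqrt.2 (by linarith)
  have hs0 : 0 ≤ s₁ := hs₁.nonneg (fun k => mul_nonneg (abs_nonneg _) (hμ k).le)
  have hB : b + (a + a₁) * s₁ ≤ (b + (a + a₁) * b₀) * √(α + 1) := by
    have : (a + a₁) * s₁ ≤ (a + a₁) * (b₀ * √(α + 1)) := by gcongr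
    nlinarith
  have hB1 : a₁ * s₁ ≤ b + (a + a₁) * s₁ := by nlinarith [mul_nonneg ha.le hs0]
  have hD : HasSum (fun k => (c n - c k) * μ k) (c n - α) := by
    have := (h0.mul_left (c n)).sub g1
    exact hs_cast this (fun k => by ring) (by ring)
  have hE : HasSum (fun k : ℕ => ((n : ℝ) - k) * μ k) (n - ρ) := by
    have := (h0.mul_left (n : ℝ)).sub h1
    exact hs_cast this (fun k => by ring) (by ring)
  refine ⟨?_, ?_, ?_⟩
  · have hF := (h0.mul_left (a₁ * |(n : ℝ) - ρ|)).add (hs₁.mul_left a₁)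
    have hpt : ∀ k : ℕ, |c n - c k| ≤ a₁ * |(n : ℝ) - ρ| + a₁ * |(k : ℝ) - ρ| := by
      intro k
      refine (hlip k n).trans ?_
      rw [← mul_add]
      refine mul_le_mul_of_nonneg_left ?_ ha₁.le
      rw [abs_sub_comm (k : ℝ) ρ]
      exact abs_sub_le _ _ _
    rw [abs_le]
    constructor
    · have := hasSum_le (fun k => ?_) hF.neg hD
      · linarith
      · have := mul_le_mul_of_nonneg_right (abs_le.1 (hpt k)).1 (hμ k).le
        linarith
    · have := hasSum_le (fun k => ?_) hD hF
      · linarith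
      · have := mul_le_mul_of_nonneg_right (abs_le.1 (hpt k)).2 (hμ k).le
        linarith
  · intro hn
    have hF := ((hE.mul_left a).sub (h0.mul_left b)).sub (hs₁.mul_left (a + a₁))
    have := hasSum_le (fun k => ?_) hF hD
    · linarith
    · have hk : a * ((n : ℝ) - k) - b - (a + a₁) * |(k : ℝ) - ρ| ≤ c n - c k := by
        rcases le_total k n with hkn | hkn
        · have := hq k n hkn
          have : 0 ≤ (a + a₁) * |(k : ℝ) - ρ| := by positivity
          linarith
        · have h5 := (abs_le.1 (hlip k n)).1
          have h6 : (n : ℝ) ≤ k := by exact_mod_cast hkn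
          rw [abs_of_nonpos (by linarith)] at h5
          rw [abs_of_nonneg (by linarith)]
          nlinarith
      have := mul_le_mul_of_nonneg_right hk (hμ k).le
      linarith
  · intro hn
    have hF := ((hE.neg.mul_left a).sub (h0.mul_left b)).sub (hs₁.mul_left (a + a₁))
    have := hasSum_le (fun k => ?_) hF hD.neg
    · linarith
    · have hk : a * (-((n : ℝ) - k)) - b - (a + a₁) * |(k : ℝ) - ρ| ≤ -(c n - c k) := by
        rcases le_total n k with hkn | hkn
        · have := hq n k hkn
          have : 0 ≤ (a + a₁) * |(k : ℝ) - ρ| := by positivity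
          linarith
        · have h5 := (abs_le.1 (hlip k n)).2
          have h6 : (k : ℝ) ≤ n := by exact_mod_cast hkn
          rw [abs_of_nonneg (by linarith)] at h5
          rw [abs_of_nonpos (by linarith)]
          nlinarith
      have := mul_le_mul_of_nonneg_right hk (hμ k).le
      linarith

end ZR

namespace ZR

/-- Discrete Gronwall, downwards. -/
lemma gron_down (r : ℕ → ℝ) (x y : ℝ) (hx : 0 ≤ x) (hy : 0 ≤ y) (p d : ℕ)
    (h : ∀ m, p ≤ m → m < p + d → r m ≤ (1 + x) * r (m + 1) + y) (h0 : 0 ≤ r (p + d)) :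
    r p ≤ Real.exp (d * x) * (r (p + d) + d * y) := by
  induction d generalizing p with
  | zero => simp
  | succ d ih =>
    have e : p + 1 + d = p + (d + 1) := by ring
    have h1 := ih (p + 1) (fun m hm hm' => h m (by omega) (by omega)) (by rwa [e])
    rw [e] at h1
    have h2 := h p le_rfl (by omega)
    have h3 : 1 + x ≤ Real.exp x := by linarith [Real.add_one_le_exp x]
    have h4 : Real.exp (((d + 1 : ℕ) : ℝ) * x) = Real.exp x * Real.exp (d * x) := by
      rw [← Real.exp_add]; congr 1; push_cast; ring
    have h5 : 0 ≤ Real.exp (d * x) * (r (p + (d + 1)) + d * y) := by positivity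
    have h6 : 1 ≤ Real.exp (((d + 1 : ℕ) : ℝ) * x) := Real.one_le_exp (by positivity)
    calc r p ≤ (1 + x) * r (p + 1) + y := h2
      _ ≤ (1 + x) * (Real.exp (d * x) * (r (p + (d + 1)) + d * y)) + y := by gcongr
      _ ≤ Real.exp x * (Real.exp (d * x) * (r (p + (d + 1)) + d * y)) + y := by gcongr
      _ = Real.exp (((d + 1 : ℕ) : ℝ) * x) * (r (p + (d + 1)) + d * y) + 1 * y := by rw [h4]; ring
      _ ≤ Real.exp (((d + 1 : ℕ) : ℝ) * x) * (r (p + (d + 1)) + d * y)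
          + Real.exp (((d + 1 : ℕ) : ℝ) * x) * y := by gcongr
      _ = _ := by push_cast; ring

/-- Discrete Gronwall, upwards. -/
lemma gron_up (r : ℕ → ℝ) (x : ℝ) (hx : 0 ≤ x) (p d : ℕ)
    (h : ∀ m, p ≤ m → m < p + d → r (m + 1) ≤ (1 + x) * r m) (h0 : 0 ≤ r p) :
    r (p + d) ≤ Real.exp (d * x) * r p := by
  induction d with
  | zero => simp
  | succ d ih =>
    have h1 := ih (fun m hm hm' => h m hm (by omega))
    have h2 := h (p + d) (by omega) (by omega)
    have h3 : 1 + x ≤ Real.exp x := by linarith [Real.add_one_le_exp x]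
    have h4 : Real.exp (((d + 1 : ℕ) : ℝ) * x) = Real.exp x * Real.exp (d * x) := by
      rw [← Real.exp_add]; congr 1; push_cast; ring
    calc r (p + (d + 1)) ≤ (1 + x) * r (p + d) := h2
      _ ≤ (1 + x) * (Real.exp (d * x) * r p) := by gcongr
      _ ≤ Real.exp x * (Real.exp (d * x) * r p) := by gcongr
      _ = _ := by rw [h4]; ring

/-- The (unnormalised) Stein kernel. -/
def TT (ρ : ℝ) (μ : ℕ → ℝ) (n : ℕ) : ℝ := ∑ k ∈ Finset.range (n + 1), (ρ - k) * μ k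

lemma TT_succ (ρ : ℝ) (μ : ℕ → ℝ) (n : ℕ) :
    TT ρ μ (n + 1) = TT ρ μ n + (ρ - ((n + 1 : ℕ) : ℝ)) * μ (n + 1) := by
  rw [TT, Finset.sum_range_succ]; rfl

lemma left_upper (c : ℕ → ℝ) (hc0 : c 0 = 0) (α ρ : ℝ) (μ : ℕ → ℝ) (hμ : ∀ k, 0 < μ k)
    (hrec : ∀ k, c (k + 1) * μ (k + 1) = α * μ k) (M : ℝ) (n : ℕ)
    (h : ∀ k, k ≤ n → (ρ - k) ≤ M * (α - c k)) : TT ρ μ n ≤ M * (α * μ n) := by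
  induction n with
  | zero =>
    have := mul_le_mul_of_nonneg_right (h 0 le_rfl) (hμ 0).le
    simp [TT, hc0] at *
    linarith
  | succ n ih =>
    have h1 := ih (fun k hk => h k (by omega))
    have h2 := mul_le_mul_of_nonneg_right (h (n + 1) le_rfl) (hμ (n + 1)).le
    rw [TT_succ]
    have : M * (c (n + 1) * μ (n + 1)) = M * (α * μ n) := by rw [hrec]
    linarith

lemma left_lower (c : ℕ → ℝ) (hc0 : c 0 = 0) (α ρ : ℝ) (μ : ℕ → ℝ) (hμ : ∀ k, 0 < μ k)
    (hrec : ∀ k, c (k + 1) * μ (k + 1) = α * μ k) (M : ℝ) (n : ℕ)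
    (h : ∀ k, k ≤ n → M * (α - c k) ≤ (ρ - k)) : M * (α * μ n) ≤ TT ρ μ n := by
  induction n with
  | zero =>
    have := mul_le_mul_of_nonneg_right (h 0 le_rfl) (hμ 0).le
    simp [TT, hc0] at *
    linarith
  | succ n ih =>
    have h1 := ih (fun k hk => h k (by omega))
    have h2 := mul_le_mul_of_nonneg_right (h (n + 1) le_rfl) (hμ (n + 1)).le
    rw [TT_succ]
    have : M * (c (n + 1) * μ (n + 1)) = M * (α * μ n) := by rw [hrec]
    linarith

lemma TT_tendsto (α ρ : ℝ) (μ : ℕ → ℝ) (h0 : HasSum μ 1)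
    (h1 : HasSum (fun k : ℕ => (k : ℝ) * μ k) ρ) (M : ℝ) :
    Filter.Tendsto (fun n => TT ρ μ n - M * (α * μ n)) Filter.atTop (nhds 0) := by
  have hs : HasSum (fun k : ℕ => (ρ - k) * μ k) 0 :=
    hs_cast ((h0.mul_left ρ).sub h1) (fun k => by ring) (by ring)
  have h2 := (hs.tendsto_sum_nat).comp (Filter.tendsto_add_atTop_nat 1)
  have h3 := ((h0.summable.tendsto_atTop_zero).const_mul α).const_mul M
  have := h2.sub h3
  simpa [TT, Function.comp_def] using this

lemma right_upper (c : ℕ → ℝ) (α ρ : ℝ) (μ : ℕ → ℝ) (hμ : ∀ k, 0 < μ k)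
    (hrec : ∀ k, c (k + 1) * μ (k + 1) = α * μ k) (h0 : HasSum μ 1)
    (h1 : HasSum (fun k : ℕ => (k : ℝ) * μ k) ρ) (M : ℝ) (n : ℕ)
    (h : ∀ k : ℕ, n ≤ k → (k : ℝ) - ρ ≤ M * (c k - α)) : TT ρ μ n ≤ M * (α * μ n) := by
  have hm : Monotone (fun j => TT ρ μ (j + n) - M * (α * μ (j + n))) := by
    refine monotone_nat_of_le_succ (fun j => ?_)
    have h2 := mul_le_mul_of_nonneg_right (h (j + n + 1) (by omega)) (hμ (j + n + 1)).le
    have e : j + 1 + n = j + n + 1 := by ring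
    rw [e, TT_succ]
    have : M * (c (j + n + 1) * μ (j + n + 1)) = M * (α * μ (j + n)) := by rw [hrec]
    linarith
  have ht := (TT_tendsto α ρ μ h0 h1 M).comp (Filter.tendsto_add_atTop_nat n)
  have := hm.ge_of_tendsto ht 0
  simp only [zero_add] at this
  linarith

lemma right_lower (c : ℕ → ℝ) (α ρ : ℝ) (μ : ℕ → ℝ) (hμ : ∀ k, 0 < μ k)
    (hrec : ∀ k, c (k + 1) * μ (k + 1) = α * μ k) (h0 : HasSum μ 1)
    (h1 : HasSum (fun k : ℕ => (k : ℝ) * μ k) ρ) (M : ℝ) (n : ℕ)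
    (h : ∀ k : ℕ, n ≤ k → M * (c k - α) ≤ (k : ℝ) - ρ) : M * (α * μ n) ≤ TT ρ μ n := by
  have hm : Antitone (fun j => TT ρ μ (j + n) - M * (α * μ (j + n))) := by
    refine antitone_nat_of_succ_le (fun j => ?_)
    have h2 := mul_le_mul_of_nonneg_right (h (j + n + 1) (by omega)) (hμ (j + n + 1)).le
    have e : j + 1 + n = j + n + 1 := by ring
    rw [e, TT_succ]
    have : M * (c (j + n + 1) * μ (j + n + 1)) = M * (α * μ (j + n)) := by rw [hrec]
    linarith
  have ht := (TT_tendsto α ρ μ h0 h1 M).comp (Filter.tendsto_add_atTop_nat n)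
  have := hm.le_of_tendsto ht 0
  simp only [zero_add] at this
  linarith

/-- Existence of the Stein solution together with the bounds away from the centre. -/
lemma stein_raw (c : ℕ → ℝ) (hc0 : c 0 = 0) (a₁ a B : ℝ) (ha₁ : 0 < a₁) (ha : 0 < a)
    (α ρ : ℝ) (hα : 0 < α) (μ : ℕ → ℝ) (hμ : ∀ k, 0 < μ k)
    (hrec : ∀ k, c (k + 1) * μ (k + 1) = α * μ k) (h0 : HasSum μ 1)
    (h1 : HasSum (fun k : ℕ => (k : ℝ) * μ k) ρ)
    (hB : ∀ n : ℕ, |c n - α| ≤ a₁ * |(n : ℝ) - ρ| + B ∧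
        (ρ ≤ n → a * ((n : ℝ) - ρ) - B ≤ c n - α) ∧
        ((n : ℝ) ≤ ρ → a * (ρ - n) - B ≤ α - c n)) :
    ∃ r : ℕ → ℝ, (∀ n : ℕ, α * r (n + 1) = c n * r n - (n - ρ)) ∧ (∀ n, 0 ≤ r n) ∧
      (∀ n : ℕ, 2 * B / a ≤ |(n : ℝ) - ρ| → (a₁ + a)⁻¹ ≤ r (n + 1) ∧ r (n + 1) ≤ 2 / a) := by
  refine ⟨fun n => if n = 0 then 0 else TT ρ μ (n - 1) / (α * μ (n - 1)), ?_, ?_, ?_⟩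
  · intro n
    have hn := (hμ n).ne'
    rcases n with _ | n
    · simp [hc0, TT]
      field_simp
    · have hn' := (hμ n).ne'
      simp only [Nat.add_eq_zero_iff, one_ne_zero, and_false, if_false, Nat.add_sub_cancel]
      rw [TT_succ]
      have h2 := hrec n
      have h3 : c (n + 1) = α * μ n / μ (n + 1) := by rw [← h2]; field_simp
      rw [h3]
      field_simp
      ring
  · intro n
    rcases n with _ | n
    · simp
    · simp only [Nat.add_eq_zero_iff, one_ne_zero, and_false, if_false, Nat.add_sub_cancel]
      refine div_nonneg ?_ (mul_pos hα (hμ n)).le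
      rcases le_total (n : ℝ) ρ with h | h
      · have := left_lower c hc0 α ρ μ hμ hrec 0 n (fun k hk => by
          have : (k : ℝ) ≤ n := by exact_mod_cast hk
          linarith)
        linarith
      · have := right_lower c α ρ μ hμ hrec h0 h1 0 n (fun k hk => by
          have : (n : ℝ) ≤ k := by exact_mod_cast hk
          linarith)
        linarith
  · intro n hn
    simp only [Nat.add_eq_zero_iff, one_ne_zero, and_false, if_false, Nat.add_sub_cancel]
    have hp := mul_pos hα (hμ n)
    rw [div_le_iff₀ hp, le_div_iff₀ hp]
    rw [div_le_iff₀ ha] at hn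
    have hM : 0 < a₁ + a := by positivity
    rcases le_total (n : ℝ) ρ with h | h
    · rw [abs_of_nonpos (by linarith)] at hn
      refine ⟨left_lower c hc0 α ρ μ hμ hrec _ n (fun k hk => ?_),
        left_upper c hc0 α ρ μ hμ hrec _ n (fun k hk => ?_)⟩
      · have hk' : (k : ℝ) ≤ n := by exact_mod_cast hk
        have h3 := (abs_le.1 (hB k).1).1
        rw [abs_of_nonpos (by linarith)] at h3
        rw [inv_mul_le_iff₀ hM]
        nlinarith
      · have hk' : (k : ℝ) ≤ n := by exact_mod_cast hk
        have h3 := (hB k).2.2 (by linarith)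
        rw [div_mul_eq_mul_div, le_div_iff₀ ha]
        nlinarith
    · rw [abs_of_nonneg (by linarith)] at hn
      refine ⟨right_lower c α ρ μ hμ hrec h0 h1 _ n (fun k hk => ?_),
        right_upper c α ρ μ hμ hrec h0 h1 _ n (fun k hk => ?_)⟩
      · have hk' : (n : ℝ) ≤ k := by exact_mod_cast hk
        have h3 := (abs_le.1 (hB k).1).2
        rw [abs_of_nonneg (by linarith)] at h3
        rw [inv_mul_le_iff₀ hM]
        nlinarith
      · have hk' : (n : ℝ) ≤ k := by exact_mod_cast hk
        have h3 := (hB k).2.1 (by linarith)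
        rw [div_mul_eq_mul_div, le_div_iff₀ ha]
        nlinarith

/-- Bounds for bounded fugacity. -/
lemma stein_small (c : ℕ → ℝ) (a₁ a b₁ cm α₁ : ℝ) (ha₁ : 0 < a₁) (ha : 0 < a)
    (hb₁ : 0 < b₁) (hcm : 0 < cm) (hα₁ : 0 < α₁)
    (hl : ∀ n : ℕ, cm * n ≤ c n) (hu : ∀ n : ℕ, c n ≤ a₁ * n) :
    ∃ κ R : ℝ, 0 < κ ∧ 0 < R ∧ ∀ (α ρ : ℝ) (r : ℕ → ℝ), 0 < α → 0 < ρ → α ≤ α₁ →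
      cm * ρ ≤ α → α ≤ a₁ * ρ →
      (∀ n : ℕ, α * r (n + 1) = c n * r n - (n - ρ)) → (∀ n, 0 ≤ r n) → 
      (∀ n : ℕ, 2 * (b₁ * √(α + 1)) / a ≤ |(n : ℝ) - ρ| →
        (a₁ + a)⁻¹ ≤ r (n + 1) ∧ r (n + 1) ≤ 2 / a) → c 0 = 0 →
      ∀ n, κ ≤ r (n + 1) ∧ r (n + 1) ≤ R := by
  set P := α₁ / cm with hP
  have hP0 : 0 < P := by positivity
  set D := 2 * (b₁ * √(α₁ + 1)) / a with hD
  have hD0 : 0 < D := by positivity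
  set K := P + D + 1 with hK
  have hK0 : 0 < K := by positivity
  set R := Real.exp (K * P) * (2 / a + K * (K / cm)) with hR
  set κ := min (Real.exp (P * P) * a₁)⁻¹ (a₁ * (P + 1))⁻¹ with hκ
  refine ⟨κ, R, by positivity, by positivity, ?_⟩
  intro α ρ r hα hρ hαα hcρ hραu hrec hr hdir hc0 n
  have hρP : ρ ≤ P := by rw [hP, le_div_iff₀ hcm]; linarith
  have hDα : 2 * (b₁ * √(α + 1)) / a ≤ D := by rw [hD]; gcongr
  have hcn : ∀ m : ℕ, 1 ≤ m → cm ≤ c m := by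
    intro m hm
    have : (1 : ℝ) ≤ m := by exact_mod_cast hm
    exact le_trans (by nlinarith) (hl m)
  constructor
  · rcases lt_or_ge (n : ℝ) ρ with hn | hn
    · refine (min_le_left _ _).trans ?_
      have hg := gron_down r P 0 hP0.le le_rfl 1 n (fun m hm hm' => ?_) (hr _)
      · have h1 := hrec 0
        rw [hc0] at h1
        simp at h1
        have h2 : a₁⁻¹ ≤ r 1 := by
          rw [inv_le_iff_one_le_mul₀ ha₁]
          have : α * 1 ≤ α * (r 1 * a₁) := by
            calc α * 1 ≤ a₁ * ρ := by linarith
              _ = _ := by rw [← h1]; ring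
          exact le_of_mul_le_mul_left this hα
        rw [mul_zero, add_zero, add_comm 1 n] at hg
        have h3 : Real.exp (n * P) ≤ Real.exp (P * P) := by
          apply Real.exp_le_exp.2; nlinarith
        have h4 : a₁⁻¹ ≤ Real.exp (P * P) * r (n + 1) :=
          h2.trans (hg.trans (mul_le_mul_of_nonneg_right h3 (hr _)))
        rw [mul_inv]
        rwa [inv_mul_le_iff₀ (Real.exp_pos _)]
      · have h1 := hrec m
        have h2 : (m : ℝ) ≤ n := by exact_mod_cast (by omega : m ≤ n)
        have h3 : cm * r m ≤ α₁ * r (m + 1) := by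
          calc cm * r m ≤ c m * r m := mul_le_mul_of_nonneg_right (hcn m hm) (hr m)
            _ ≤ α * r (m + 1) := by linarith
            _ ≤ _ := mul_le_mul_of_nonneg_right hαα (hr _)
        have h4 : r m ≤ P * r (m + 1) := by
          rw [hP, div_mul_eq_mul_div, le_div_iff₀ hcm]; linarith
        have := hr (m + 1)
        linarith
    · refine (min_le_right _ _).trans ?_
      have h1 := hrec (n + 1)
      have h2 := mul_nonneg hα.le (hr (n + 1 + 1))
      have h3 := mul_le_mul_of_nonneg_right (hu (n + 1)) (hr (n + 1))
      push_cast at *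
      rw [inv_le_iff_one_le_mul₀ (by positivity)]
      have h5 : ((n : ℝ) + 1 - ρ) ≤ a₁ * (n + 1) * r (n + 1) := by linarith
      have h6 : ((n : ℝ) + 1) * 1 ≤ (n + 1) * (r (n + 1) * (a₁ * (P + 1))) := by
        have h7 : ((n : ℝ) + 1) ≤ (n + 1 - ρ) * (P + 1) := by nlinarith
        have h8 := mul_le_mul_of_nonneg_right h5 (by linarith : 0 ≤ P + 1)
        linarith
      exact le_of_mul_le_mul_left h6 (by positivity)
  · rcases le_or_gt D (|(n : ℝ) - ρ|) with hn | hn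
    · refine (hdir n (hDα.trans hn)).2.trans ?_
      have : 1 ≤ Real.exp (K * P) := Real.one_le_exp (by positivity)
      have h2 : 0 < 2 / a := by positivity
      have h3 : 0 < K * (K / cm) := by positivity
      rw [hR]
      nlinarith
    · set q := ⌈ρ + D⌉₊ with hq
      have hq1 : ρ + D ≤ q := Nat.le_ceil _
      have hq2 : (q : ℝ) < ρ + D + 1 := Nat.ceil_lt_add_one (by positivity)
      have hnq : n ≤ q := by
        have : (n : ℝ) ≤ q := by linarith [(abs_lt.1 hn).2]
        exact_mod_cast this
      obtain ⟨d, hd⟩ := Nat.exists_eq_add_of_le hnq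
      have hdK : (d : ℝ) ≤ K := by
        have : (d : ℝ) ≤ q := by exact_mod_cast (by omega : d ≤ q)
        linarith
      have hqq := (hdir q (hDα.trans (by rw [abs_of_nonneg] <;> linarith))).2
      have hg := gron_down r P (K / cm) hP0.le (by positivity) (n + 1) d (fun m hm hm' => ?_) (hr _)
      · have e : n + 1 + d = q + 1 := by omega
        rw [e] at hg
        refine hg.trans ?_
        rw [hR]
        have := hr (q + 1)
        gcongr
      · have h1 := hrec m
        have h2 : (m : ℝ) ≤ q := by exact_mod_cast (by omega : m ≤ q)
        have h3 : cm * r m ≤ α₁ * r (m + 1) + K := by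
          calc cm * r m ≤ c m * r m := mul_le_mul_of_nonneg_right (hcn m (by omega)) (hr m)
            _ ≤ α * r (m + 1) + K := by linarith
            _ ≤ _ := by linarith [mul_le_mul_of_nonneg_right hαα (hr (m + 1))]
        have h4 : r m ≤ P * r (m + 1) + K / cm := by
          rw [hP, div_mul_eq_mul_div, ← add_div, le_div_iff₀ hcm]; linarith
        have := hr (m + 1)
        linarith

end ZR

namespace ZR

set_option maxHeartbeats 2000000 in
/-- Bounds for large fugacity. -/
lemma stein_large (c : ℕ → ℝ) (a₁ a b₁ : ℝ) (ha₁ : 0 < a₁) (ha : 0 < a)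
    (hb₁ : 0 < b₁) :
    ∃ α₁ κ R : ℝ, 0 < α₁ ∧ 0 < κ ∧ 0 < R ∧ ∀ (α ρ : ℝ) (r : ℕ → ℝ), 0 < ρ → α₁ ≤ α →
      α ≤ a₁ * ρ →
      (∀ n : ℕ, |c n - α| ≤ a₁ * |(n : ℝ) - ρ| + b₁ * √(α + 1)) →
      (∀ n : ℕ, α * r (n + 1) = c n * r n - (n - ρ)) → (∀ n, 0 ≤ r n) → 
      (∀ n : ℕ, 2 * (b₁ * √(α + 1)) / a ≤ |(n : ℝ) - ρ| →
        (a₁ + a)⁻¹ ≤ r (n + 1) ∧ r (n + 1) ≤ 2 / a) →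
      ∀ n, κ ≤ r (n + 1) ∧ r (n + 1) ≤ R := by
  set d := 2 * b₁ / a with hd
  have hd0 : 0 < d := by positivity
  set e := a₁ * (d + 1) + b₁ with he
  have he0 : 0 < e := by positivity
  set e' := 2 * e + a₁ * (d + 2) with he'
  have he'0 : 0 < e' := by positivity
  set X := 4 * e * (2 * d + 1) with hX
  have hX0 : 0 < X := by positivity
  set Y := 4 * (2 * d + 1) * (d + 1) with hY
  have hY0 : 0 < Y := by positivity
  refine ⟨1 + 2 * e' ^ 2, (Real.exp X * (a₁ + a))⁻¹, Real.exp X * (2 / a + Y), by positivity,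
    by positivity, by positivity, ?_⟩
  intro α ρ r hρ hα hαρ hB hrec hr hdir n
  have hα1 : 1 ≤ α := by nlinarith [sq_nonneg e']
  have hα0 : 0 < α := by linarith
  set s := √(α + 1) with hs
  have hs2 : s ^ 2 = α + 1 := Real.sq_sqrt (by linarith)
  have hs1 : 1 ≤ s := by rw [hs]; exact Real.one_le_sqrt.2 (by linarith)
  have hsα : e' * s ≤ α := by
    apply le_of_sq_le_sq _ hα0.le
    rw [mul_pow, hs2]
    nlinarith [sq_nonneg e']
  have hes : 2 * e * s ≤ α := by
    have : 0 < a₁ * (d + 2) * s := by positivity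
    rw [he'] at hsα; linarith
  have hds : (d + 2) * s ≤ ρ := by
    have h1 : 0 < 2 * e * s := by positivity
    have h2 : a₁ * ((d + 2) * s) ≤ a₁ * ρ := by rw [he'] at hsα; linarith
    exact le_of_mul_le_mul_left h2 ha₁
  set D := 2 * (b₁ * s) / a with hD
  have hDd : D = d * s := by rw [hD, hd]; ring
  have hD0 : 0 < D := by positivity
  set x := 2 * e * s / α with hx
  have hx0 : 0 < x := by positivity
  have hxα : x * α = 2 * e * s := by rw [hx]; field_simp
  set y := 2 * (d + 1) * s / α with hy
  have hy0 : 0 < y := by positivity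
  have hyα : y * α = 2 * (d + 1) * s := by rw [hy]; field_simp
  have hwin : ∀ m : ℕ, |(m : ℝ) - ρ| ≤ D + 1 →
      α ≤ (1 + x) * c m ∧ c m ≤ (1 + x) * α ∧ α / 2 ≤ c m := by
    intro m hm
    have h1 : |c m - α| ≤ e * s := by
      refine (hB m).trans ?_
      have : a₁ * |(m : ℝ) - ρ| ≤ a₁ * (D + 1) := by gcongr
      rw [he]
      have : a₁ * 1 ≤ a₁ * s := by gcongr
      rw [hDd] at *
      linarith
    rw [abs_le] at h1
    have hes0 : 0 < e * s := by positivity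
    refine ⟨?_, ?_, by linarith [h1.1]⟩
    · have hx1 : x ≤ 1 := by rw [hx, div_le_one hα0]; exact hes
      have : (1 + x) * (α - e * s) ≤ (1 + x) * c m := by
        apply mul_le_mul_of_nonneg_left _ (by linarith); linarith [h1.1]
      nlinarith
    · linarith [h1.2]
  have hstep : ∀ k : ℕ, (k : ℝ) ≤ 2 * D + 1 → k * x ≤ X ∧ k * y ≤ Y := by
    intro k hk
    have hk' : (k : ℝ) ≤ (2 * d + 1) * s := by rw [hDd] at hk; linarith
    have hss : s * s ≤ 2 * α := by nlinarith
    constructor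
    · calc (k : ℝ) * x ≤ (2 * d + 1) * s * x := by gcongr
        _ = 2 * e * (2 * d + 1) * (s * s) / α := by rw [hx]; ring
        _ ≤ 2 * e * (2 * d + 1) * (2 * α) / α := by gcongr
        _ = X := by rw [hX]; field_simp; ring
    · calc (k : ℝ) * y ≤ (2 * d + 1) * s * y := by gcongr
        _ = 2 * (d + 1) * (2 * d + 1) * (s * s) / α := by rw [hy]; ring
        _ ≤ 2 * (d + 1) * (2 * d + 1) * (2 * α) / α := by gcongr
        _ = Y := by rw [hY]; field_simp; ring
  have hE1 : 1 ≤ Real.exp X := Real.one_le_exp hX0.le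
  have ha0 : 0 < 2 / a := by positivity
  have hfin : ∀ k : ℕ, (k : ℝ) ≤ 2 * D + 1 → (a₁ + a)⁻¹ ≤ Real.exp (k * x) * r (n + 1) →
      (Real.exp X * (a₁ + a))⁻¹ ≤ r (n + 1) := by
    intro k hk h
    rw [mul_inv, inv_mul_le_iff₀ (Real.exp_pos _)]
    refine h.trans (mul_le_mul_of_nonneg_right ?_ (hr _))
    exact Real.exp_le_exp.2 (hstep k hk).1
  rcases le_or_gt D (|(n : ℝ) - ρ|) with hn | hn
  · obtain ⟨h1, h2⟩ := hdir n hn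
    constructor
    · refine le_trans ?_ h1
      rw [mul_inv]
      exact mul_le_of_le_one_left (by positivity) (inv_le_one_of_one_le₀ hE1)
    · refine h2.trans ?_
      calc 2 / a ≤ 1 * (2 / a + Y) := by linarith
        _ ≤ Real.exp X * (2 / a + Y) := by gcongr
  · rw [abs_lt] at hn
    set q := ⌈ρ + D⌉₊ with hq
    have hq1 : ρ + D ≤ q := Nat.le_ceil _
    have hq2 : (q : ℝ) < ρ + D + 1 := Nat.ceil_lt_add_one (by positivity)
    have hnq : n ≤ q := by
      have : (n : ℝ) ≤ q := by linarith
      exact_mod_cast this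
    obtain ⟨k, hk⟩ := Nat.exists_eq_add_of_le hnq
    have hkR : (q : ℝ) = n + k := by exact_mod_cast hk
    have hkD : (k : ℝ) ≤ 2 * D + 1 := by linarith
    have hqq := hdir q (by rw [abs_of_nonneg] <;> linarith)
    have eq : n + 1 + k = q + 1 := by omega
    constructor
    · rcases le_or_gt ρ (n : ℝ) with hnρ | hnρ
      · have hg := gron_up r x hx0.le (n + 1) k (fun m hm hm' => ?_) (hr _)
        · rw [eq] at hg
          exact hfin k hkD (hqq.1.trans hg)
        · have m1 : (n : ℝ) + 1 ≤ m := by exact_mod_cast hm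
          have m2 : (m : ℝ) ≤ q := by exact_mod_cast (by omega : m ≤ q)
          have hw := hwin m (by rw [abs_le]; constructor <;> linarith)
          have h1 := hrec m
          have h2 := mul_le_mul_of_nonneg_right hw.2.1 (hr m)
          have h3 : α * r (m + 1) ≤ α * ((1 + x) * r m) := by linarith
          exact le_of_mul_le_mul_left h3 hα0
      · set p := ⌊ρ - D⌋₊ with hp
        have hDρ : D + 2 ≤ ρ := by
          rw [hDd]; linarith
        have hp1 : (p : ℝ) ≤ ρ - D := Nat.floor_le (by linarith)
        have hp2 : ρ - D < p + 1 := Nat.lt_floor_add_one _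
        have hpn : p ≤ n := by
          have : (p : ℝ) ≤ n := by linarith
          exact_mod_cast this
        obtain ⟨j, hj⟩ := Nat.exists_eq_add_of_le hpn
        have hjR : (n : ℝ) = p + j := by exact_mod_cast hj
        have hjD : (j : ℝ) ≤ 2 * D + 1 := by linarith
        have hpp := hdir p (by rw [abs_of_nonpos] <;> linarith)
        have ep : p + 1 + j = n + 1 := by omega
        have hg := gron_down r x 0 hx0.le le_rfl (p + 1) j (fun m hm hm' => ?_) (hr _)
        · rw [ep, mul_zero, add_zero] at hg
          exact hfin j hjD (hpp.1.trans hg)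
        · have m1 : (p : ℝ) + 1 ≤ m := by exact_mod_cast hm
          have m2 : (m : ℝ) ≤ n := by exact_mod_cast (by omega : m ≤ n)
          have hw := hwin m (by rw [abs_le]; constructor <;> linarith)
          have h1 := hrec m
          have h2 := mul_le_mul_of_nonneg_right hw.1 (hr (m + 1))
          have hcm : 0 < c m := by linarith [hw.2.2]
          have h3 : c m * r m ≤ c m * ((1 + x) * r (m + 1) + 0) := by linarith
          exact le_of_mul_le_mul_left h3 hcm
    · have hg := gron_down r x y hx0.le hy0.le (n + 1) k (fun m hm hm' => ?_) (hr _)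
      · rw [eq] at hg
        refine hg.trans ?_
        have h1 := (hstep k hkD).1
        have h2 := (hstep k hkD).2
        have h3 := hr (q + 1)
        have h4 := hqq.2
        gcongr
      · have m1 : (n : ℝ) + 1 ≤ m := by exact_mod_cast hm
        have m2 : (m : ℝ) ≤ q := by exact_mod_cast (by omega : m ≤ q)
        have hw := hwin m (by rw [abs_le]; constructor <;> linarith)
        have h1 := hrec m
        have h2 := mul_le_mul_of_nonneg_right hw.1 (hr (m + 1))
        have hcm : 0 < c m := by linarith [hw.2.2]
        have h4 : D + 1 ≤ y * c m := by
          have : y * (α / 2) ≤ y * c m := mul_le_mul_of_nonneg_left hw.2.2 hy0.le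
          have h5 : y * (α / 2) = (d + 1) * s := by linarith
          rw [hDd]; linarith
        have h3 : c m * r m ≤ c m * ((1 + x) * r (m + 1) + y) := by linarith
        exact le_of_mul_le_mul_left h3 hcm

/-- The Stein solution: existence and uniform bounds. -/
lemma stein (c : ℕ → ℝ) (a₁ a b cm : ℝ) (hc0 : c 0 = 0) (ha₁ : 0 < a₁) (ha : 0 < a) (hb : 0 < b)
    (hcm : 0 < cm)
    (hlip : ∀ j k : ℕ, |c k - c j| ≤ a₁ * |(k : ℝ) - j|)
    (hq : ∀ j k : ℕ, j ≤ k → a * ((k : ℝ) - j) - b ≤ c k - c j)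
    (hl : ∀ n : ℕ, cm * n ≤ c n) (hu : ∀ n : ℕ, c n ≤ a₁ * n) :
    ∃ κ R b₁ : ℝ, 0 < κ ∧ 0 < R ∧ 0 < b₁ ∧ ∀ (α ρ : ℝ), 0 < α → 0 < ρ → meanGC c α = ρ →
      cm * ρ ≤ α ∧ α ≤ a₁ * ρ ∧
      (∀ n : ℕ, |c n - α| ≤ a₁ * |(n : ℝ) - ρ| + b₁ * √(α + 1)) ∧
      ∃ r : ℕ → ℝ, (∀ n : ℕ, α * r (n + 1) = c n * r n - (n - ρ)) ∧
        ∀ n, κ ≤ r (n + 1) ∧ r (n + 1) ≤ R := by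
  obtain ⟨b₁, hb₁, hconc⟩ := gc_conc c hc0 a₁ a b ha₁ ha hb hlip hq
  obtain ⟨α₁, κ, R, hα₁, hκ, hR, hlarge⟩ := stein_large c a₁ a b₁ ha₁ ha hb₁
  obtain ⟨κ', R', hκ', hR', hsmall⟩ := stein_small c a₁ a b₁ cm α₁ ha₁ ha hb₁ hcm hα₁ hl hu
  refine ⟨min κ κ', max R R', b₁, lt_min hκ hκ', lt_max_of_lt_left hR, hb₁, ?_⟩
  intro α ρ hα hρ hm
  obtain ⟨μ, hμ, hrec, h0, h1⟩ := gc_exists c cm hcm hl α ρ hα hm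
  obtain ⟨hr1, hr2⟩ := gc_ratio c hc0 a₁ cm hl hu α ρ μ hμ hrec h0 h1
  have hB := hconc α ρ μ hα hρ hμ hrec h0 h1
  refine ⟨hr1, hr2, fun n => (hB n).1, ?_⟩
  obtain ⟨r, hr, hpos, hdir⟩ := stein_raw c hc0 a₁ a _ ha₁ ha α ρ hα μ hμ hrec h0 h1 hB
  refine ⟨r, hr, fun n => ?_⟩
  rcases le_total α₁ α with h | h
  · obtain ⟨h1, h2⟩ := hlarge α ρ r hρ h hr2 (fun n => (hB n).1) hr hpos hdir n
    exact ⟨(min_le_left _ _).trans h1, h2.trans (le_max_left _ _)⟩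
  · obtain ⟨h1, h2⟩ := hsmall α ρ r hα hρ h hr1 hr2 hr hpos hdir hc0 n
    exact ⟨(min_le_right _ _).trans h1, h2.trans (le_max_right _ _)⟩

end ZR

namespace ZR

/-- Unnormalized product weight. -/
def WW (c : ℕ → ℝ) (Λ : Finset ℤ) (η : ℤ → ℕ) : ℝ := ∏ x ∈ Λ, (cfact c (η x))⁻¹

/-- Unnormalized canonical sum. -/
def SS (c : ℕ → ℝ) (Λ : Finset ℤ) (N : ℕ) (g : (ℤ → ℕ) → ℝ) : ℝ :=
  ∑ η ∈ Finset.piAntidiag Λ N, WW c Λ η * g η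

open Classical in
lemma nuW_eq (c : ℕ → ℝ) (Λ : Finset ℤ) (N : ℕ) (η : ℤ → ℕ) :
    nuW c Λ N η = if η ∈ Finset.piAntidiag Λ N then WW c Λ η else 0 := by
  unfold nuW WW
  rw [Set.indicator_apply]
  congr 1
  rw [Finset.mem_piAntidiag, Set.mem_setOf_eq, eq_iff_iff]
  constructor
  · rintro ⟨h1, h2⟩
    exact ⟨h2, fun i hi => by by_contra h; exact hi (h1 i h)⟩
  · rintro ⟨h1, h2⟩
    exact ⟨fun i hi => by by_contra h; exact hi (h2 i h), h1⟩

lemma tsum_nuW (c : ℕ → ℝ) (Λ : Finset ℤ) (N : ℕ) (g : (ℤ → ℕ) → ℝ) :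
    ∑' η, nuW c Λ N η * g η = SS c Λ N g := by
  classical
  rw [tsum_eq_sum (s := Finset.piAntidiag Λ N)]
  · unfold SS
    refine Finset.sum_congr rfl fun η hη => ?_
    rw [nuW_eq, if_pos hη]
  · intro η hη
    rw [nuW_eq, if_neg hη, zero_mul]

lemma wE_eq (c : ℕ → ℝ) (Λ : Finset ℤ) (N : ℕ) (g : (ℤ → ℕ) → ℝ) :
    wE (nuW c Λ N) g = SS c Λ N g / SS c Λ N (fun _ => 1) := by
  unfold wE
  rw [tsum_nuW, ← tsum_nuW c Λ N (fun _ => 1)]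
  simp

lemma cfact_pos (c : ℕ → ℝ) (hcpos : ∀ n : ℕ, 0 < n → 0 < c n) (k : ℕ) : 0 < cfact c k := by
  induction k with
  | zero => simp [cfact]
  | succ k ih => exact mul_pos ih (hcpos _ (Nat.succ_pos _))

lemma WW_pos (c : ℕ → ℝ) (hcpos : ∀ n : ℕ, 0 < n → 0 < c n) (Λ : Finset ℤ) (η : ℤ → ℕ) :
    0 < WW c Λ η := Finset.prod_pos fun x _ => inv_pos.2 (cfact_pos c hcpos _)

lemma SS_one_pos (c : ℕ → ℝ) (hcpos : ∀ n : ℕ, 0 < n → 0 < c n) (Λ : Finset ℤ) (N : ℕ)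
    (hΛ : Λ.Nonempty) : 0 < SS c Λ N (fun _ => 1) := by
  classical
  unfold SS
  refine Finset.sum_pos (fun η _ => by simpa using WW_pos c hcpos Λ η) ?_
  obtain ⟨x, hx⟩ := hΛ
  refine ⟨Pi.single x N, ?_⟩
  rw [Finset.mem_piAntidiag]
  constructor
  · simp [Finset.sum_pi_single', hx, Pi.single_apply]
  · intro i hi
    by_contra h
    apply hi
    rw [Pi.single_apply, if_neg]
    rintro rfl
    exact h hx

lemma SS_mono (c : ℕ → ℝ) (hcpos : ∀ n : ℕ, 0 < n → 0 < c n) (Λ : Finset ℤ) (N : ℕ)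
    (g h : (ℤ → ℕ) → ℝ) (hgh : ∀ η, ∑ x ∈ Λ, η x = N → g η ≤ h η) :
    SS c Λ N g ≤ SS c Λ N h := by
  unfold SS
  refine Finset.sum_le_sum fun η hη => ?_
  exact mul_le_mul_of_nonneg_left (hgh η (Finset.mem_piAntidiag.1 hη).1) (WW_pos c hcpos Λ η).le

lemma SS_congr (c : ℕ → ℝ) (Λ : Finset ℤ) (N : ℕ)
    (g h : (ℤ → ℕ) → ℝ) (hgh : ∀ η, ∑ x ∈ Λ, η x = N → g η = h η) :
    SS c Λ N g = SS c Λ N h := by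
  unfold SS
  refine Finset.sum_congr rfl fun η hη => ?_
  rw [hgh η (Finset.mem_piAntidiag.1 hη).1]

lemma SS_nonneg (c : ℕ → ℝ) (hcpos : ∀ n : ℕ, 0 < n → 0 < c n) (Λ : Finset ℤ) (N : ℕ)
    (g : (ℤ → ℕ) → ℝ) (hg : ∀ η, 0 ≤ g η) : 0 ≤ SS c Λ N g :=
  Finset.sum_nonneg fun η _ => mul_nonneg (WW_pos c hcpos Λ η).le (hg η)

lemma SS_add (c : ℕ → ℝ) (Λ : Finset ℤ) (N : ℕ) (g h : (ℤ → ℕ) → ℝ) :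
    SS c Λ N (fun η => g η + h η) = SS c Λ N g + SS c Λ N h := by
  unfold SS
  rw [← Finset.sum_add_distrib]
  exact Finset.sum_congr rfl fun _ _ => by ring

lemma SS_sub (c : ℕ → ℝ) (Λ : Finset ℤ) (N : ℕ) (g h : (ℤ → ℕ) → ℝ) :
    SS c Λ N (fun η => g η - h η) = SS c Λ N g - SS c Λ N h := by
  unfold SS
  rw [← Finset.sum_sub_distrib]
  exact Finset.sum_congr rfl fun _ _ => by ring

lemma SS_smul (c : ℕ → ℝ) (Λ : Finset ℤ) (N : ℕ) (t : ℝ) (g : (ℤ → ℕ) → ℝ) :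
    SS c Λ N (fun η => t * g η) = t * SS c Λ N g := by
  unfold SS
  rw [Finset.mul_sum]
  exact Finset.sum_congr rfl fun _ _ => by ring

lemma SS_sum {ι : Type*} (s : Finset ι) (c : ℕ → ℝ) (Λ : Finset ℤ) (N : ℕ)
    (g : ι → (ℤ → ℕ) → ℝ) :
    SS c Λ N (fun η => ∑ i ∈ s, g i η) = ∑ i ∈ s, SS c Λ N (g i) := by
  unfold SS
  rw [Finset.sum_comm]
  exact Finset.sum_congr rfl fun _ _ => by rw [Finset.mul_sum]

lemma SS_shift (c : ℕ → ℝ) (hc0 : c 0 = 0) (hcpos : ∀ n : ℕ, 0 < n → 0 < c n) (Λ : Finset ℤ)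
    (n : ℕ) (y : ℤ) (hy : y ∈ Λ) (G : (ℤ → ℕ) → ℝ) :
    SS c Λ (n + 1) (fun η => c (η y) * G η) = SS c Λ n (fun ξ => G (ξ + Pi.single y 1)) := by
  classical
  symm
  unfold SS
  have hother : ∀ (ξ : ℤ → ℕ) (z : ℤ), z ≠ y → (ξ + Pi.single y 1 : ℤ → ℕ) z = ξ z := by
    intro ξ z hz
    simp [Pi.single_apply, hz]
  have hself : ∀ (ξ : ℤ → ℕ), (ξ + Pi.single y 1 : ℤ → ℕ) y = ξ y + 1 := by
    intro ξ
    simp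
  refine Finset.sum_of_injOn (fun ξ => ξ + Pi.single y 1) ?_ ?_ ?_ ?_
  · intro ξ _ ξ' _ h
    exact add_right_cancel h
  · intro ξ hξ
    have hξ := Finset.mem_piAntidiag.1 (Finset.mem_coe.1 hξ)
    refine Finset.mem_coe.2 (Finset.mem_piAntidiag.2 ⟨?_, ?_⟩)
    · simp only [Pi.add_apply, Finset.sum_add_distrib]
      rw [hξ.1]
      simp [Pi.single_apply, hy]
    · intro i hi
      by_cases h : i = y
      · rw [h]; exact hy
      · apply hξ.2
        have h2 := hother ξ i h
        exact fun h0 => hi (h2.trans h0)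
  · intro η hη hn
    have hη := Finset.mem_piAntidiag.1 hη
    by_cases h : η y = 0
    · simp [h, hc0]
    · exfalso
      apply hn
      have heq : (η - Pi.single y 1) + Pi.single y 1 = η := by
        funext z
        by_cases hz : z = y
        · subst hz
          simp
          omega
        · simp [Pi.single_apply, hz]
      refine ⟨η - Pi.single y 1, Finset.mem_coe.2 (Finset.mem_piAntidiag.2 ⟨?_, ?_⟩), heq⟩
      · have h1 := hη.1
        rw [← heq] at h1
        simp only [Pi.add_apply, Finset.sum_add_distrib] at h1
        simp [Pi.single_apply, hy] at h1
        simpa [Pi.single_apply] using h1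
      · intro i hi
        apply hη.2
        intro h0
        apply hi
        simp [h0]
  · intro ξ _
    have : WW c Λ (ξ + Pi.single y 1) * c (ξ y + 1) = WW c Λ ξ := by
      unfold WW
      rw [← Finset.mul_prod_erase Λ _ hy, ← Finset.mul_prod_erase Λ _ hy, hself]
      have e : ∏ x ∈ Λ.erase y, (cfact c ((ξ + Pi.single y 1 : ℤ → ℕ) x))⁻¹
          = ∏ x ∈ Λ.erase y, (cfact c (ξ x))⁻¹ :=
        Finset.prod_congr rfl fun x hx => by rw [hother ξ x (Finset.ne_of_mem_erase hx)]
      rw [e]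
      have h1 := (cfact_pos c hcpos (ξ y)).ne'
      have h2 := (hcpos (ξ y + 1) (Nat.succ_pos _)).ne'
      have h3 : cfact c (ξ y + 1) = cfact c (ξ y) * c (ξ y + 1) := rfl
      rw [h3]
      field_simp
    dsimp only
    rw [hself, ← this]
    ring

lemma move_add (ξ : ℤ → ℕ) (x y : ℤ) (hxy : x ≠ y) :
    move (ξ + Pi.single x 1) x y = ξ + Pi.single y 1 := by
  funext z
  unfold move
  by_cases hx : z = x
  · subst hx
    simp [Pi.single_apply, hxy]
  · by_cases hy : z = y
    · subst hy
      simp [Pi.single_apply, hx]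
    · simp [Pi.single_apply, hx, hy]

/-- Nearest-neighbour quadratic form. -/
def TN (Λ : Finset ℤ) (u : ℤ → ℝ) : ℝ :=
  ∑ x ∈ Λ, ∑ y ∈ Λ, if |x - y| = 1 then (u y - u x) ^ 2 else 0

lemma TN_nonneg (Λ : Finset ℤ) (u : ℤ → ℝ) : 0 ≤ TN Λ u :=
  Finset.sum_nonneg fun x _ => Finset.sum_nonneg fun y _ => by split_ifs <;> positivity

/-- The Dirichlet integrand. -/
def dirF (c : ℕ → ℝ) (Λ : Finset ℤ) (f : (ℤ → ℕ) → ℝ) (η : ℤ → ℕ) : ℝ :=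
  (1 / 2) * ∑ x ∈ Λ, ∑ y ∈ Λ,
    if |x - y| = 1 then c (η x) * ((f (move η x y) - f η) * (f (move η x y) - f η)) else 0

lemma SS_dir (c : ℕ → ℝ) (hc0 : c 0 = 0) (hcpos : ∀ n : ℕ, 0 < n → 0 < c n) (Λ : Finset ℤ)
    (n : ℕ) (g : (ℤ → ℕ) → ℝ) :
    SS c Λ n (fun ξ => TN Λ (fun x => g (ξ + Pi.single x 1))) =
      2 * SS c Λ (n + 1) (dirF c Λ g) := by
  unfold dirF TN
  rw [SS_smul, SS_sum, SS_sum, ← mul_assoc]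
  norm_num
  refine Finset.sum_congr rfl fun x hx => ?_
  rw [SS_sum, SS_sum]
  refine Finset.sum_congr rfl fun y hy => ?_
  by_cases h : |x - y| = 1
  · simp only [h, if_true]
    rw [SS_shift c hc0 hcpos Λ n x hx
      (fun η => (g (move η x y) - g η) * (g (move η x y) - g η))]
    have hxy : x ≠ y := by rintro rfl; simp at h
    refine SS_congr c Λ n _ _ fun ξ _ => ?_
    rw [move_add ξ x y hxy]
    ring
  · simp [h, SS]

lemma path_sq (a : ℤ) (m : ℕ) (u : ℤ → ℝ) (x : ℤ) (k : ℕ) (hx : a ≤ x) (hk : x + k < a + m) :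
    (u (x + k) - u x) ^ 2 ≤ m * TN (Finset.Ico a (a + m)) u := by
  classical
  have h1 : u (x + k) - u x = ∑ i ∈ Finset.range k, (u (x + i + 1) - u (x + i)) := by
    have := Finset.sum_range_sub (fun i : ℕ => u (x + i)) k
    simp only [Nat.cast_zero, add_zero] at this
    rw [← this]
    refine Finset.sum_congr rfl fun i _ => ?_
    push_cast
    rw [add_assoc]
  rw [h1]
  refine (sq_sum_le_card_mul_sum_sq).trans ?_
  rw [Finset.card_range]
  have hkm : (k : ℝ) ≤ m := by
    have : k ≤ m := by omega
    exact_mod_cast this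
  have hT : ∑ i ∈ Finset.range k, (u (x + i + 1) - u (x + i)) ^ 2
      ≤ TN (Finset.Ico a (a + m)) u := by
    unfold TN
    rw [← Finset.sum_product']
    have hinj : Set.InjOn (fun i : ℕ => ((x + i, x + i + 1) : ℤ × ℤ)) (Finset.range k : Set ℕ) := by
      intro i _ j _ h
      simp at h
      exact h
    have e : ∑ i ∈ Finset.range k, (u (x + i + 1) - u (x + i)) ^ 2 =
        ∑ p ∈ (Finset.range k).image (fun i : ℕ => ((x + i, x + i + 1) : ℤ × ℤ)),
          (if |p.1 - p.2| = 1 then (u p.2 - u p.1) ^ 2 else 0) := by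
      rw [Finset.sum_image hinj]
      refine Finset.sum_congr rfl fun i _ => ?_
      simp
    rw [e]
    refine Finset.sum_le_sum_of_subset_of_nonneg ?_ ?_
    · intro p hp
      obtain ⟨i, hi, rfl⟩ := Finset.mem_image.1 hp
      have := Finset.mem_range.1 hi
      simp only [Finset.mem_product, Finset.mem_Ico]
      omega
    · intro p _ _
      split_ifs <;> positivity
  exact mul_le_mul hkm hT (Finset.sum_nonneg fun _ _ => sq_nonneg _) (Nat.cast_nonneg _)

lemma path_sq' (a : ℤ) (m : ℕ) (u : ℤ → ℝ) (x y : ℤ) (hx : x ∈ Finset.Ico a (a + m))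
    (hy : y ∈ Finset.Ico a (a + m)) :
    (u x - u y) ^ 2 ≤ m * TN (Finset.Ico a (a + m)) u := by
  rw [Finset.mem_Ico] at hx hy
  rcases le_total x y with h | h
  · obtain ⟨k, hk⟩ := Int.le.dest h
    have := path_sq a m u x k hx.1 (by omega)
    rw [hk] at this
    rw [← neg_sq, neg_sub]
    exact this
  · obtain ⟨k, hk⟩ := Int.le.dest h
    have := path_sq a m u y k hy.1 (by omega)
    rwa [hk] at this

lemma site_CS (a : ℤ) (m : ℕ) (hm : 1 ≤ m) (u K : ℤ → ℝ) (M : ℝ)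
    (hK : ∀ x, |K x| ≤ M) :
    (∑ x ∈ Finset.Ico a (a + m), u x ^ 2 *
      (K x - (m : ℝ)⁻¹ * ∑ y ∈ Finset.Ico a (a + m), K y)) ^ 2 ≤
      (4 * M ^ 2 * m ^ 2 * TN (Finset.Ico a (a + m)) u) *
        ∑ x ∈ Finset.Ico a (a + m), u x ^ 2 := by
  set Λ := Finset.Ico a (a + m) with hΛ
  have hcard : (Λ.card : ℝ) = m := by simp [hΛ]
  have hm0 : (0 : ℝ) < m := by exact_mod_cast hm
  have e : ∑ x ∈ Λ, u x ^ 2 * (K x - (m : ℝ)⁻¹ * ∑ y ∈ Λ, K y) =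
      (m : ℝ)⁻¹ * ∑ p ∈ Λ ×ˢ Λ, K p.1 * ((u p.1 - u p.2) * (u p.1 + u p.2)) := by
    rw [Finset.sum_product]
    have h1 : ∀ x ∈ Λ, ∑ y ∈ Λ, K x * ((u x - u y) * (u x + u y)) =
        m * (u x ^ 2 * K x) - K x * ∑ y ∈ Λ, u y ^ 2 := by
      intro x _
      rw [Finset.mul_sum, ← hcard, ← nsmul_eq_mul, ← Finset.sum_const, ← Finset.sum_sub_distrib]
      exact Finset.sum_congr rfl fun _ _ => by ring
    rw [Finset.sum_congr rfl h1, Finset.sum_sub_distrib, ← Finset.mul_sum, ← Finset.sum_mul]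
    simp only [mul_sub, Finset.sum_sub_distrib]
    rw [← Finset.sum_mul]
    field_simp
  rw [e, mul_pow]
  have hT := TN_nonneg Λ u
  have hM0 : 0 ≤ M := (abs_nonneg _).trans (hK 0)
  have cs := Finset.sum_sq_le_sum_mul_sum_of_sq_le_mul (Λ ×ˢ Λ)
    (r := fun p => K p.1 * ((u p.1 - u p.2) * (u p.1 + u p.2)))
    (f := fun _ => M ^ 2 * (m * TN Λ u)) (g := fun p => 2 * (u p.1 ^ 2 + u p.2 ^ 2))
    (fun _ _ => by positivity) (fun _ _ => by positivity) (by
      intro p hp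
      rw [Finset.mem_product] at hp
      have h1 := path_sq' a m u p.1 p.2 hp.1 hp.2
      have h2 : K p.1 ^ 2 ≤ M ^ 2 := sq_le_sq' (by linarith [(abs_le.1 (hK p.1)).1])
        (abs_le.1 (hK p.1)).2
      have h3 : (u p.1 + u p.2) ^ 2 ≤ 2 * (u p.1 ^ 2 + u p.2 ^ 2) := by
        nlinarith [sq_nonneg (u p.1 - u p.2)]
      rw [mul_pow, mul_pow, mul_assoc (M ^ 2)]
      exact mul_le_mul h2 (mul_le_mul h1 h3 (sq_nonneg _) (by positivity)) (by positivity)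
        (by positivity))
  have e2 : ∑ p ∈ Λ ×ˢ Λ, 2 * (u p.1 ^ 2 + u p.2 ^ 2) = 4 * m * ∑ x ∈ Λ, u x ^ 2 := by
    rw [Finset.sum_product]
    simp only [← Finset.mul_sum, Finset.sum_add_distrib, Finset.sum_const, nsmul_eq_mul, hcard]
    ring
  have e3 : ∑ p ∈ Λ ×ˢ Λ, M ^ 2 * (m * TN Λ u) = m ^ 2 * (M ^ 2 * (m * TN Λ u)) := by
    rw [Finset.sum_const, nsmul_eq_mul, Finset.card_product]
    push_cast
    rw [hcard]
    ring
  rw [e2, e3] at cs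
  calc _ ≤ ((m : ℝ)⁻¹) ^ 2 * (m ^ 2 * (M ^ 2 * (m * TN Λ u)) * (4 * m * ∑ x ∈ Λ, u x ^ 2)) := by
        gcongr
    _ = _ := by field_simp

/-- The transport functional associated with a kernel. -/
def DK (c : ℕ → ℝ) (a : ℤ) (m : ℕ) (K : (ℤ → ℕ) → ℤ → ℝ) (η : ℤ → ℕ) : ℝ :=
  ∑ y ∈ Finset.Ico a (a + m), c (η y) * (K (η - Pi.single y 1) y -
    (m : ℝ)⁻¹ * ∑ x ∈ Finset.Ico a (a + m), K (η - Pi.single y 1) x)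

lemma transport (c : ℕ → ℝ) (hc0 : c 0 = 0) (hcpos : ∀ n : ℕ, 0 < n → 0 < c n) (a₁ : ℝ)
    (ha₁ : 0 < a₁) (hu : ∀ n : ℕ, c n ≤ a₁ * n) (a : ℤ) (m n : ℕ) (hm : 1 ≤ m)
    (f : (ℤ → ℕ) → ℝ) (hf : ∀ η, 0 ≤ f η) (K : (ℤ → ℕ) → ℤ → ℝ) (M : ℝ)
    (hK : ∀ ξ x, |K ξ x| ≤ M) :
    |SS c (Finset.Ico a (a + m)) (n + 1) (fun η => f η * DK c a m K η)| ≤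
      M * √(8 * a₁ * m ^ 2 * (n + 1 : ℕ) *
        SS c (Finset.Ico a (a + m)) (n + 1) (dirF c (Finset.Ico a (a + m)) (fun η => √(f η))) *
        SS c (Finset.Ico a (a + m)) (n + 1) f) := by
  set Λ := Finset.Ico a (a + m) with hΛ
  have hM0 : 0 ≤ M := (abs_nonneg _).trans (hK 0 0)
  have e1 : SS c Λ (n + 1) (fun η => f η * DK c a m K η) =
      SS c Λ n (fun ξ => ∑ y ∈ Λ, (√(f (ξ + Pi.single y 1))) ^ 2 *
        (K ξ y - (m : ℝ)⁻¹ * ∑ x ∈ Λ, K ξ x)) := by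
    unfold DK
    simp only [Finset.mul_sum]
    rw [SS_sum, SS_sum]
    refine Finset.sum_congr rfl fun y hy => ?_
    have := SS_shift c hc0 hcpos Λ n y hy (fun η => f η * (K (η - Pi.single y 1) y -
      ∑ x ∈ Λ, (m : ℝ)⁻¹ * K (η - Pi.single y 1) x))
    rw [← hΛ]
    simp only [add_tsub_cancel_right] at this
    simp only [Real.sq_sqrt (hf _)]
    rw [← this]
    exact SS_congr c Λ _ _ _ fun η _ => by ring
  have e2 : SS c Λ n (fun ξ => ∑ x ∈ Λ, (√(f (ξ + Pi.single x 1))) ^ 2) ≤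
      a₁ * (n + 1 : ℕ) * SS c Λ (n + 1) f := by
    rw [SS_sum]
    simp only [Real.sq_sqrt (hf _)]
    have : ∀ x ∈ Λ, SS c Λ n (fun ξ => f (ξ + Pi.single x 1)) =
        SS c Λ (n + 1) (fun η => c (η x) * f η) := fun x hx =>
      (SS_shift c hc0 hcpos Λ n x hx f).symm
    rw [Finset.sum_congr rfl this, ← SS_sum, ← SS_smul]
    refine SS_mono c hcpos Λ _ _ _ fun η hη => ?_
    rw [← Finset.sum_mul]
    refine mul_le_mul_of_nonneg_right ?_ (hf η)
    calc ∑ x ∈ Λ, c (η x) ≤ ∑ x ∈ Λ, a₁ * (η x : ℝ) := Finset.sum_le_sum fun x _ => hu _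
      _ = a₁ * ((∑ x ∈ Λ, η x : ℕ) : ℝ) := by rw [← Finset.mul_sum]; push_cast; rfl
      _ = _ := by rw [hη]
  have e3 := SS_dir c hc0 hcpos Λ n (fun η => √(f η))
  have hSf : 0 ≤ SS c Λ (n + 1) f := SS_nonneg c hcpos Λ _ f hf
  have hTT : 0 ≤ SS c Λ n (fun ξ => TN Λ (fun x => √(f (ξ + Pi.single x 1)))) :=
    SS_nonneg c hcpos Λ _ _ fun ξ => TN_nonneg _ _
  have cs : (SS c Λ n (fun ξ => ∑ y ∈ Λ, (√(f (ξ + Pi.single y 1))) ^ 2 *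
        (K ξ y - (m : ℝ)⁻¹ * ∑ x ∈ Λ, K ξ x))) ^ 2 ≤
      SS c Λ n (fun ξ => 4 * M ^ 2 * m ^ 2 * TN Λ (fun x => √(f (ξ + Pi.single x 1)))) *
        SS c Λ n (fun ξ => ∑ x ∈ Λ, (√(f (ξ + Pi.single x 1))) ^ 2) := by
    unfold SS
    refine Finset.sum_sq_le_sum_mul_sum_of_sq_le_mul _ ?_ ?_ ?_
    · intro ξ _
      have := TN_nonneg Λ (fun x => √(f (ξ + Pi.single x 1)))
      have := WW_pos c hcpos Λ ξ
      positivity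
    · intro ξ _
      have := WW_pos c hcpos Λ ξ
      exact mul_nonneg this.le (Finset.sum_nonneg fun _ _ => sq_nonneg _)
    · intro ξ _
      have := site_CS a m hm (fun x => √(f (ξ + Pi.single x 1))) (K ξ) M (hK ξ)
      have hW := WW_pos c hcpos Λ ξ
      rw [mul_pow, sq (WW c Λ ξ), mul_mul_mul_comm]
      exact mul_le_mul_of_nonneg_left this (by positivity)
  rw [SS_smul, e3] at cs
  rw [e1]
  rw [← Real.sqrt_sq hM0, ← Real.sqrt_mul (sq_nonneg _)]
  refine Real.abs_le_sqrt (cs.trans ?_)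
  rw [e3] at hTT
  calc _ ≤ 4 * M ^ 2 * m ^ 2 * (2 * SS c Λ (n + 1) (dirF c Λ fun η => √(f η))) *
        (a₁ * (n + 1 : ℕ) * SS c Λ (n + 1) f) :=
        mul_le_mul_of_nonneg_left e2 (by positivity)
    _ = _ := by ring

end ZR

namespace ZR

/-- Truncated linear profile. -/
def clip (ρ : ℝ) (n : ℕ) : ℝ := max (-1) (min 1 (((n : ℝ) - ρ) / √ρ))

lemma clip_abs (ρ : ℝ) (n : ℕ) : |clip ρ n| ≤ 1 := by
  unfold clip
  rw [abs_le]
  exact ⟨le_max_left _ _, max_le (by norm_num) (min_le_left _ _)⟩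

lemma clip_mono (ρ : ℝ) {j k : ℕ} (h : j ≤ k) : clip ρ j ≤ clip ρ k := by
  unfold clip
  have : (j : ℝ) ≤ k := by exact_mod_cast h
  gcongr

lemma clip_one (ρ : ℝ) (hρ : 1 ≤ ρ) (n : ℕ) (h : ρ + √ρ ≤ n) : clip ρ n = 1 := by
  have hs : 0 < √ρ := Real.sqrt_pos.2 (by linarith)
  unfold clip
  rw [min_eq_left, max_eq_right (by norm_num)]
  rw [le_div_iff₀ hs]
  linarith

lemma clip_step (ρ : ℝ) (hρ : 1 ≤ ρ) (n : ℕ) : clip ρ (n + 1) ≤ clip ρ n + 1 / √ρ := by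
  have hs : 0 < √ρ := Real.sqrt_pos.2 (by linarith)
  have hs1 : 0 < 1 / √ρ := by positivity
  have e : (((n + 1 : ℕ) : ℝ) - ρ) / √ρ = ((n : ℝ) - ρ) / √ρ + 1 / √ρ := by
    push_cast
    ring
  unfold clip
  rw [e]
  set t := ((n : ℝ) - ρ) / √ρ
  have h1 := le_max_left (-1) (min 1 t)
  have h2 := le_max_right (-1) (min 1 t)
  refine max_le (by linarith) ?_
  rcases le_total 1 t with h | h
  · rw [min_eq_left h] at h2 ⊢
    exact (min_le_left _ _).trans (by linarith)
  · rw [min_eq_right h] at h2 ⊢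
    exact (min_le_right _ _).trans (by linarith)

lemma clip_mul (ρ : ℝ) (hρ : 1 ≤ ρ) (n : ℕ) :
    |(n : ℝ) - ρ| - √ρ ≤ ((n : ℝ) - ρ) * clip ρ n := by
  have hs : 0 < √ρ := Real.sqrt_pos.2 (by linarith)
  unfold clip
  set d := (n : ℝ) - ρ
  rcases le_total (√ρ) |d| with h | h
  · rcases le_total 0 d with h0 | h0
    · rw [abs_of_nonneg h0] at *
      rw [min_eq_left (by rw [le_div_iff₀ hs]; linarith), max_eq_right (by norm_num)]
      linarith
    · rw [abs_of_nonpos h0] at *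
      have h1 : d / √ρ ≤ -1 := by rw [div_le_iff₀ hs]; linarith
      rw [min_eq_right (by linarith), max_eq_left h1]
      linarith
  · have h2 := abs_le.1 h
    have h3 : d / √ρ ≤ 1 := by rw [div_le_iff₀ hs]; linarith
    have h4 : -1 ≤ d / √ρ := by rw [le_div_iff₀ hs]; linarith
    rw [min_eq_right h3, max_eq_right h4, ← mul_div_assoc]
    have : 0 ≤ d * d / √ρ := by have := mul_self_nonneg d; positivity
    linarith

lemma clip_shift (c : ℕ → ℝ) (a₁ : ℝ) (ha₁ : 0 < a₁) (hc0 : c 0 = 0)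
    (hcn : ∀ n, 0 ≤ c n) (hu : ∀ n : ℕ, c n ≤ a₁ * n)
    (ρ : ℝ) (hρ : 1 ≤ ρ) (n : ℕ) : c n * (clip ρ n - clip ρ (n - 1)) ≤ 3 * a₁ * √ρ := by
  have hs : 0 < √ρ := Real.sqrt_pos.2 (by linarith)
  have hs1 : 1 ≤ √ρ := Real.one_le_sqrt.2 hρ
  have hss : √ρ * √ρ = ρ := Real.mul_self_sqrt (by linarith)
  cases n with
  | zero => rw [hc0, zero_mul]; positivity
  | succ n =>
    simp only [Nat.add_sub_cancel]
    rcases le_total (ρ + √ρ) n with h | h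
    · rw [clip_one ρ hρ n h, clip_one ρ hρ (n + 1) (by push_cast; linarith)]
      rw [sub_self, mul_zero]
      positivity
    · have h1 : c (n + 1) ≤ 3 * a₁ * ρ := by
        have := hu (n + 1)
        push_cast at this
        have h3 : (n : ℝ) + 1 ≤ 3 * ρ := by nlinarith
        nlinarith
      have h2 := clip_step ρ hρ n
      have h4 : clip ρ (n + 1) - clip ρ n ≤ 1 / √ρ := by linarith
      calc c (n + 1) * (clip ρ (n + 1) - clip ρ n) ≤ c (n + 1) * (1 / √ρ) :=
            mul_le_mul_of_nonneg_left h4 (hcn _)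
        _ ≤ 3 * a₁ * ρ * (1 / √ρ) := mul_le_mul_of_nonneg_right h1 (by positivity)
        _ = 3 * a₁ * √ρ := by
          rw [← hss]
          field_simp
          simp [hss]

lemma quasi_prod (c : ℕ → ℝ) (a b : ℝ) (hb : 0 < b)
    (hq : ∀ j k : ℕ, j ≤ k → a * ((k : ℝ) - j) - b ≤ c k - c j) (ρ : ℝ) (j k : ℕ) :
    a * (((k : ℝ) - j) * (clip ρ k - clip ρ j)) - 2 * b ≤
      (c k - c j) * (clip ρ k - clip ρ j) := by
  have main : ∀ j k : ℕ, j ≤ k → a * (((k : ℝ) - j) * (clip ρ k - clip ρ j)) - 2 * b ≤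
      (c k - c j) * (clip ρ k - clip ρ j) := by
    intro j k h
    have h1 := clip_mono ρ h
    have h2 := hq j k h
    have h3 := abs_le.1 (clip_abs ρ j)
    have h4 := abs_le.1 (clip_abs ρ k)
    have h5 : (a * ((k : ℝ) - j) - b) * (clip ρ k - clip ρ j) ≤
      (c k - c j) * (clip ρ k - clip ρ j) := mul_le_mul_of_nonneg_right h2 (by linarith)
    have h6 : b * (clip ρ k - clip ρ j) ≤ b * 2 := mul_le_mul_of_nonneg_left (by linarith) hb.le
    linarith
  rcases le_total j k with h | h
  · exact main j k h
  · have := main k j h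
    linarith

lemma double_sum (Λ : Finset ℤ) (g h : ℤ → ℝ) :
    ∑ y ∈ Λ, ∑ x ∈ Λ, (g y - g x) * (h y - h x) =
      2 * (Λ.card * ∑ y ∈ Λ, g y * h y - (∑ y ∈ Λ, g y) * ∑ y ∈ Λ, h y) := by
  have h1 : ∀ y ∈ Λ, ∑ x ∈ Λ, (g y - g x) * (h y - h x) =
      Λ.card * (g y * h y) - g y * ∑ x ∈ Λ, h x - h y * ∑ x ∈ Λ, g x + ∑ x ∈ Λ, g x * h x := by
    intro y _
    rw [← nsmul_eq_mul, ← Finset.sum_const, Finset.mul_sum, Finset.mul_sum,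
      ← Finset.sum_sub_distrib, ← Finset.sum_sub_distrib, ← Finset.sum_add_distrib]
    exact Finset.sum_congr rfl fun _ _ => by ring
  rw [Finset.sum_congr rfl h1]
  simp only [Finset.sum_add_distrib, Finset.sum_sub_distrib, ← Finset.mul_sum, ← Finset.sum_mul,
    Finset.sum_const, nsmul_eq_mul]
  ring

lemma app2 (c : ℕ → ℝ) (a₁ a b : ℝ) (ha₁ : 0 < a₁) (ha : 0 < a) (hb : 0 < b) (hc0 : c 0 = 0)
    (hcn : ∀ n, 0 ≤ c n) (hu : ∀ n : ℕ, c n ≤ a₁ * n)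
    (hq : ∀ j k : ℕ, j ≤ k → a * ((k : ℝ) - j) - b ≤ c k - c j)
    (o : ℤ) (m N : ℕ) (hm : 1 ≤ m) (ρ : ℝ) (hρ : 1 ≤ ρ) (hρN : ρ * m = N) (η : ℤ → ℕ)
    (hη : ∑ x ∈ Finset.Ico o (o + m), η x = N) :
    a * ∑ y ∈ Finset.Ico o (o + m), |(η y : ℝ) - ρ| ≤
      DK c o m (fun ξ x => clip ρ (ξ x)) η + (3 * a₁ + b + a) * √ρ * m := by
  set Λ := Finset.Ico o (o + m) with hΛ
  have hcard : (Λ.card : ℝ) = m := by simp [hΛ]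
  have hm0 : (0 : ℝ) < m := by exact_mod_cast hm
  have hs1 : 1 ≤ √ρ := Real.one_le_sqrt.2 hρ
  have hηR : ∑ x ∈ Λ, (η x : ℝ) = ρ * m := by rw [hρN, ← hη]; push_cast; rfl
  -- compare with the unshifted functional
  have h1 : ∑ y ∈ Λ, (c (η y) * (clip ρ (η y) - (m : ℝ)⁻¹ * ∑ x ∈ Λ, clip ρ (η x))
        - 3 * a₁ * √ρ) ≤ DK c o m (fun ξ x => clip ρ (ξ x)) η := by
    unfold DK
    refine Finset.sum_le_sum fun y _ => ?_
    have h2 := clip_shift c a₁ ha₁ hc0 hcn hu ρ hρ (η y)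
    have h3 : (η - Pi.single y 1 : ℤ → ℕ) y = η y - 1 := by simp
    have h4 : ∑ x ∈ Λ, clip ρ ((η - Pi.single y 1 : ℤ → ℕ) x) ≤ ∑ x ∈ Λ, clip ρ (η x) :=
      Finset.sum_le_sum fun x _ => clip_mono ρ (by simp)
    have h5 : (m : ℝ)⁻¹ * ∑ x ∈ Λ, clip ρ ((η - Pi.single y 1 : ℤ → ℕ) x) ≤
        (m : ℝ)⁻¹ * ∑ x ∈ Λ, clip ρ (η x) := mul_le_mul_of_nonneg_left h4 (by positivity)
    have h6 := mul_le_mul_of_nonneg_left h5 (hcn (η y))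
    beta_reduce
    rw [h3, ← hΛ]
    linarith
  rw [Finset.sum_sub_distrib, Finset.sum_const, nsmul_eq_mul, hcard] at h1
  -- symmetrize
  have h7 : ∑ y ∈ Λ, ∑ x ∈ Λ,
      (a * (((η y : ℝ) - η x) * (clip ρ (η y) - clip ρ (η x))) - 2 * b) ≤
      ∑ y ∈ Λ, ∑ x ∈ Λ, (c (η y) - c (η x)) * (clip ρ (η y) - clip ρ (η x)) :=
    Finset.sum_le_sum fun y _ => Finset.sum_le_sum fun x _ => quasi_prod c a b hb hq ρ _ _
  rw [double_sum Λ (fun y => c (η y)) (fun y => clip ρ (η y))] at h7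
  simp only [Finset.sum_sub_distrib, ← Finset.mul_sum, Finset.sum_const, nsmul_eq_mul] at h7
  have h8 := double_sum Λ (fun y => (η y : ℝ)) (fun y => clip ρ (η y))
  rw [h8, hcard, hηR] at h7
  have h9 : ∑ y ∈ Λ, c (η y) * (clip ρ (η y) - (m : ℝ)⁻¹ * ∑ x ∈ Λ, clip ρ (η x)) =
      (m : ℝ)⁻¹ * (m * ∑ y ∈ Λ, c (η y) * clip ρ (η y) -
        (∑ y ∈ Λ, c (η y)) * ∑ y ∈ Λ, clip ρ (η y)) := by
    simp only [mul_sub, Finset.sum_sub_distrib]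
    rw [← Finset.sum_mul]
    field_simp
  rw [h9] at h1
  set P := m * ∑ y ∈ Λ, c (η y) * clip ρ (η y) - (∑ y ∈ Λ, c (η y)) * ∑ y ∈ Λ, clip ρ (η y)
    with hP
  have h10 : ∑ y ∈ Λ, (|(η y : ℝ) - ρ| - √ρ) ≤ ∑ y ∈ Λ, ((η y : ℝ) - ρ) * clip ρ (η y) :=
    Finset.sum_le_sum fun y _ => clip_mul ρ hρ (η y)
  simp only [sub_mul, Finset.sum_sub_distrib, ← Finset.mul_sum, Finset.sum_const, nsmul_eq_mul,
    hcard] at h10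
  set S1 := ∑ y ∈ Λ, (η y : ℝ) * clip ρ (η y)
  set S2 := ∑ y ∈ Λ, clip ρ (η y)
  set S3 := ∑ y ∈ Λ, |(η y : ℝ) - ρ|
  have h11 : a * m * (S1 - ρ * S2) - b * m * m ≤ P := by nlinarith
  have h12 : a * (S1 - ρ * S2) - b * m ≤ (m : ℝ)⁻¹ * P := by
    rw [inv_mul_eq_div, le_div_iff₀ hm0]
    nlinarith
  have h13 : a * (S3 - m * √ρ) ≤ a * (S1 - ρ * S2) := mul_le_mul_of_nonneg_left h10 ha.le
  have h14 : b * m ≤ b * √ρ * m := by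
    have : b * 1 * m ≤ b * √ρ * m := by gcongr
    linarith
  nlinarith

end ZR

namespace ZR

/-- Empirical average of the Stein profile. -/
def rh (r : ℕ → ℝ) (o : ℤ) (m : ℕ) (ξ : ℤ → ℕ) : ℝ :=
  (m : ℝ)⁻¹ * ∑ x ∈ Finset.Ico o (o + m), r (ξ x + 1)

lemma rh_bounds (r : ℕ → ℝ) (o : ℤ) (m : ℕ) (hm : 1 ≤ m) (κ R : ℝ)
    (hr : ∀ n, κ ≤ r (n + 1) ∧ r (n + 1) ≤ R) (ξ : ℤ → ℕ) :
    κ ≤ rh r o m ξ ∧ rh r o m ξ ≤ R := by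
  unfold rh
  have hm0 : (0 : ℝ) < m := by exact_mod_cast hm
  have h1 : ∑ x ∈ Finset.Ico o (o + m), κ ≤ ∑ x ∈ Finset.Ico o (o + m), r (ξ x + 1) :=
    Finset.sum_le_sum fun x _ => (hr _).1
  have h2 : ∑ x ∈ Finset.Ico o (o + m), r (ξ x + 1) ≤ ∑ x ∈ Finset.Ico o (o + m), R :=
    Finset.sum_le_sum fun x _ => (hr _).2
  simp at h1 h2
  rw [inv_mul_eq_div, le_div_iff₀ hm0, div_le_iff₀ hm0]
  constructor <;> linarith

lemma rh_shift (r : ℕ → ℝ) (o : ℤ) (m : ℕ) (η : ℤ → ℕ) (y : ℤ)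
    (hy : y ∈ Finset.Ico o (o + (m : ℤ))) (h : η y ≠ 0) :
    rh r o m (η - Pi.single y 1) - rh r o m η = (m : ℝ)⁻¹ * (r (η y) - r (η y + 1)) := by
  classical
  unfold rh
  rw [← mul_sub, ← Finset.sum_sub_distrib, Finset.sum_eq_single_of_mem y hy]
  · have : (η - Pi.single y 1 : ℤ → ℕ) y + 1 = η y := by
      simp
      omega
    rw [this]
  · intro x _ hx
    have : (η - Pi.single y 1 : ℤ → ℕ) x = η x := by simp [hx]
    rw [this, sub_self]

/-- Stein transport kernel. -/
def K1 (r : ℕ → ℝ) (o : ℤ) (m : ℕ) (ξ : ℤ → ℕ) (x : ℤ) : ℝ := r (ξ x + 1) / rh r o m ξ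

lemma K1_abs (r : ℕ → ℝ) (o : ℤ) (m : ℕ) (hm : 1 ≤ m) (κ R : ℝ) (hκ : 0 < κ)
    (hr : ∀ n, κ ≤ r (n + 1) ∧ r (n + 1) ≤ R) (ξ : ℤ → ℕ) (x : ℤ) :
    |K1 r o m ξ x| ≤ R / κ := by
  have h1 := rh_bounds r o m hm κ R hr ξ
  have h2 := hr (ξ x)
  unfold K1
  rw [abs_of_nonneg (div_nonneg (by linarith) (by linarith))]
  exact div_le_div₀ (by linarith) h2.2 hκ h1.1

lemma K1_avg (r : ℕ → ℝ) (o : ℤ) (m : ℕ) (hm : 1 ≤ m) (κ R : ℝ) (hκ : 0 < κ)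
    (hr : ∀ n, κ ≤ r (n + 1) ∧ r (n + 1) ≤ R) (ξ : ℤ → ℕ) :
    (m : ℝ)⁻¹ * ∑ x ∈ Finset.Ico o (o + m), K1 r o m ξ x = 1 := by
  have h1 := rh_bounds r o m hm κ R hr ξ
  unfold K1
  rw [← Finset.sum_div, ← mul_div_assoc]
  change rh r o m ξ / rh r o m ξ = 1
  exact div_self (by linarith)

lemma app1 (c : ℕ → ℝ) (hc0 : c 0 = 0) (hcn : ∀ n, 0 ≤ c n)
    (r : ℕ → ℝ) (κ R α ρ : ℝ) (hκ : 0 < κ)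
    (hrec : ∀ n : ℕ, α * r (n + 1) = c n * r n - (n - ρ))
    (hr : ∀ n, κ ≤ r (n + 1) ∧ r (n + 1) ≤ R)
    (o : ℤ) (m N : ℕ) (hm : 1 ≤ m) (hρN : ρ * m = N) (η : ℤ → ℕ)
    (hη : ∑ x ∈ Finset.Ico o (o + m), η x = N) :
    |∑ y ∈ Finset.Ico o (o + m), c (η y) - α * m + DK c o m (K1 r o m) η| ≤
      R / κ ^ 2 * ((m : ℝ)⁻¹ * ∑ y ∈ Finset.Ico o (o + m),
        c (η y) * |r (η y + 1) - r (η y)|) := by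
  set Λ := Finset.Ico o (o + m) with hΛ
  have hcard : (Λ.card : ℝ) = m := by simp [hΛ]
  have hm0 : (0 : ℝ) < m := by exact_mod_cast hm
  have hηR : ∑ x ∈ Λ, (η x : ℝ) = ρ * m := by rw [hρN, ← hη]; push_cast; rfl
  obtain ⟨hb1, hb2⟩ := rh_bounds r o m hm κ R hr η
  have hrb : 0 < rh r o m η := by linarith
  have hR : 0 < R := by linarith
  have e1 : α * m = ∑ y ∈ Λ, c (η y) * (r (η y) / rh r o m η) := by
    have h1 : ∑ y ∈ Λ, c (η y) * r (η y) = α * ∑ y ∈ Λ, r (η y + 1) := by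
      have : ∀ y ∈ Λ, c (η y) * r (η y) = α * r (η y + 1) + (η y - ρ) := by
        intro y _
        rw [hrec]
        ring
      rw [Finset.sum_congr rfl this, Finset.sum_add_distrib, ← Finset.mul_sum,
        Finset.sum_sub_distrib, hηR, Finset.sum_const, nsmul_eq_mul, hcard]
      ring
    have h2 : ∑ y ∈ Λ, r (η y + 1) = m * rh r o m η := by
      unfold rh
      rw [mul_inv_cancel_left₀ hm0.ne']
    rw [h2] at h1
    simp only [← mul_div_assoc]
    rw [← Finset.sum_div, h1]
    field_simp
  rw [e1]
  unfold DK
  rw [← hΛ, ← Finset.sum_sub_distrib, ← Finset.sum_add_distrib, Finset.mul_sum, Finset.mul_sum]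
  refine (Finset.abs_sum_le_sum_abs _ _).trans (Finset.sum_le_sum fun y hy => ?_)
  rw [hΛ, K1_avg r o m hm κ R hκ hr]
  by_cases h0 : η y = 0
  · simp [h0, hc0]
  · have h1 := rh_shift r o m η y hy h0
    obtain ⟨hd1, hd2⟩ := rh_bounds r o m hm κ R hr (η - Pi.single y 1)
    unfold K1
    have h3 : (η - Pi.single y 1 : ℤ → ℕ) y + 1 = η y := by
      simp
      omega
    rw [h3]
    set p := rh r o m (η - Pi.single y 1)
    set q := rh r o m η
    have hp : 0 < p := by linarith
    have hry : κ ≤ r (η y) ∧ r (η y) ≤ R := by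
      have := hr (η y - 1)
      rwa [Nat.sub_add_cancel (by omega)] at this
    have e2 : c (η y) - c (η y) * (r (η y) / q) + c (η y) * (r (η y) / p - 1) =
        c (η y) * ((m : ℝ)⁻¹ * (r (η y + 1) - r (η y))) * (r (η y) / (p * q)) := by
      have : (m : ℝ)⁻¹ * (r (η y + 1) - r (η y)) = q - p := by linarith
      rw [this]
      field_simp
      ring
    rw [e2, abs_mul, abs_mul, abs_mul, abs_of_nonneg (hcn (η y)),
      abs_of_nonneg (by positivity : (0 : ℝ) ≤ (m : ℝ)⁻¹)]
    have h4 : |r (η y) / (p * q)| ≤ R / κ ^ 2 := by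
      rw [abs_of_nonneg (div_nonneg (by linarith) (by positivity)), sq]
      exact div_le_div₀ hR.le hry.2 (by positivity) (mul_le_mul hd1 hb1 hκ.le hp.le)
    have h5 : 0 ≤ c (η y) * ((m : ℝ)⁻¹ * |r (η y + 1) - r (η y)|) :=
      mul_nonneg (hcn _) (by positivity)
    calc _ ≤ c (η y) * ((m : ℝ)⁻¹ * |r (η y + 1) - r (η y)|) * (R / κ ^ 2) :=
          mul_le_mul_of_nonneg_left h4 h5
      _ = _ := by ring

lemma q_small (c : ℕ → ℝ) (a₁ : ℝ) (hc0 : c 0 = 0) (hcn : ∀ n, 0 ≤ c n)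
    (hu : ∀ n : ℕ, c n ≤ a₁ * n)
    (r : ℕ → ℝ) (κ R : ℝ) (hκ : 0 < κ)
    (hr : ∀ n, κ ≤ r (n + 1) ∧ r (n + 1) ≤ R) (n : ℕ) :
    c n * |r (n + 1) - r n| ≤ a₁ * R * n := by
  cases n with
  | zero => simp [hc0]
  | succ n =>
    have h1 := hr n
    have h2 := hr (n + 1)
    have h3 : |r (n + 1 + 1) - r (n + 1)| ≤ R := by
      rw [abs_le]
      constructor <;> linarith
    calc c (n + 1) * |r (n + 1 + 1) - r (n + 1)| ≤ c (n + 1) * R :=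
          mul_le_mul_of_nonneg_left h3 (hcn _)
      _ ≤ (a₁ * (n + 1 : ℕ)) * R := mul_le_mul_of_nonneg_right (hu _) (by linarith)
      _ = _ := by ring

lemma q_large (c : ℕ → ℝ) (a₁ cm b₁ : ℝ) (ha₁ : 0 < a₁) (hcm : 0 < cm) (hb₁ : 0 < b₁)
    (hc0 : c 0 = 0) (hcn : ∀ n, 0 ≤ c n) (hu : ∀ n : ℕ, c n ≤ a₁ * n)
    (r : ℕ → ℝ) (κ R α ρ : ℝ) (hκ : 0 < κ) (hρ : 1 ≤ ρ)
    (hα1 : cm * ρ ≤ α) (hα2 : α ≤ a₁ * ρ)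
    (hconc : ∀ n : ℕ, |c n - α| ≤ a₁ * |(n : ℝ) - ρ| + b₁ * √(α + 1))
    (hrec : ∀ n : ℕ, α * r (n + 1) = c n * r n - (n - ρ))
    (hr : ∀ n, κ ≤ r (n + 1) ∧ r (n + 1) ≤ R) (n : ℕ) :
    c n * |r (n + 1) - r n| ≤
      (2 * a₁ / cm * (R * a₁ + 1) + 2 * a₁ * R) * |(n : ℝ) - ρ| +
        2 * a₁ / cm * (R * (b₁ * √(a₁ + 1))) * √ρ := by
  have hR : 0 < R := by linarith [(hr 0).1, (hr 0).2]
  rcases lt_or_ge (2 * ρ) n with h | h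
  · refine (q_small c a₁ hc0 hcn hu r κ R hκ hr n).trans ?_
    have h1 : (n : ℝ) ≤ 2 * |(n : ℝ) - ρ| := by
      rw [abs_of_nonneg (by linarith)]
      linarith
    have h2 : a₁ * R * n ≤ a₁ * R * (2 * |(n : ℝ) - ρ|) :=
      mul_le_mul_of_nonneg_left h1 (by positivity)
    have h3 : 0 ≤ 2 * a₁ / cm * (R * a₁ + 1) * |(n : ℝ) - ρ| := by positivity
    have h4 : 0 ≤ 2 * a₁ / cm * (R * (b₁ * √(a₁ + 1))) * √ρ := by positivity
    linarith
  · rcases Nat.eq_zero_or_pos n with h0 | h0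
    · rw [h0, hc0, zero_mul]
      positivity
    have hα : 0 < α := lt_of_lt_of_le (by positivity) hα1
    have hrn : κ ≤ r n ∧ r n ≤ R := by
      have := hr (n - 1)
      rwa [Nat.sub_add_cancel h0] at this
    have h1 : α * |r (n + 1) - r n| ≤
        R * (a₁ * |(n : ℝ) - ρ| + b₁ * (√(a₁ + 1) * √ρ)) + |(n : ℝ) - ρ| := by
      have e : α * |r (n + 1) - r n| = |(c n - α) * r n - (n - ρ)| := by
        rw [← abs_of_pos hα, ← abs_mul, abs_of_pos hα]
        congr 1
        linarith [hrec n]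
      rw [e]
      refine (abs_sub _ _).trans ?_
      rw [abs_mul]
      have h2 : √(α + 1) ≤ √(a₁ + 1) * √ρ := by
        rw [← Real.sqrt_mul (by positivity)]
        apply Real.sqrt_le_sqrt
        linarith
      have h3 : |r n| ≤ R := by rw [abs_of_nonneg (by linarith)]; exact hrn.2
      have h4 : |c n - α| ≤ a₁ * |(n : ℝ) - ρ| + b₁ * (√(a₁ + 1) * √ρ) :=
        (hconc n).trans (by gcongr)
      have h5 := mul_le_mul h4 h3 (abs_nonneg _) (by positivity)
      linarith
    have h2 : c n ≤ 2 * a₁ / cm * α := by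
      calc c n ≤ a₁ * n := hu n
        _ ≤ a₁ * (2 * ρ) := by gcongr
        _ = 2 * a₁ / cm * (cm * ρ) := by field_simp
        _ ≤ _ := by gcongr
    calc c n * |r (n + 1) - r n| ≤ 2 * a₁ / cm * α * |r (n + 1) - r n| := by gcongr
      _ = 2 * a₁ / cm * (α * |r (n + 1) - r n|) := by ring
      _ ≤ 2 * a₁ / cm * (R * (a₁ * |(n : ℝ) - ρ| + b₁ * (√(a₁ + 1) * √ρ)) + |(n : ℝ) - ρ|) := by
        gcongr
      _ ≤ _ := by
        have : 0 ≤ 2 * a₁ * R * |(n : ℝ) - ρ| := by positivity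
        linarith

end ZR

set_option maxHeartbeats 4000000
namespace ZR

lemma main_bound (c : ℕ → ℝ) (a₁ a b cm : ℝ) (hc0 : c 0 = 0)
    (hcpos : ∀ n : ℕ, 0 < n → 0 < c n) (ha₁ : 0 < a₁) (ha : 0 < a) (hb : 0 < b)
    (hcm : 0 < cm)
    (hlip : ∀ j k : ℕ, |c k - c j| ≤ a₁ * |(k : ℝ) - j|)
    (hq : ∀ j k : ℕ, j ≤ k → a * ((k : ℝ) - j) - b ≤ c k - c j)
    (hl : ∀ n : ℕ, cm * n ≤ c n) (hu : ∀ n : ℕ, c n ≤ a₁ * n)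
    (A : ℝ → ℝ) (hA : ∀ ρ : ℝ, 0 < ρ → 0 < A ρ ∧ meanGC c (A ρ) = ρ) :
    ∃ C : ℝ, 0 < C ∧ ∀ (o : ℤ) (m n : ℕ), 1 ≤ m → ∃ α : ℝ, ∀ f : (ℤ → ℕ) → ℝ,
      (∀ η, 0 ≤ f η) →
      |SS c (Finset.Ico o (o + m)) (n + 1)
        (fun η => f η * (∑ y ∈ Finset.Ico o (o + m), c (η y) - α * m))| ≤
      C * (√(m ^ 2 * (n + 1 : ℕ) *
        SS c (Finset.Ico o (o + m)) (n + 1) (dirF c (Finset.Ico o (o + m)) (fun η => √(f η))) *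
        SS c (Finset.Ico o (o + m)) (n + 1) f) +
        √(n + 1 : ℕ) * SS c (Finset.Ico o (o + m)) (n + 1) f) := by
  have hcn : ∀ n, 0 ≤ c n := by
    intro n
    rcases Nat.eq_zero_or_pos n with h | h
    · rw [h, hc0]
    · exact (hcpos n h).le
  obtain ⟨κ, R, b₁, hκ, hR, hb₁, hst⟩ := stein c a₁ a b cm hc0 ha₁ ha hb hcm hlip hq hl hu
  set C1 := 2 * a₁ / cm * (R * a₁ + 1) + 2 * a₁ * R with hC1
  set C2 := 2 * a₁ / cm * (R * (b₁ * √(a₁ + 1))) with hC2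
  set C4 := 3 * a₁ + b + a with hC4
  have hC1p : 0 < C1 := by positivity
  have hC2p : 0 < C2 := by positivity
  have hC4p : 0 < C4 := by positivity
  set CB := R / κ + R / κ ^ 2 * (C1 / a) with hCB
  set CN := R / κ ^ 2 * (a₁ * R + (C1 * C4 / a + C2)) with hCN
  have hCBp : 0 < CB := by positivity
  have hCNp : 0 < CN := by positivity
  refine ⟨CB * √(8 * a₁) + CN, by positivity, ?_⟩
  intro o m n hm
  have hm0 : (0 : ℝ) < m := by exact_mod_cast hm
  have hm1 : (1 : ℝ) ≤ m := by exact_mod_cast hm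
  set N : ℕ := n + 1 with hN
  have hN1 : (1 : ℝ) ≤ N := by rw [hN]; push_cast; linarith [(Nat.cast_nonneg n : (0 : ℝ) ≤ n)]
  set ρ : ℝ := N / m with hρ
  have hρ0 : 0 < ρ := by positivity
  have hρN : ρ * m = N := by rw [hρ]; field_simp
  have hρle : ρ ≤ N := by nlinarith
  have hsN1 : 1 ≤ √(N : ℝ) := Real.one_le_sqrt.2 hN1
  obtain ⟨hα, hmean⟩ := hA ρ hρ0
  obtain ⟨hα1, hα2, hconc, r, hrec, hr⟩ := hst (A ρ) ρ hα hρ0 hmean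
  refine ⟨A ρ, ?_⟩
  intro f hf
  set Λ := Finset.Ico o (o + (m : ℤ)) with hΛ
  set S := SS c Λ N f with hS
  have hS0 : 0 ≤ S := SS_nonneg c hcpos Λ N f hf
  set X := √(m ^ 2 * N * SS c Λ N (dirF c Λ (fun η => √(f η))) * S) with hX
  have hX0 : 0 ≤ X := Real.sqrt_nonneg _
  have hB : √(8 * a₁ * m ^ 2 * N * SS c Λ N (dirF c Λ (fun η => √(f η))) * S) =
      √(8 * a₁) * X := by
    rw [hX, ← Real.sqrt_mul (by positivity)]
    congr 1
    ring
  set B := √(8 * a₁) * X with hBdef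
  have hB0 : 0 ≤ B := by positivity
  have t1 := transport c hc0 hcpos a₁ ha₁ hu o m n hm f hf (K1 r o m) (R / κ)
    (K1_abs r o m hm κ R hκ hr)
  rw [← hΛ, ← hN, ← hS, hB] at t1
  -- the error functional
  set Q : (ℤ → ℕ) → ℝ := fun η => (m : ℝ)⁻¹ * ∑ y ∈ Λ, c (η y) * |r (η y + 1) - r (η y)| with hQ
  have hQb : SS c Λ N (fun η => f η * Q η) ≤
      C1 / a * B + (a₁ * R + (C1 * C4 / a + C2)) * √(N : ℝ) * S := by
    rcases lt_or_ge ρ 1 with h1 | h1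
    · have h2 : SS c Λ N (fun η => f η * Q η) ≤ a₁ * R * √(N : ℝ) * S := by
        rw [hS, ← SS_smul]
        refine SS_mono c hcpos Λ N _ _ fun η hη => ?_
        rw [mul_comm]
        refine mul_le_mul_of_nonneg_right ?_ (hf η)
        have hηR : ∑ x ∈ Λ, (η x : ℝ) = ρ * m := by rw [hρN, ← hη]; push_cast; rfl
        have h3 : ∑ y ∈ Λ, c (η y) * |r (η y + 1) - r (η y)| ≤ ∑ y ∈ Λ, a₁ * R * (η y : ℝ) :=
          Finset.sum_le_sum fun y _ => q_small c a₁ hc0 hcn hu r κ R hκ hr (η y)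
        rw [← Finset.mul_sum, hηR] at h3
        calc Q η ≤ (m : ℝ)⁻¹ * (a₁ * R * (ρ * m)) := mul_le_mul_of_nonneg_left h3 (by positivity)
          _ = a₁ * R * ρ := by field_simp
          _ ≤ a₁ * R * √(N : ℝ) := by gcongr; linarith
      have h4 : 0 ≤ C1 / a * B := by positivity
      have h5 : 0 ≤ (C1 * C4 / a + C2) * √(N : ℝ) * S := by positivity
      linarith
    · have t2 := transport c hc0 hcpos a₁ ha₁ hu o m n hm f hf (fun ξ x => clip ρ (ξ x)) 1
        (fun ξ x => clip_abs ρ (ξ x))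
      rw [← hΛ, ← hN, ← hS, hB, one_mul] at t2
      set D2 := DK c o m (fun ξ x => clip ρ (ξ x)) with hD2
      have h2 : SS c Λ N (fun η => f η * Q η) ≤
          SS c Λ N (fun η => C1 / a * (m : ℝ)⁻¹ * (f η * D2 η) + (C1 * C4 / a + C2) * √ρ * f η) := by
        refine SS_mono c hcpos Λ N _ _ fun η hη => ?_
        have h3 := app2 c a₁ a b ha₁ ha hb hc0 hcn hu hq o m N hm ρ h1 hρN η hη
        rw [← hΛ, ← hD2, ← hC4] at h3
        have h4 : ∑ y ∈ Λ, c (η y) * |r (η y + 1) - r (η y)| ≤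
            ∑ y ∈ Λ, (C1 * |(η y : ℝ) - ρ| + C2 * √ρ) :=
          Finset.sum_le_sum fun y _ => q_large c a₁ cm b₁ ha₁ hcm hb₁ hc0 hcn hu r κ R (A ρ) ρ hκ
            h1 hα1 hα2 hconc hrec hr (η y)
        rw [Finset.sum_add_distrib, ← Finset.mul_sum, Finset.sum_const, nsmul_eq_mul] at h4
        have hcard : (Λ.card : ℝ) = m := by simp [hΛ]
        rw [hcard] at h4
        have h5 : ∑ y ∈ Λ, |(η y : ℝ) - ρ| ≤ (D2 η + C4 * √ρ * m) / a := by
          rw [le_div_iff₀ ha]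
          linarith
        have h6 : Q η ≤ C1 / a * (m : ℝ)⁻¹ * D2 η + (C1 * C4 / a + C2) * √ρ := by
          calc Q η ≤ (m : ℝ)⁻¹ * (C1 * ((D2 η + C4 * √ρ * m) / a) + m * (C2 * √ρ)) := by
                refine mul_le_mul_of_nonneg_left (h4.trans ?_) (by positivity)
                gcongr
            _ = _ := by field_simp; ring
        have h7 := mul_le_mul_of_nonneg_left h6 (hf η)
        linarith
      rw [SS_add, SS_smul, SS_smul, ← hS] at h2
      have h8 : C1 / a * (m : ℝ)⁻¹ * SS c Λ N (fun η => f η * D2 η) ≤ C1 / a * B := by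
        have h9 : (m : ℝ)⁻¹ ≤ 1 := inv_le_one_of_one_le₀ hm1
        calc _ ≤ C1 / a * (m : ℝ)⁻¹ * B :=
              mul_le_mul_of_nonneg_left ((le_abs_self _).trans t2) (by positivity)
          _ ≤ C1 / a * 1 * B := by gcongr
          _ = _ := by ring
      have h10 : (C1 * C4 / a + C2) * √ρ * S ≤ (C1 * C4 / a + C2) * √(N : ℝ) * S := by
        gcongr
      have h11 : 0 ≤ a₁ * R * √(N : ℝ) * S := by positivity
      linarith
  -- combine
  set G : (ℤ → ℕ) → ℝ := fun η => ∑ y ∈ Λ, c (η y) - A ρ * m with hG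
  have hpt : ∀ η, ∑ x ∈ Λ, η x = N → |G η + DK c o m (K1 r o m) η| ≤ R / κ ^ 2 * Q η :=
    fun η hη => app1 c hc0 hcn r κ R (A ρ) ρ hκ hrec hr o m N hm hρN η hη
  have u1 : SS c Λ N (fun η => f η * G η) + SS c Λ N (fun η => f η * DK c o m (K1 r o m) η) ≤
      R / κ ^ 2 * SS c Λ N (fun η => f η * Q η) := by
    rw [← SS_add, ← SS_smul]
    refine SS_mono c hcpos Λ N _ _ fun η hη => ?_
    have := mul_le_mul_of_nonneg_left (abs_le.1 (hpt η hη)).2 (hf η)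
    linarith
  have u2 : -(R / κ ^ 2 * SS c Λ N (fun η => f η * Q η)) ≤
      SS c Λ N (fun η => f η * G η) + SS c Λ N (fun η => f η * DK c o m (K1 r o m) η) := by
    rw [← SS_add, ← SS_smul, neg_le_iff_add_nonneg, ← SS_add]
    have h0 : SS c Λ N (fun _ => 0) = 0 := by simp [SS]
    rw [← h0]
    refine SS_mono c hcpos Λ N _ _ fun η hη => ?_
    have := mul_le_mul_of_nonneg_left (abs_le.1 (hpt η hη)).1 (hf η)
    linarith
  have u3 : R / κ ^ 2 * SS c Λ N (fun η => f η * Q η) ≤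
      R / κ ^ 2 * (C1 / a * B + (a₁ * R + (C1 * C4 / a + C2)) * √(N : ℝ) * S) :=
    mul_le_mul_of_nonneg_left hQb (by positivity)
  have u4 := abs_le.1 t1
  have u5 : |SS c Λ N (fun η => f η * G η)| ≤ CB * B + CN * (√(N : ℝ) * S) := by
    have e : CB * B + CN * (√(N : ℝ) * S) = R / κ * B +
      R / κ ^ 2 * (C1 / a * B + (a₁ * R + (C1 * C4 / a + C2)) * √(N : ℝ) * S) := by
      rw [hCB, hCN]
      ring
    rw [e, abs_le]
    constructor <;> linarith [u4.1, u4.2]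
  refine u5.trans ?_
  have v1 : 0 ≤ CB * √(8 * a₁) * (√(N : ℝ) * S) := by positivity
  have v2 : 0 ≤ CN * X := by positivity
  rw [hBdef]
  linarith

lemma ent_nonneg (c : ℕ → ℝ) (hcpos : ∀ n : ℕ, 0 < n → 0 < c n) (Λ : Finset ℤ) (N : ℕ)
    (hΛ : Λ.Nonempty) (f : (ℤ → ℕ) → ℝ) (hf : ∀ η, 0 ≤ f η) : 0 ≤ wEnt (nuW c Λ N) f := by
  unfold wEnt
  rw [wE_eq, wE_eq, sub_nonneg]
  have hZ := SS_one_pos c hcpos Λ N hΛ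
  set Z := SS c Λ N (fun _ => 1) with hZdef
  have key := Real.convexOn_mul_log.map_sum_le (t := Finset.piAntidiag Λ N)
    (w := fun η => WW c Λ η / Z) (p := f)
    (fun η _ => div_nonneg (WW_pos c hcpos Λ η).le hZ.le)
    (by
      rw [← Finset.sum_div, div_eq_one_iff_eq hZ.ne', hZdef]
      simp [SS])
    (fun η _ => hf η)
  have e : ∀ g : (ℤ → ℕ) → ℝ, ∑ η ∈ Finset.piAntidiag Λ N, (WW c Λ η / Z) • g η = SS c Λ N g / Z := by
    intro g
    unfold SS
    rw [Finset.sum_div]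
    refine Finset.sum_congr rfl fun η _ => ?_
    rw [smul_eq_mul]
    ring
  rw [e f, e (fun η => f η * Real.log (f η))] at key
  exact key

lemma block_eq (c : ℕ → ℝ) (hcpos : ∀ n : ℕ, 0 < n → 0 < c n) (δ : ℝ) (a : ℤ) (m : ℕ)
    (η : ℤ → ℕ) :
    (∑ k ∈ Finset.range m, wE (nuW c (blockC a 1 k) (∑ x ∈ blockC a 1 k, η x))
      (fun ξ => ∑ x ∈ blockC a 1 k, (c (ξ x) - δ * (ξ x : ℝ)))) =
      ∑ x ∈ Finset.Ico a (a + (m : ℤ)), (c (η x) - δ * (η x : ℝ)) := by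
  have hb : ∀ k : ℕ, blockC a 1 k = {a + (k : ℤ)} := by
    intro k
    ext z
    simp only [blockC, Finset.mem_Ico, Finset.mem_singleton]
    push_cast
    omega
  have h1 : ∀ k ∈ Finset.range m, wE (nuW c (blockC a 1 k) (∑ x ∈ blockC a 1 k, η x))
      (fun ξ => ∑ x ∈ blockC a 1 k, (c (ξ x) - δ * (ξ x : ℝ))) =
      c (η (a + k)) - δ * (η (a + k) : ℝ) := by
    intro k _
    rw [hb k, wE_eq]
    simp only [Finset.sum_singleton]
    have hZ := SS_one_pos c hcpos {a + (k : ℤ)} (η (a + k)) (Finset.singleton_nonempty _)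
    rw [div_eq_iff hZ.ne', ← SS_smul]
    refine SS_congr c _ _ _ _ fun ξ hξ => ?_
    rw [Finset.sum_singleton] at hξ
    rw [hξ, mul_one]
  rw [Finset.sum_congr rfl h1]
  refine Finset.sum_bij (fun k _ => a + (k : ℤ)) ?_ ?_ ?_ ?_
  · intro k hk
    rw [Finset.mem_range] at hk
    rw [Finset.mem_Ico]
    omega
  · intro i _ j _ h
    omega
  · intro z hz
    rw [Finset.mem_Ico] at hz
    refine ⟨(z - a).toNat, ?_, ?_⟩
    · rw [Finset.mem_range]
      omega
    · omega
  · intro k _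
    rfl

end ZR

/-- Proposition 3.10: the two-blocks estimate.  Here `A` is the fugacity function
`ρ ↦ α(ρ)`, characterized by `α(ρ) > 0` and `μ_{α(ρ)}[η_x] = ρ`, and
`δ = α'(ρ)` for `ρ ≥ ρ₀`, `δ = α(ρ)/ρ` for `ρ < ρ₀`. -/
theorem statement12
    (c : ℕ → ℝ) (a₁ a₂ : ℝ) (k₀ : ℕ)
    (hc0 : c 0 = 0) (hcpos : ∀ n : ℕ, 0 < n → 0 < c n)
    (hLG : ∀ k : ℕ, |c (k + 1) - c k| ≤ a₁)
    (hk₀ : 0 < k₀) (ha₂ : 0 < a₂)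
    (hM : ∀ j k : ℕ, j + k₀ ≤ k → a₂ ≤ c k - c j)
    (A : ℝ → ℝ) (hA : ∀ ρ : ℝ, 0 < ρ → 0 < A ρ ∧ meanGC c (A ρ) = ρ)
    (ε : ℝ) (hε : 0 < ε) :
    ∃ (l L₀ : ℕ) (ρ₀ Cε : ℝ), 1 ≤ l ∧ 0 < ρ₀ ∧ 0 < Cε ∧
      ∀ (a : ℤ) (m N : ℕ), 1 ≤ m → L₀ ≤ m * l → 1 ≤ N →
        ∀ ρ δ : ℝ, ρ = (N : ℝ) / ((m * l : ℕ) : ℝ) →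
          (ρ₀ ≤ ρ → δ = deriv A ρ) → (ρ < ρ₀ → δ = A ρ / ρ) →
          ∀ f : (ℤ → ℕ) → ℝ, (∀ η, 0 ≤ f η) →
            (wCov (nuW c (Finset.Ico a (a + ((m * l : ℕ) : ℤ))) N) f
                (fun η => ∑ k ∈ Finset.range m,
                  wE (nuW c (blockC a l k) (∑ x ∈ blockC a l k, η x))
                    (fun ξ => ∑ x ∈ blockC a l k, (c (ξ x) - δ * (ξ x : ℝ))))) ^ 2
              ≤ (N : ℝ) * wE (nuW c (Finset.Ico a (a + ((m * l : ℕ) : ℤ))) N) f *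
                  (Cε * wE (nuW c (Finset.Ico a (a + ((m * l : ℕ) : ℤ))) N) f
                    + Cε * (((m * l : ℕ) : ℝ)) ^ 2 *
                        wDir c (Finset.Ico a (a + ((m * l : ℕ) : ℤ)))
                          (nuW c (Finset.Ico a (a + ((m * l : ℕ) : ℤ))) N)
                          (fun η => Real.sqrt (f η)) (fun η => Real.sqrt (f η))
                    + ε * wEnt (nuW c (Finset.Ico a (a + ((m * l : ℕ) : ℤ))) N) f) := by
  have ha₁ : 0 < a₁ := by
    have h1 := hLG 0
    have h2 := hcpos 1 one_pos
    rw [hc0, sub_zero, zero_add] at h1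
    exact h2.trans_le ((le_abs_self _).trans h1)
  have hcn : ∀ n, 0 ≤ c n := by
    intro n
    rcases Nat.eq_zero_or_pos n with h | h
    · rw [h, hc0]
    · exact (hcpos n h).le
  obtain ⟨a', b, ha', hb, hq⟩ := ZR.c_quasi c a₁ a₂ k₀ hLG hk₀ ha₂ hM
  obtain ⟨cm, hcm, hl⟩ := ZR.c_lower c a₂ k₀ hc0 hcpos hk₀ ha₂ hM
  obtain ⟨C, hC, hmain⟩ := ZR.main_bound c a₁ a' b cm hc0 hcpos ha₁ ha' hb hcm
    (fun j k => ZR.c_lip' c a₁ hLG j k) hq hl (fun n => ZR.c_upper c a₁ hc0 hLG n) A hA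
  refine ⟨1, 0, 1, 8 * C ^ 2, le_refl 1, one_pos, by positivity, ?_⟩
  intro o m N hm _ hN ρ δ _ _ _ f hf
  obtain ⟨n, rfl⟩ : ∃ n, N = n + 1 := ⟨N - 1, by omega⟩
  rw [mul_one]
  simp only [ZR.block_eq c hcpos δ o m]
  obtain ⟨α, hα⟩ := hmain o m n hm
  set Λ := Finset.Ico o (o + (m : ℤ)) with hΛ
  set N := n + 1 with hNdef
  have hne : Λ.Nonempty := ⟨o, by rw [hΛ, Finset.mem_Ico]; omega⟩
  have hent := ZR.ent_nonneg c hcpos Λ N hne f hf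
  have hZ := ZR.SS_one_pos c hcpos Λ N hne
  set Z := ZR.SS c Λ N (fun _ => 1) with hZdef
  have hdir : wDir c Λ (nuW c Λ N) (fun η => √(f η)) (fun η => √(f η)) =
      ZR.SS c Λ N (ZR.dirF c Λ (fun η => √(f η))) / Z := by
    unfold wDir
    rw [ZR.wE_eq]
    rfl
  have hdir0 : 0 ≤ ZR.SS c Λ N (ZR.dirF c Λ (fun η => √(f η))) := by
    refine ZR.SS_nonneg c hcpos Λ N _ fun η => ?_
    unfold ZR.dirF
    refine mul_nonneg (by norm_num) (Finset.sum_nonneg fun x _ => Finset.sum_nonneg fun y _ => ?_)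
    split_ifs
    · exact mul_nonneg (hcn _) (mul_self_nonneg _)
    · exact le_refl 0
  rw [hdir, ZR.wE_eq, ← hZdef]
  set E := ZR.SS c Λ N (ZR.dirF c Λ (fun η => √(f η))) with hE
  have hS0 : 0 ≤ ZR.SS c Λ N f := ZR.SS_nonneg c hcpos Λ N f hf
  have hf1 := hα f hf
  have h11 := hα (fun _ => 1) (fun _ => zero_le_one)
  have hdir1 : ZR.SS c Λ N (ZR.dirF c Λ (fun _ => √(1 : ℝ))) = 0 := by
    simp [ZR.SS, ZR.dirF]
  rw [hdir1] at h11
  rw [← hZdef] at h11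
  simp only [mul_zero, zero_mul, Real.sqrt_zero, zero_add, one_mul] at h11
  set S := ZR.SS c Λ N f with hS
  set G : (ℤ → ℕ) → ℝ := fun η => ∑ y ∈ Λ, c (η y) - α * m with hG
  have hcov : wCov (nuW c Λ N) f (fun η => ∑ x ∈ Λ, (c (η x) - δ * (η x : ℝ))) =
      (ZR.SS c Λ N (fun η => f η * G η) - S / Z * ZR.SS c Λ N G) / Z := by
    unfold wCov
    rw [ZR.wE_eq, ZR.wE_eq, ZR.wE_eq, ← hZdef, ← hS]
    have e0 : ∀ η : ℤ → ℕ, ∑ x ∈ Λ, η x = N →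
        ∑ x ∈ Λ, (c (η x) - δ * (η x : ℝ)) = G η + (α * m - δ * N) := by
      intro η hη
      rw [Finset.sum_sub_distrib, ← Finset.mul_sum, hG]
      have : ∑ x ∈ Λ, (η x : ℝ) = N := by rw [← hη]; push_cast; rfl
      rw [this]
      ring
    have e1 : ZR.SS c Λ N (fun η => f η * ∑ x ∈ Λ, (c (η x) - δ * (η x : ℝ))) =
        ZR.SS c Λ N (fun η => f η * G η) + (α * m - δ * N) * S := by
      rw [hS, ← ZR.SS_smul, ← ZR.SS_add]
      refine ZR.SS_congr c Λ N _ _ fun η hη => ?_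
      rw [e0 η hη]
      ring
    have e2 : ZR.SS c Λ N (fun η => ∑ x ∈ Λ, (c (η x) - δ * (η x : ℝ))) =
        ZR.SS c Λ N G + (α * m - δ * N) * Z := by
      rw [hZdef, ← ZR.SS_smul, ← ZR.SS_add]
      refine ZR.SS_congr c Λ N _ _ fun η hη => ?_
      rw [e0 η hη]
      ring
    rw [e1, e2]
    field_simp
    ring
  rw [hcov]
  have hN0 : (0 : ℝ) ≤ N := Nat.cast_nonneg _
  set X := √((m : ℝ) ^ 2 * N * E * S) with hX
  have hXsq : X ^ 2 = m ^ 2 * N * E * S := Real.sq_sqrt (by positivity)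
  have hNsq : √(N : ℝ) ^ 2 = N := Real.sq_sqrt hN0
  have hX0 : 0 ≤ X := Real.sqrt_nonneg _
  have hb1 : |ZR.SS c Λ N (fun η => f η * G η) - S / Z * ZR.SS c Λ N G| ≤
      C * (X + 2 * (√(N : ℝ) * S)) := by
    refine (abs_sub _ _).trans ?_
    rw [abs_mul, abs_of_nonneg (by positivity : 0 ≤ S / Z)]
    have h2 : S / Z * |ZR.SS c Λ N G| ≤ S / Z * (C * (√(N : ℝ) * Z)) :=
      mul_le_mul_of_nonneg_left h11 (by positivity)
    have h3 : S / Z * (C * (√(N : ℝ) * Z)) = C * (√(N : ℝ) * S) := by field_simp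
    linarith
  have hb2 : (ZR.SS c Λ N (fun η => f η * G η) - S / Z * ZR.SS c Λ N G) ^ 2 ≤
      8 * C ^ 2 * (m ^ 2 * N * E * S + N * S ^ 2) := by
    rw [← sq_abs]
    calc _ ≤ (C * (X + 2 * (√(N : ℝ) * S))) ^ 2 := by gcongr
      _ = C ^ 2 * (X + 2 * (√(N : ℝ) * S)) ^ 2 := by ring
      _ ≤ C ^ 2 * (8 * (X ^ 2 + √(N : ℝ) ^ 2 * S ^ 2)) := by
        gcongr
        nlinarith [sq_nonneg (X - 2 * (√(N : ℝ) * S)), sq_nonneg X]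
      _ = _ := by rw [hXsq, hNsq]; ring
  have hfin : 0 ≤ (N : ℝ) * (S / Z) * (ε * wEnt (nuW c Λ N) f) := by positivity
  rw [div_pow]
  have hlast : (ZR.SS c Λ N (fun η => f η * G η) - S / Z * ZR.SS c Λ N G) ^ 2 / Z ^ 2 ≤
      (N : ℝ) * (S / Z) * (8 * C ^ 2 * (S / Z) + 8 * C ^ 2 * (m : ℝ) ^ 2 * (E / Z)) := by
    rw [div_le_iff₀ (by positivity)]
    refine hb2.trans (le_of_eq ?_)
    field_simp
    ring
  linarith
end
end
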